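/- arXiv:math/0506171 — 3 statements merged into one kernel-verified Lean document; each statement's English description precedes it below -/
import Mathlib

section
/- Let U be an irreducible module with highest weight χ over a complex semisimple Lie algebra g, and suppose U admits a nondegenerate g-invariant alternating bilinear form (U is symplectic). Then χ is not a root of g. -/
open LieAlgebra LieModule LieAlgebra.IsKilling in
lemma aux_sum_ne_zero
    (L : Type*) [LieRing L] [LieAlgebra ℂ L] [FiniteDimensional ℂ L]
    [LieAlgebra.IsKilling ℂ L]
    (H : LieSubalgebra ℂ L) [H.IsCartanSubalgebra]
    (P : Set (H → ℂ))
    (hP_cover : ∀ χ' : H → ℂ, χ' ≠ 0 → LieAlgebra.rootSpace H χ' ≠ ⊥ →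
      (χ' ∈ P ↔ ¬(-χ' ∈ P)))
    (hP_add : ∀ χ₁ ∈ P, ∀ χ₂ ∈ P,
      LieAlgebra.rootSpace H (χ₁ + χ₂) ≠ ⊥ → χ₁ + χ₂ ∈ P) (n : ℕ) :
    ∀ s : Multiset (Weight ℂ H L), s.card = n + 1 →
      (∀ b ∈ s, (b : H → ℂ) ≠ 0 ∧ (b : H → ℂ) ∈ P) →
      (s.map (fun b : Weight ℂ H L => (b : H → ℂ))).sum ≠ 0 := by
  induction n with
  | zero =>
    intro s hs hb
    obtain ⟨a, rfl⟩ := Multiset.card_eq_one.1 hs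
    simpa using (hb a (by simp)).1
  | succ n ih =>
    intro s hs hb h0
    obtain ⟨a, t, rfl⟩ : ∃ a t, s = a ::ₘ t := by
      obtain ⟨a, ha⟩ := Multiset.card_pos_iff_exists_mem.1 (by omega : 0 < s.card)
      exact ⟨a, Multiset.exists_cons_of_mem ha⟩
    have ha := hb a (by simp)
    have key : ∃ b ∈ t, 0 < chainTopCoeff (a : H → ℂ) b := by
      by_contra! hcon
      have h1 : ∀ t' : Multiset (Weight ℂ H L), t' ≤ t → ∃ k : ℕ,
          (t'.map (fun b : Weight ℂ H L => (b : H → ℂ))).sum (coroot a) = k := by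
        intro t'
        induction t' using Multiset.induction with
        | empty => intro _; exact ⟨0, by simp⟩
        | cons b t' ih' =>
          intro hle
          obtain ⟨k, hk⟩ := ih' ((Multiset.le_cons_self _ _).trans hle)
          have hb0 := hcon b (Multiset.mem_of_le hle (by simp))
          refine ⟨chainLength a b + k, ?_⟩
          have := apply_coroot_eq_cast' a b
          rw [Nat.le_zero.1 hb0] at this
          simp [hk, this]
      obtain ⟨k, hk⟩ := h1 t le_rfl
      have h2 := congrFun h0 (coroot a)
      rw [Multiset.map_cons, Multiset.sum_cons, Pi.add_apply, hk,
        root_apply_coroot (fun h => ha.1 h)] at h2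
      have : ((2 + k : ℕ) : ℂ) = 0 := by simpa using h2
      have := Nat.cast_eq_zero.1 this
      omega
    obtain ⟨b, hbt, hpos⟩ := key
    obtain ⟨t', rfl⟩ := Multiset.exists_cons_of_mem hbt
    have hb' := hb b (by simp)
    have hne : rootSpace H ((a : H → ℂ) + b) ≠ ⊥ := by
      have := genWeightSpace_nsmul_add_ne_bot_of_le (a : H → ℂ) b (n := 1) hpos
      rwa [one_smul] at this
    have hmem := hP_add _ ha.2 _ hb'.2 hne
    have hab : (a : H → ℂ) + b ≠ 0 := by
      intro h
      have h3 : (b : H → ℂ) = -a := (neg_eq_of_add_eq_zero_right h).symm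
      exact (hP_cover a ha.1 a.genWeightSpace_ne_bot).1 ha.2 (h3 ▸ hb'.2)
    refine ih ((⟨(a : H → ℂ) + b, hne⟩ : Weight ℂ H L) ::ₘ t') (by simpa using hs) ?_ ?_
    · intro c hc
      rcases Multiset.mem_cons.1 hc with rfl | hc
      · exact ⟨hab, hmem⟩
      · exact hb c (by simp [hc])
    · rw [← h0]
      simp only [Multiset.map_cons, Multiset.sum_cons]
      rw [← add_assoc]
      rfl

lemma aux_generate
    (L : Type*) [LieRing L] [LieAlgebra ℂ L]
    (U : Type*) [AddCommGroup U] [Module ℂ U] [LieRingModule L U] [LieModule ℂ L U]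
    (hirr : ∀ W : LieSubmodule ℂ L U, W = ⊥ ∨ W = ⊤)
    (N Q : Submodule ℂ L) (hNQ : N ⊔ Q = ⊤) (v : U) (hv : v ≠ 0)
    (hQ : ∀ q ∈ Q, ⁅q, v⁆ ∈ Submodule.span ℂ {v})
    (S : Submodule ℂ U) (hvS : v ∈ S) (hS : ∀ y ∈ N, ∀ s ∈ S, ⁅y, s⁆ ∈ S) : S = ⊤ := by
  let T : ℕ → Submodule ℂ U := fun n => Nat.rec (Submodule.span ℂ {v})
    (fun _ R => R ⊔ Submodule.span ℂ {w | ∃ y ∈ N, ∃ t ∈ R, w = ⁅y, t⁆}) n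
  have hT0 : T 0 = Submodule.span ℂ {v} := rfl
  have hTs : ∀ n, T (n + 1) = T n ⊔ Submodule.span ℂ {w | ∃ y ∈ N, ∃ t ∈ T n, w = ⁅y, t⁆} :=
    fun _ => rfl
  have hTmono : Monotone T := monotone_nat_of_le_succ fun n => by rw [hTs]; exact le_sup_left
  have hN : ∀ n, ∀ y ∈ N, ∀ t ∈ T n, ⁅y, t⁆ ∈ T (n + 1) := by
    intro n y hy t ht
    rw [hTs]
    exact Submodule.mem_sup_right (Submodule.subset_span ⟨y, hy, t, ht, rfl⟩)
  have hdec : ∀ x : L, ∃ y ∈ N, ∃ q ∈ Q, y + q = x := fun x =>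
    Submodule.mem_sup.1 (hNQ ▸ Submodule.mem_top)
  have hQT : ∀ n, ∀ q ∈ Q, ∀ t ∈ T n, ⁅q, t⁆ ∈ T n := by
    intro n
    induction n with
    | zero =>
      intro q hq t ht
      rw [hT0] at ht ⊢
      obtain ⟨c, rfl⟩ := Submodule.mem_span_singleton.1 ht
      rw [lie_smul]
      exact Submodule.smul_mem _ _ (hQ q hq)
    | succ n ih =>
      intro q hq t ht
      rw [hTs] at ht
      obtain ⟨t1, ht1, t2, ht2, rfl⟩ := Submodule.mem_sup.1 ht
      rw [lie_add]
      refine add_mem (hTmono (Nat.le_succ n) (ih q hq t1 ht1)) ?_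
      clear ht
      induction ht2 using Submodule.span_induction with
      | mem w hw =>
        obtain ⟨y, hy, t, ht, rfl⟩ := hw
        rw [leibniz_lie]
        refine add_mem ?_ (hN n y hy _ (ih q hq t ht))
        obtain ⟨y', hy', q', hq', he⟩ := hdec ⁅q, y⁆
        rw [← he, add_lie]
        exact add_mem (hN n y' hy' t ht) (hTmono (Nat.le_succ n) (ih q' hq' t ht))
      | zero => simp
      | add _ _ _ _ h1 h2 => rw [lie_add]; exact add_mem h1 h2
      | smul c _ _ h1 => rw [lie_smul]; exact Submodule.smul_mem _ _ h1
  let W : LieSubmodule ℂ L U :=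
    { (⨆ n, T n) with
      lie_mem := by
        intro x m hm
        replace hm : m ∈ ⨆ n, T n := hm
        change ⁅x, m⁆ ∈ ⨆ n, T n
        rw [Submodule.mem_iSup_of_directed _ hTmono.directed_le] at hm ⊢
        obtain ⟨n, hn⟩ := hm
        obtain ⟨y, hy, q, hq, rfl⟩ := hdec x
        refine ⟨n + 1, ?_⟩
        rw [add_lie]
        exact add_mem (hN n y hy m hn) (hTmono (Nat.le_succ n) (hQT n q hq m hn)) }
  have hvW : v ∈ W := by
    change v ∈ ⨆ n, T n
    exact Submodule.mem_iSup_of_mem 0 (Submodule.mem_span_singleton_self v)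
  have hWtop : W = ⊤ := by
    rcases hirr W with h | h
    · rw [h] at hvW
      exact absurd ((LieSubmodule.mem_bot v).1 hvW) hv
    · exact h
  have hTS : ∀ n, T n ≤ S := by
    intro n
    induction n with
    | zero => rw [hT0, Submodule.span_singleton_le_iff_mem]; exact hvS
    | succ n ih =>
      rw [hTs]
      refine sup_le ih (Submodule.span_le.2 ?_)
      rintro w ⟨y, hy, t, ht, rfl⟩
      exact hS y hy t (ih ht)
  rw [eq_top_iff]
  intro u _
  have hu : u ∈ W := hWtop ▸ LieSubmodule.mem_top u
  exact (iSup_le hTS : (⨆ n, T n) ≤ S) hu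



/-- If the irreducible highest-weight module `U` over a complex semisimple Lie algebra
admits a nondegenerate invariant symplectic form, then its highest weight `χ` is not
a root of `g`. -/
theorem highest_weight_of_symplectic_module_not_root
    (L : Type*) [LieRing L] [LieAlgebra ℂ L] [FiniteDimensional ℂ L]
    [LieAlgebra.IsSemisimple ℂ L]
    (H : LieSubalgebra ℂ L) [H.IsCartanSubalgebra]
    -- a positive system of roots
    (P : Set (H → ℂ))
    (hP_cover : ∀ χ' : H → ℂ, χ' ≠ 0 → LieAlgebra.rootSpace H χ' ≠ ⊥ →
      (χ' ∈ P ↔ ¬(-χ' ∈ P)))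
    (hP_add : ∀ χ₁ ∈ P, ∀ χ₂ ∈ P,
      LieAlgebra.rootSpace H (χ₁ + χ₂) ≠ ⊥ → χ₁ + χ₂ ∈ P)
    -- U is an irreducible finite-dimensional module …
    (U : Type*) [AddCommGroup U] [Module ℂ U] [LieRingModule L U] [LieModule ℂ L U]
    [FiniteDimensional ℂ U]
    (hirr : ∀ W : LieSubmodule ℂ L U, W = ⊥ ∨ W = ⊤)
    -- … with a nondegenerate invariant symplectic form
    (B : U →ₗ[ℂ] U →ₗ[ℂ] ℂ)
    (halt : ∀ u : U, B u u = 0)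
    (hnondeg : ∀ u : U, (∀ w : U, B u w = 0) → u = 0)
    (hBinv : ∀ (x : L) (u w : U), B ⁅x, u⁆ w + B u ⁅x, w⁆ = 0)
    -- χ is the highest weight of U, with highest weight vector v
    (χ : H → ℂ) (v : U) (hv : v ≠ 0)
    (hweight : ∀ h : H, ⁅(h : L), v⁆ = χ h • v)
    (hhw : ∀ χ' ∈ P, ∀ x ∈ LieAlgebra.rootSpace H χ', ⁅x, v⁆ = 0) :
    -- χ is not a root of g
    ¬(χ ≠ 0 ∧ LieAlgebra.rootSpace H χ ≠ ⊥) := by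
  rintro ⟨hχ0, hχr⟩
  have hK : LieAlgebra.IsKilling ℂ L := inferInstance
  let α : LieModule.Weight ℂ H L := ⟨χ, hχr⟩
  have hα : α.IsNonZero := fun h => hχ0 h
  -- the sl2 triple
  obtain ⟨h, e, f, ht, he, hf⟩ :=
    LieAlgebra.IsKilling.exists_isSl2Triple_of_weight_isNonZero hα
  have hh : h = LieAlgebra.IsKilling.coroot α := ht.h_eq_coroot hα he hf
  have hhv : ⁅h, v⁆ = (2 : ℂ) • v := by
    rw [hh, hweight]
    congr 1
    exact LieAlgebra.IsKilling.root_apply_coroot hα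
  have hχP : χ ∈ P := by
    rw [hP_cover χ hχ0 hχr]
    intro hneg
    have prim : ht.symm.HasPrimitiveVectorWith v (-2 : ℂ) :=
      ⟨hv, by rw [neg_lie, hhv, neg_smul], hhw _ hneg f hf⟩
    obtain ⟨n, hn⟩ := prim.exists_nat
    have h1 : ((n + 2 : ℕ) : ℂ) = 0 := by push_cast; rw [← hn]; ring
    have := Nat.cast_eq_zero.1 h1
    omega
  have prim : ht.HasPrimitiveVectorWith v (2 : ℂ) := ⟨hv, hhv, hhw _ hχP e he⟩
  have hne : ⁅f, ⁅f, v⁆⁆ ≠ 0 := by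
    intro h0
    have h1 := prim.lie_e_pow_succ_toEnd_f 0
    have h2 := prim.lie_e_pow_succ_toEnd_f 1
    simp [pow_succ, h0] at h1 h2
    have h4 : ⁅f, v⁆ = 0 := by
      rcases smul_eq_zero.1 h2.symm with h5 | h5
      · norm_num at h5
      · exact h5
    rw [h4, lie_zero] at h1
    have h3 : (2 : ℂ) • v = 0 := by simpa using h1.symm
    exact hv (by simpa using h3)
  -- the weight of f f v
  have hfH : ∀ k : H, ⁅(k : L), f⁆ = (-χ k) • f := fun k =>
    LieAlgebra.IsKilling.lie_eq_smul_of_mem_rootSpace hf k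
  have hffv : ∀ k : H, ⁅(k : L), ⁅f, ⁅f, v⁆⁆⁆ = (-χ k) • ⁅f, ⁅f, v⁆⁆ := by
    intro k
    rw [leibniz_lie, leibniz_lie (k : L) f v, hfH, hweight]
    simp only [smul_lie, lie_add, lie_smul, ← add_smul]
    congr 1
    ring
  -- generating subspaces
  let N : Submodule ℂ L := Submodule.span ℂ {y | ∃ b : LieModule.Weight ℂ H L,
    ((b : H → ℂ) ≠ 0 ∧ (b : H → ℂ) ∈ P) ∧ y ∈ LieAlgebra.rootSpace H (-(b : H → ℂ))}
  let Q : Submodule ℂ L := Submodule.span ℂ {y | y ∈ H ∨ ∃ χ' ∈ P,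
    y ∈ LieAlgebra.rootSpace H χ'}
  have hNQ : N ⊔ Q = ⊤ := by
    have htop := LieModule.iSup_genWeightSpace_eq_top' ℂ H L
    have htop' := congrArg LieSubmodule.toSubmodule htop
    rw [LieSubmodule.iSup_toSubmodule, LieSubmodule.top_toSubmodule] at htop'
    rw [eq_top_iff, ← htop']
    refine iSup_le fun b x hx => ?_
    by_cases hb : (b : H → ℂ) = 0
    · refine Submodule.mem_sup_right (Submodule.subset_span (Or.inl ?_))
      rw [hb] at hx
      have h5 : x ∈ LieAlgebra.rootSpace H (0 : H → ℂ) := hx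
      rw [LieAlgebra.rootSpace_zero_eq] at h5
      exact h5
    · by_cases hbP : (b : H → ℂ) ∈ P
      · exact Submodule.mem_sup_right (Submodule.subset_span (Or.inr ⟨b, hbP, hx⟩))
      · refine Submodule.mem_sup_left (Submodule.subset_span ⟨-b, ⟨?_, ?_⟩, ?_⟩)
        · rw [LieModule.Weight.coe_neg]; exact neg_ne_zero.2 hb
        · rw [LieModule.Weight.coe_neg]
          by_contra hcon
          exact hbP ((hP_cover b hb b.genWeightSpace_ne_bot).2 hcon)
        · rw [LieModule.Weight.coe_neg, neg_neg]; exact hx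
  let G : Set U := {u | ∃ s : Multiset (LieModule.Weight ℂ H L),
    (∀ b ∈ s, (b : H → ℂ) ≠ 0 ∧ (b : H → ℂ) ∈ P) ∧ (s = 0 → u = v) ∧
    ∀ k : H, ⁅(k : L), u⁆ =
      (χ k - (s.map (fun b : LieModule.Weight ℂ H L => (b : H → ℂ))).sum k) • u}
  have hStop : Submodule.span ℂ G = ⊤ := by
    refine aux_generate L U hirr N Q hNQ v hv ?_ _ ?_ ?_
    · intro q hq
      induction hq using Submodule.span_induction with
      | mem q hq =>
        rcases hq with hq | ⟨χ', hχ', hq⟩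
        · rw [hweight ⟨q, hq⟩]
          exact Submodule.smul_mem _ _ (Submodule.mem_span_singleton_self v)
        · rw [hhw χ' hχ' q hq]; exact zero_mem _
      | zero => simp
      | add _ _ _ _ h1 h2 => rw [add_lie]; exact add_mem h1 h2
      | smul c _ _ h1 => rw [smul_lie]; exact Submodule.smul_mem _ _ h1
    · exact Submodule.subset_span ⟨0, by simp, fun _ => rfl, by simpa using hweight⟩
    · intro y hy s hs
      induction hy using Submodule.span_induction with
      | mem y hy =>
        obtain ⟨b, hb, hy⟩ := hy
        induction hs using Submodule.span_induction with
        | mem u hu =>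
          obtain ⟨s, hs1, -, hs3⟩ := hu
          refine Submodule.subset_span ⟨b ::ₘ s, ?_, fun h => absurd h (by simp), ?_⟩
          · intro c hc
            rcases Multiset.mem_cons.1 hc with rfl | hc
            · exact hb
            · exact hs1 c hc
          · intro k
            have h6 : ⁅(k : L), y⁆ = (-(b : H → ℂ)) k • y :=
              LieAlgebra.IsKilling.lie_eq_smul_of_mem_rootSpace hy k
            rw [leibniz_lie, h6, hs3, smul_lie, lie_smul, ← add_smul, Multiset.map_cons,
              Multiset.sum_cons]
            congr 1
            simp only [Pi.neg_apply, Pi.add_apply]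
            ring
        | zero => simp
        | add _ _ _ _ h1 h2 => rw [lie_add]; exact add_mem h1 h2
        | smul c _ _ h1 => rw [lie_smul]; exact Submodule.smul_mem _ _ h1
      | zero => simp
      | add _ _ _ _ h1 h2 => rw [add_lie]; exact add_mem h1 h2
      | smul c _ _ h1 => rw [smul_lie]; exact Submodule.smul_mem _ _ h1
  -- the pairing with f f v vanishes
  have hzero : ∀ u : U, B u ⁅f, ⁅f, v⁆⁆ = 0 := by
    intro u
    have hu : u ∈ Submodule.span ℂ G := hStop ▸ Submodule.mem_top
    induction hu using Submodule.span_induction with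
    | mem u hu =>
      obtain ⟨s, hs1, hs2, hs3⟩ := hu
      by_cases hs0 : s = 0
      · rw [hs2 hs0]
        have h7 := hBinv f v ⁅f, v⁆
        rwa [halt, zero_add] at h7
      · obtain ⟨n, hn⟩ := Nat.exists_eq_succ_of_ne_zero
          (fun h => hs0 (Multiset.card_eq_zero.1 h))
        have h8 := aux_sum_ne_zero L H P hP_cover hP_add n s hn hs1
        obtain ⟨k, hk⟩ := Function.ne_iff.1 h8
        have h9 := hBinv k u ⁅f, ⁅f, v⁆⁆
        rw [hs3, hffv, map_smul, map_smul, LinearMap.smul_apply, ← add_smul] at h9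
        rcases smul_eq_zero.1 h9 with h10 | h10
        · exfalso
          apply hk
          simp only [Pi.zero_apply]
          linear_combination -h10
        · exact h10
    | zero => simp
    | add _ _ _ _ h1 h2 => rw [map_add, LinearMap.add_apply, h1, h2, add_zero]
    | smul c _ _ h1 => rw [map_smul, LinearMap.smul_apply, h1, smul_zero]
  apply hne
  apply hnondeg
  intro w
  have h11 := halt (⁅f, ⁅f, v⁆⁆ + w)
  simp only [map_add, LinearMap.add_apply, halt, hzero, zero_add, add_zero] at h11
  exact h11
end

section
/- (Panyushev-type lemma) Let X and Y be finite-dimensional complex vector spaces, Γ ⊆ GL(Y) a finite subgroup, and ψ : X → Y/Γ a dominant equidimensional morphism of affine varieties. Assume the coordinate ring ℂ[Y/Γ] = ℂ[Y]^Γ is integrally closed in ℂ[X]. Then Γ is generated by (pseudo-)reflections and Y/Γ is smooth, i.e., ℂ[Y]^Γ is a polynomial ring. -/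
open MvPolynomial

/-- The Zariski topology on affine space `σ → ℂ`. -/
def zariskiTop (σ : Type*) : TopologicalSpace (σ → ℂ) :=
  TopologicalSpace.generateFrom
    {U | ∃ f : MvPolynomial σ ℂ, U = {p | MvPolynomial.eval p f ≠ 0}}

/-- The subalgebra of `Γ`-invariant polynomials on `ℂᵏ`. -/
noncomputable def invariantSubalgebra (k : ℕ)
    (Γ : Subgroup ((Fin k → ℂ) ≃ₗ[ℂ] (Fin k → ℂ))) :
    Subalgebra ℂ (MvPolynomial (Fin k) ℂ) where
  carrier := {f | ∀ g ∈ Γ, ∀ x : Fin k → ℂ, eval (g x) f = eval x f}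
  mul_mem' := by
    intro a b ha hb g hg x
    simp [map_mul, ha g hg x, hb g hg x]
  add_mem' := by
    intro a b ha hb g hg x
    simp [map_add, ha g hg x, hb g hg x]
  algebraMap_mem' := by
    intro r g hg x
    simp


namespace FGQ

/-- Power series with infinite radius of convergence. -/
def Ent (p : PowerSeries ℂ) : Prop :=
  ∀ ρ : ℝ, 0 ≤ ρ → Summable fun n => ‖PowerSeries.coeff n p‖ * ρ ^ n

/-- Sum of a power series at a point. -/
noncomputable def psum (p : PowerSeries ℂ) (s : ℂ) : ℂ := ∑' n, PowerSeries.coeff n p * s ^ n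

lemma Ent.summable {p : PowerSeries ℂ} (h : Ent p) (s : ℂ) :
    Summable fun n => ‖PowerSeries.coeff n p * s ^ n‖ := by
  simpa [norm_mul, norm_pow] using h ‖s‖ (norm_nonneg _)

lemma psum_add {p q : PowerSeries ℂ} (hp : Ent p) (hq : Ent q) (s : ℂ) :
    psum (p + q) s = psum p s + psum q s := by
  unfold psum
  rw [← Summable.tsum_add (hp.summable s).of_norm (hq.summable s).of_norm]
  simp [add_mul]

lemma psum_mul {p q : PowerSeries ℂ} (hp : Ent p) (hq : Ent q) (s : ℂ) :
    psum (p * q) s = psum p s * psum q s := by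
  unfold psum
  rw [tsum_mul_tsum_eq_tsum_sum_antidiagonal_of_summable_norm (hp.summable s) (hq.summable s)]
  congr 1
  ext n
  rw [PowerSeries.coeff_mul, Finset.sum_mul]
  refine Finset.sum_congr rfl fun x hx => ?_
  rw [← Finset.HasAntidiagonal.mem_antidiagonal.1 hx, pow_add]
  ring

lemma Ent.of_bdd {p : PowerSeries ℂ}
    (h : ∀ ρ : ℝ, 0 < ρ → ∃ C, ∀ n, ‖PowerSeries.coeff n p‖ * ρ ^ n ≤ C) : Ent p := by
  intro ρ hρ
  obtain ⟨C, hC⟩ := h (2 * (ρ + 1)) (by positivity)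
  refine Summable.of_nonneg_of_le (fun n => by positivity) (fun n => ?_)
    ((summable_geometric_two).mul_left C)
  have h1 := hC n
  rw [mul_pow] at h1
  have : (1 / 2 : ℝ) ^ n * 2 ^ n = 1 := by rw [← mul_pow]; norm_num
  calc _ ≤ ‖PowerSeries.coeff n p‖ * (ρ + 1) ^ n := by gcongr; linarith
    _ = (‖PowerSeries.coeff n p‖ * (2 ^ n * (ρ + 1) ^ n)) * (1 / 2) ^ n := by
        rw [show (‖PowerSeries.coeff n p‖ * (2 ^ n * (ρ + 1) ^ n)) * (1 / 2 : ℝ) ^ n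
          = ‖PowerSeries.coeff n p‖ * (ρ + 1) ^ n * ((1 / 2 : ℝ) ^ n * 2 ^ n) by ring, this, mul_one]
    _ ≤ _ := by gcongr

lemma ent_of_ode {ι : Type*} [Fintype ι] (p : ι → PowerSeries ℂ) (q : ι → ι → PowerSeries ℂ)
    (hq : ∀ i j, Ent (q i j))
    (h : ∀ i, PowerSeries.derivative ℂ (p i) = ∑ j, q i j * p j) (i : ι) : Ent (p i) := by
  refine Ent.of_bdd fun ρ hρ => ?_
  -- total size
  set Q : ℝ := ∑ i, ∑ j, ∑' n, ‖PowerSeries.coeff n (q i j)‖ * ρ ^ n with hQ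
  obtain ⟨M, hM⟩ := exists_nat_ge (ρ * Q)
  -- bound on the first terms
  set C : ℝ := ∑ i, ∑ n ∈ Finset.range (M + 1), ‖PowerSeries.coeff n (p i)‖ * ρ ^ n with hC
  have hC0 : 0 ≤ C := by positivity
  have key : ∀ n, ∀ i, ‖PowerSeries.coeff n (p i)‖ * ρ ^ n ≤ C := by
    intro n
    induction n using Nat.strong_induction_on with
    | _ n ih =>
      intro i
      by_cases hn : n ≤ M
      · calc _ ≤ ∑ n ∈ Finset.range (M + 1), ‖PowerSeries.coeff n (p i)‖ * ρ ^ n :=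
              Finset.single_le_sum (f := fun n => ‖PowerSeries.coeff n (p i)‖ * ρ ^ n)
                (fun n _ => by positivity) (by simp; omega)
          _ ≤ _ := Finset.single_le_sum (f := fun i => ∑ n ∈ Finset.range (M + 1),
                ‖PowerSeries.coeff n (p i)‖ * ρ ^ n)
                (fun n _ => by positivity) (by simp)
      · obtain ⟨n, rfl⟩ : ∃ n', n = n' + 1 := ⟨n - 1, by omega⟩
        have h1 : PowerSeries.coeff (n + 1) (p i) * ((n : ℂ) + 1)
            = ∑ j, ∑ x ∈ Finset.HasAntidiagonal.antidiagonal n,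
              PowerSeries.coeff x.1 (q i j) * PowerSeries.coeff x.2 (p j) := by
          rw [← PowerSeries.coeff_derivative, h i, map_sum]
          simp [PowerSeries.coeff_mul]
        have h2 : ‖PowerSeries.coeff (n + 1) (p i)‖ * ((n : ℝ) + 1) * ρ ^ n ≤ Q * C := by
          have : ‖((n : ℂ) + 1)‖ = (n : ℝ) + 1 := by
            rw [← Nat.cast_succ, Complex.norm_natCast]; push_cast; rfl
          rw [← this, ← norm_mul, h1]
          calc _ ≤ (∑ j, ∑ x ∈ Finset.HasAntidiagonal.antidiagonal n,
              ‖PowerSeries.coeff x.1 (q i j) * PowerSeries.coeff x.2 (p j)‖) * ρ ^ n := by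
                gcongr
                refine (norm_sum_le _ _).trans (Finset.sum_le_sum fun j _ => norm_sum_le _ _)
            _ = ∑ j, ∑ x ∈ Finset.HasAntidiagonal.antidiagonal n,
              (‖PowerSeries.coeff x.1 (q i j)‖ * ρ ^ x.1) *
                (‖PowerSeries.coeff x.2 (p j)‖ * ρ ^ x.2) := by
                rw [Finset.sum_mul]
                refine Finset.sum_congr rfl fun j _ => ?_
                rw [Finset.sum_mul]
                refine Finset.sum_congr rfl fun x hx => ?_
                rw [← Finset.HasAntidiagonal.mem_antidiagonal.1 hx, pow_add, norm_mul]
                ring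
            _ ≤ ∑ j, ∑ x ∈ Finset.HasAntidiagonal.antidiagonal n,
              (‖PowerSeries.coeff x.1 (q i j)‖ * ρ ^ x.1) * C := by
                refine Finset.sum_le_sum fun j _ => Finset.sum_le_sum fun x hx => ?_
                gcongr
                exact ih _ (by have := Finset.HasAntidiagonal.mem_antidiagonal.1 hx; omega) j
            _ = (∑ j, ∑ l ∈ Finset.range (n + 1),
              (‖PowerSeries.coeff l (q i j)‖ * ρ ^ l)) * C := by
                rw [Finset.sum_mul]
                refine Finset.sum_congr rfl fun j _ => ?_
                rw [Finset.sum_mul, Finset.Nat.sum_antidiagonal_eq_sum_range_succ_mk]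
            _ ≤ (∑ j, ∑' n, ‖PowerSeries.coeff n (q i j)‖ * ρ ^ n) * C := by
                gcongr with j _
                exact Summable.sum_le_tsum _ (fun n _ => by positivity) (hq i j ρ hρ.le)
            _ ≤ Q * C := by
                gcongr
                exact Finset.single_le_sum (f := fun i => ∑ j, ∑' n,
                  ‖PowerSeries.coeff n (q i j)‖ * ρ ^ n) (fun i _ =>
                  Finset.sum_nonneg fun j _ => tsum_nonneg fun n => by positivity)
                  (Finset.mem_univ i)
        have h3 : ρ * Q ≤ (n : ℝ) + 1 := hM.trans (by
          have : M ≤ n + 1 := by omega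
          exact_mod_cast this)
        have hn0 : (0 : ℝ) < (n : ℝ) + 1 := by positivity
        have h4 : (‖PowerSeries.coeff (n + 1) (p i)‖ * ρ ^ (n + 1)) * ((n : ℝ) + 1)
            ≤ C * ((n : ℝ) + 1) := by
          calc _ = (‖PowerSeries.coeff (n + 1) (p i)‖ * ((n : ℝ) + 1) * ρ ^ n) * ρ := by ring
            _ ≤ (Q * C) * ρ := by gcongr
            _ = C * (ρ * Q) := by ring
            _ ≤ _ := by gcongr
        exact le_of_mul_le_mul_right h4 hn0
  exact ⟨C, fun n => key n i⟩

open FormalMultilinearSeries in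
lemma coeff_eq_zero_of_growth {p : PowerSeries ℂ} (hp : Ent p) (d : ℕ) (C : ℝ)
    (h : ∀ s, ‖psum p s‖ ≤ C * (1 + ‖s‖) ^ d) (n : ℕ) (hn : d < n) :
    PowerSeries.coeff n p = 0 := by
  let P : FormalMultilinearSeries ℂ ℂ ℂ := ofScalars ℂ (fun n => PowerSeries.coeff n p)
  have hrad : P.radius = ⊤ := by
    refine ENNReal.eq_top_of_forall_nnreal_le ?_
    intro r
    refine P.le_radius_of_summable_norm ?_
    simpa [P, ofScalars_norm] using hp r r.2
  have hps : HasFPowerSeriesOnBall P.sum P 0 P.radius :=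
    P.hasFPowerSeriesOnBall (by rw [hrad]; exact ENNReal.zero_lt_top)
  have hsum : P.sum = psum p := by
    ext s
    simp [P, FormalMultilinearSeries.sum, psum, mul_comm]
  rw [hsum, hrad] at hps
  have hd : Differentiable ℂ (psum p) := by
    have := hps.differentiableOn
    simpa [Metric.eball_top, differentiableOn_univ] using this
  have h1 := hps.factorial_smul 1 n
  have h1' : (n.factorial : ℂ) * PowerSeries.coeff n p = iteratedDeriv n (psum p) 0 := by
    rw [iteratedDeriv_eq_iteratedFDeriv, ← h1]
    simp [P]
  have h2 : ∀ R : ℝ, 0 < R → ‖iteratedDeriv n (psum p) 0‖ ≤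
      n.factorial * (C * (1 + R) ^ d) / R ^ n := fun R hR =>
    Complex.norm_iteratedDeriv_le_of_forall_mem_sphere_norm_le n hR hd.diffContOnCl
      (fun z hz => by
        have := h z
        rwa [mem_sphere_zero_iff_norm.1 hz] at this)
  have hC0 : 0 ≤ C := by
    have := (norm_nonneg _).trans (h 0)
    simpa using this
  have h3 : ∀ R : ℝ, 1 ≤ R → ‖iteratedDeriv n (psum p) 0‖ ≤ (n.factorial * C * 2 ^ d) * R⁻¹ := by
    intro R hR
    refine (h2 R (by linarith)).trans ?_
    rw [div_le_iff₀ (by positivity)]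
    obtain ⟨e, rfl⟩ : ∃ e, n = d + 1 + e := ⟨n - d - 1, by omega⟩
    have : (1 + R) ^ d ≤ 2 ^ d * R ^ d := by
      rw [← mul_pow]; gcongr; linarith
    have h5 : R⁻¹ * R ^ (d + 1 + e) = R ^ (d + e) := by
      field_simp; ring
    rw [mul_assoc, h5]
    have : R ^ d ≤ R ^ (d + e) := pow_le_pow_right₀ hR (by omega)
    calc _ ≤ ((d + 1 + e).factorial : ℝ) * (C * (2 ^ d * R ^ (d + e))) := by
          gcongr; exact ‹(1 + R) ^ d ≤ 2 ^ d * R ^ d›.trans (by gcongr)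
      _ = _ := by ring
  have h4 : ‖iteratedDeriv n (psum p) 0‖ ≤ 0 := by
    have ht : Filter.Tendsto (fun R : ℝ => (n.factorial * C * 2 ^ d) * R⁻¹) Filter.atTop
        (nhds ((n.factorial * C * 2 ^ d) * 0)) := tendsto_inv_atTop_zero.const_mul _
    rw [mul_zero] at ht
    refine ge_of_tendsto ht ?_
    filter_upwards [Filter.eventually_ge_atTop 1] with R hR using h3 R hR
  have h5 : iteratedDeriv n (psum p) 0 = 0 := norm_le_zero_iff.1 h4
  rw [h5] at h1'
  exact (mul_eq_zero.1 h1').resolve_left (by exact_mod_cast n.factorial_ne_zero)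

end FGQ


namespace FGQ
open MvPolynomial

lemma Ent.mul {p q : PowerSeries ℂ} (hp : Ent p) (hq : Ent q) : Ent (p * q) := by
  intro ρ hρ
  have hρ' : ‖(ρ : ℂ)‖ = ρ := by simp [abs_of_nonneg hρ]
  have := summable_norm_sum_mul_antidiagonal_of_summable_norm (hp.summable ρ) (hq.summable ρ)
  refine this.congr fun n => ?_
  rw [← hρ', ← norm_pow, ← norm_mul, PowerSeries.coeff_mul, Finset.sum_mul, hρ']
  congr 1
  refine Finset.sum_congr rfl fun x hx => ?_
  rw [← Finset.HasAntidiagonal.mem_antidiagonal.1 hx, pow_add]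
  ring

lemma Ent.add {p q : PowerSeries ℂ} (hp : Ent p) (hq : Ent q) : Ent (p + q) := by
  intro ρ hρ
  refine Summable.of_nonneg_of_le (fun n => by positivity) (fun n => ?_)
    ((hp ρ hρ).add (hq ρ hρ))
  rw [← add_mul, map_add]
  gcongr
  exact norm_add_le _ _

lemma Ent.of_finite {p : PowerSeries ℂ} (N : ℕ) (h : ∀ n, N ≤ n → PowerSeries.coeff n p = 0) :
    Ent p := by
  intro ρ hρ
  refine summable_of_ne_finset_zero (s := Finset.range N) fun n hn => ?_
  rw [h n (by simpa using hn)]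
  simp

section tay
variable {T : Type*} [CommRing T] [Algebra ℂ T] (D : Derivation ℂ T T) (ev : T →ₐ[ℂ] ℂ)

/-- Taylor expansion along a derivation. -/
noncomputable def tay (f : T) : PowerSeries ℂ :=
  PowerSeries.mk fun n => ev (D^[n] f) / (n.factorial : ℂ)

lemma tay_coeff (f : T) (n : ℕ) :
    PowerSeries.coeff n (tay D ev f) = ev (D^[n] f) / (n.factorial : ℂ) := by
  simp [tay]

lemma tay_deriv (f : T) : PowerSeries.derivative ℂ (tay D ev f) = tay D ev (D f) := by
  ext n
  rw [PowerSeries.coeff_derivative, tay_coeff, tay_coeff, Function.iterate_succ_apply,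
    Nat.factorial_succ]
  have : (n.factorial : ℂ) ≠ 0 := by exact_mod_cast n.factorial_ne_zero
  have h2 : (n : ℂ) + 1 ≠ 0 := by exact_mod_cast n.succ_ne_zero
  push_cast
  field_simp

lemma tay_add (f g : T) : tay D ev (f + g) = tay D ev f + tay D ev g := by
  ext n
  have : D^[n] (f + g) = D^[n] f + D^[n] g := by
    induction n generalizing f g with
    | zero => rfl
    | succ n ih => rw [Function.iterate_succ_apply, map_add, ih]; rfl
  rw [map_add, tay_coeff, tay_coeff, tay_coeff, this, map_add, add_div]

lemma tay_mul (f g : T) : tay D ev (f * g) = tay D ev f * tay D ev g := by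
  ext n
  induction n generalizing f g with
  | zero => simp [tay_coeff, PowerSeries.coeff_mul]
  | succ n ih =>
    have h2 : (n : ℂ) + 1 ≠ 0 := by exact_mod_cast n.succ_ne_zero
    refine mul_right_cancel₀ h2 ?_
    rw [← PowerSeries.coeff_derivative, ← PowerSeries.coeff_derivative, tay_deriv,
      Derivation.leibniz, Derivation.leibniz, tay_add, map_add, map_add, smul_eq_mul, smul_eq_mul,
      smul_eq_mul, smul_eq_mul, ih, ih, tay_deriv, tay_deriv]

lemma iter_zero (n : ℕ) : D^[n] (0 : T) = 0 := by
  induction n with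
  | zero => rfl
  | succ n ih => rw [Function.iterate_succ_apply, map_zero, ih]

lemma tay_algebraMap (c : ℂ) : tay D ev (algebraMap ℂ T c) = PowerSeries.C c := by
  ext n
  rw [tay_coeff]
  cases n with
  | zero => simp
  | succ n =>
    rw [Function.iterate_succ_apply, Derivation.map_algebraMap, iter_zero]
    simp [PowerSeries.coeff_C]

end tay

lemma psum_C (c s : ℂ) : psum (PowerSeries.C c) s = c := by
  unfold psum
  rw [tsum_eq_single 0]
  · simp
  · intro n hn
    simp [PowerSeries.coeff_C, hn]

/-- Points of finite type algebras. -/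
lemma exists_point {T : Type*} [CommRing T] [Algebra ℂ T] [Algebra.FiniteType ℂ T]
    (P : Ideal T) (hP : P.IsPrime) (g : T) (hg : g ∉ P) :
    ∃ ev : T →ₐ[ℂ] ℂ, (∀ p ∈ P, ev p = 0) ∧ ev g ≠ 0 := by
  have hJ : IsJacobsonRing T := isJacobsonRing_of_finiteType (A := ℂ)
  have h1 : P.jacobson = P := hJ.out hP.isRadical
  rw [← h1, Ideal.jacobson, Ideal.mem_sInf] at hg
  push Not at hg
  obtain ⟨Q, ⟨hPQ, hQ⟩, hgQ⟩ := hg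
  letI := Ideal.Quotient.field Q
  haveI : Algebra.FiniteType ℂ (T ⧸ Q) := inferInstance
  haveI : Module.Finite ℂ (T ⧸ Q) := finite_of_finite_type_of_isJacobsonRing ℂ (T ⧸ Q)
  have hb : Function.Bijective (algebraMap ℂ (T ⧸ Q)) :=
    IsAlgClosed.algebraMap_bijective_of_isIntegral
  let e := AlgEquiv.ofBijective (Algebra.ofId ℂ (T ⧸ Q)) hb
  refine ⟨(e.symm : (T ⧸ Q) →ₐ[ℂ] ℂ).comp (Ideal.Quotient.mkₐ ℂ Q), fun p hp => ?_, fun h => ?_⟩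
  · have : (Ideal.Quotient.mk Q) p = 0 := Ideal.Quotient.eq_zero_iff_mem.2 (hPQ hp)
    simp [this]
  · apply hgQ
    rw [← Ideal.Quotient.eq_zero_iff_mem]
    have h2 : e.symm (Ideal.Quotient.mk Q g) = 0 := h
    simpa using h2

section growth
variable {m : ℕ}

lemma eval_growth (a : MvPolynomial (Fin m) ℂ) (x0 : Fin m → ℂ) (i : Fin m) :
    ∃ C : ℝ, 0 ≤ C ∧ ∀ s : ℂ, ‖eval (fun j => x0 j + s * (if j = i then 1 else 0)) a‖
      ≤ C * (1 + ‖s‖) ^ a.totalDegree := by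
  set B : ℝ := 1 + ‖x0‖ with hB
  have hB1 : 1 ≤ B := by have := norm_nonneg x0; linarith
  refine ⟨∑ d ∈ a.support, ‖coeff d a‖ * B ^ a.totalDegree, by positivity, fun s => ?_⟩
  have hs := norm_nonneg s
  rw [eval_eq', Finset.sum_mul]
  refine (norm_sum_le _ _).trans (Finset.sum_le_sum fun d hd => ?_)
  rw [norm_mul, norm_prod, mul_assoc, ← mul_pow]
  gcongr
  have h1 : ∀ j, ‖x0 j + s * (if j = i then 1 else 0)‖ ≤ B * (1 + ‖s‖) := by
    intro j
    have h2 : ‖x0 j‖ ≤ ‖x0‖ := norm_le_pi_norm x0 j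
    have h3 : ‖s * (if j = i then 1 else 0 : ℂ)‖ ≤ ‖s‖ := by
      split_ifs <;> simp
    refine (norm_add_le _ _).trans ?_
    nlinarith [norm_nonneg x0]
  calc _ ≤ ∏ j, (B * (1 + ‖s‖)) ^ d j := by
        refine Finset.prod_le_prod (fun _ _ => norm_nonneg _) fun j _ => ?_
        rw [norm_pow]
        gcongr
        exact h1 j
    _ = (B * (1 + ‖s‖)) ^ (∑ j, d j) := by rw [Finset.prod_pow_eq_pow_sum]
    _ ≤ _ := by
        refine pow_le_pow_right₀ ?_ ?_
        · nlinarith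
        · have := le_totalDegree hd
          rwa [Finsupp.sum_fintype _ _ (by simp)] at this

variable {T : Type*} [CommRing T] [Algebra ℂ T] [Algebra (MvPolynomial (Fin m) ℂ) T]
  [IsScalarTower ℂ (MvPolynomial (Fin m) ℂ) T]

lemma locNil_point [Module.Finite (MvPolynomial (Fin m) ℂ) T]
    (D : Derivation ℂ T T) (i : Fin m)
    (hD : ∀ r, D (algebraMap (MvPolynomial (Fin m) ℂ) T r)
      = algebraMap (MvPolynomial (Fin m) ℂ) T (pderiv i r)) (f : T)
    (P : Polynomial (MvPolynomial (Fin m) ℂ)) (hP : P.Monic) (hf : Polynomial.aeval f P = 0)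
    (ev : T →ₐ[ℂ] ℂ) (n : ℕ)
    (hn : (∑ j ∈ Finset.range P.natDegree, (P.coeff j).totalDegree) < n) :
    ev (D^[n] f) = 0 := by
  classical
  have hX : ∀ j, D (algebraMap _ T (X j : MvPolynomial (Fin m) ℂ))
      = algebraMap ℂ T (if j = i then 1 else 0) := by
    intro j
    rw [hD, pderiv_X, IsScalarTower.algebraMap_apply ℂ (MvPolynomial (Fin m) ℂ) T,
      algebraMap_eq]
    congr 1
    by_cases h : j = i
    · subst h; simp
    · simp [h]
  have hCR : ∀ c : ℂ, algebraMap (MvPolynomial (Fin m) ℂ) T (C c) = algebraMap ℂ T c := by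
    intro c
    rw [IsScalarTower.algebraMap_apply ℂ (MvPolynomial (Fin m) ℂ) T, algebraMap_eq]
  have hXent : ∀ j, ∀ k, 2 ≤ k → PowerSeries.coeff k (tay D ev (algebraMap _ T
      (X j : MvPolynomial (Fin m) ℂ))) = 0 := by
    intro j k hk
    obtain ⟨k, rfl⟩ : ∃ k', k = k' + 2 := ⟨k - 2, by omega⟩
    rw [tay_coeff, Function.iterate_succ_apply, Function.iterate_succ_apply, hX,
      Derivation.map_algebraMap, iter_zero]
    simp
  have hR : ∀ r : MvPolynomial (Fin m) ℂ, Ent (tay D ev (algebraMap _ T r)) := by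
    intro r
    induction r using MvPolynomial.induction_on with
    | C c =>
      rw [hCR, tay_algebraMap]
      refine Ent.of_finite 1 fun k hk => ?_
      rw [PowerSeries.coeff_C, if_neg (by omega)]
    | add p q hp hq => rw [map_add, tay_add]; exact hp.add hq
    | mul_X p j hp =>
      rw [map_mul, tay_mul]
      exact hp.mul (Ent.of_finite 2 (hXent j))
  have hT : ∀ f : T, Ent (tay D ev f) := by
    intro f
    obtain ⟨s, hs⟩ := (Module.Finite.fg_top : (⊤ : Submodule (MvPolynomial (Fin m) ℂ) T).FG)
    let w : {x // x ∈ insert f s} → T := fun x => x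
    have hw : ∀ g : T, ∃ a : {x // x ∈ insert f s} → MvPolynomial (Fin m) ℂ,
        ∑ j, a j • w j = g := by
      intro g
      rw [← Submodule.mem_span_range_iff_exists_fun]
      have : g ∈ (⊤ : Submodule (MvPolynomial (Fin m) ℂ) T) := trivial
      rw [← hs] at this
      refine Submodule.span_mono ?_ this
      intro x hx
      exact ⟨⟨x, Finset.mem_insert_of_mem hx⟩, rfl⟩
    choose a ha using fun i => hw (D (w i))
    refine ent_of_ode (fun j => tay D ev (w j)) (fun i j => tay D ev (algebraMap _ T (a i j)))
      (fun i j => hR _) (fun i => ?_) ⟨f, Finset.mem_insert_self _ _⟩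
    rw [tay_deriv, ← ha i]
    let τ : T →+ PowerSeries ℂ := AddMonoidHom.mk' (tay D ev) (tay_add D ev)
    change τ _ = _
    rw [map_sum]
    refine Finset.sum_congr rfl fun j _ => ?_
    rw [Algebra.smul_def]
    exact tay_mul D ev _ _
  -- evaluation at shifted point
  let E : ℂ → T →+* ℂ := fun s =>
    { toFun := fun f => psum (tay D ev f) s
      map_one' := by
        rw [← map_one (algebraMap ℂ T), tay_algebraMap, psum_C]
      map_zero' := by
        rw [← map_zero (algebraMap ℂ T), tay_algebraMap, psum_C]
      map_mul' := fun a b => by rw [tay_mul, psum_mul (hT a) (hT b)]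
      map_add' := fun a b => by rw [tay_add, psum_add (hT a) (hT b)] }
  let x0 : Fin m → ℂ := fun j => ev (algebraMap _ T (X j : MvPolynomial (Fin m) ℂ))
  have hE : ∀ s, (E s).comp (algebraMap (MvPolynomial (Fin m) ℂ) T)
      = eval (fun j => x0 j + s * (if j = i then 1 else 0)) := by
    intro s
    refine MvPolynomial.ringHom_ext (fun c => ?_) (fun j => ?_)
    · change psum (tay D ev (algebraMap _ T (C c))) s = _
      rw [hCR, tay_algebraMap, psum_C, eval_C]
    · change psum (tay D ev (algebraMap _ T (X j))) s = _
      rw [eval_X, psum, tsum_eq_sum (s := Finset.range 2)]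
      · rw [Finset.sum_range_succ, Finset.sum_range_one, tay_coeff, tay_coeff,
          Function.iterate_one, hX, AlgHom.commutes]
        simp [x0, mul_comm]
      · intro k hk
        rw [hXent j k (by simp at hk; omega), zero_mul]
  choose Cc hC0 hC using fun j => eval_growth (P.coeff j) x0 i
  set d := ∑ j ∈ Finset.range P.natDegree, (P.coeff j).totalDegree with hd
  have hgrow : ∀ s, ‖psum (tay D ev f) s‖ ≤
      ((∑ j ∈ Finset.range P.natDegree, Cc j) + 1) * (1 + ‖s‖) ^ d := by
    intro s
    have h1s : 1 ≤ 1 + ‖s‖ := by linarith [norm_nonneg s]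
    set Q := P.map (eval (fun j => x0 j + s * (if j = i then 1 else 0))) with hQ
    have hQm : Q.Monic := hP.map _
    have hroot : Q.IsRoot (E s f) := by
      rw [Polynomial.IsRoot, hQ, ← hE s, Polynomial.eval_map, ← Polynomial.hom_eval₂]
      have : Polynomial.eval₂ (algebraMap (MvPolynomial (Fin m) ℂ) T) f P = 0 := hf
      rw [this, map_zero]
    have hb := Polynomial.IsRoot.norm_lt_cauchyBound hQm.ne_zero hroot
    have hb' : ‖E s f‖₊ ≤ (∑ j ∈ Finset.range P.natDegree, ‖Q.coeff j‖₊) + 1 := by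
      refine hb.le.trans ?_
      rw [Polynomial.cauchyBound, hQm.leadingCoeff, nnnorm_one, div_one]
      gcongr
      refine Finset.sup_le fun j hj => ?_
      have : Q.natDegree ≤ P.natDegree := Polynomial.natDegree_map_le
      refine Finset.single_le_sum (f := fun j => ‖Q.coeff j‖₊) (fun _ _ => zero_le) ?_
      simp at hj ⊢
      omega
    have hb2 : ‖E s f‖ ≤ (∑ j ∈ Finset.range P.natDegree, ‖Q.coeff j‖) + 1 := by
      have := NNReal.coe_le_coe.2 hb'
      simpa using this
    refine (show ‖psum (tay D ev f) s‖ = ‖E s f‖ from rfl).le.trans (hb2.trans ?_)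
    rw [add_mul, one_mul, Finset.sum_mul]
    gcongr with j hj
    · rw [hQ, Polynomial.coeff_map]
      refine (hC j s).trans ?_
      gcongr
      · exact hC0 j
      · exact Finset.single_le_sum (f := fun j => (P.coeff j).totalDegree)
          (fun _ _ => Nat.zero_le _) hj
    · exact one_le_pow₀ h1s
  have := coeff_eq_zero_of_growth (hT f) d _ hgrow n hn
  rw [tay_coeff, div_eq_zero_iff] at this
  exact this.resolve_right (by exact_mod_cast n.factorial_ne_zero)

lemma locNil [IsDomain T] [Module.Finite (MvPolynomial (Fin m) ℂ) T]
    (D : Derivation ℂ T T) (i : Fin m)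
    (hD : ∀ r, D (algebraMap (MvPolynomial (Fin m) ℂ) T r)
      = algebraMap (MvPolynomial (Fin m) ℂ) T (pderiv i r)) (f : T) :
    ∃ n, D^[n] f = 0 := by
  obtain ⟨P, hP, hf⟩ := Algebra.IsIntegral.isIntegral (R := MvPolynomial (Fin m) ℂ) f
  haveI : Algebra.FiniteType ℂ T :=
    Algebra.FiniteType.trans (S := MvPolynomial (Fin m) ℂ) inferInstance inferInstance
  refine ⟨(∑ j ∈ Finset.range P.natDegree, (P.coeff j).totalDegree) + 1, ?_⟩
  by_contra hne
  obtain ⟨ev, -, hev⟩ := exists_point (⊥ : Ideal T) Ideal.isPrime_bot _ hne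
  exact hev (locNil_point D i hD f P hP hf ev _ (Nat.lt_succ_self _))

end growth
end FGQ


namespace FGQ
open MvPolynomial

lemma D_aeval {R T : Type*} [CommRing R] [CommRing T] [Algebra ℂ R] [Algebra ℂ T] [Algebra R T]
    (d : Derivation ℂ R R) (D : Derivation ℂ T T)
    (hD : ∀ r, D (algebraMap R T r) = algebraMap R T (d r)) (x : T) (p : Polynomial R) :
    ∃ q : Polynomial R, (∀ n, q.coeff n = d (p.coeff n)) ∧
      D (Polynomial.aeval x p) = Polynomial.aeval x q
        + Polynomial.aeval x (Polynomial.derivative p) * D x := by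
  induction p using Polynomial.induction_on' with
  | add p q hp hq =>
    obtain ⟨p', hp1, hp2⟩ := hp
    obtain ⟨q', hq1, hq2⟩ := hq
    refine ⟨p' + q', fun n => by simp [hp1, hq1], ?_⟩
    rw [map_add, map_add, hp2, hq2]
    simp only [map_add]
    ring
  | monomial n a =>
    refine ⟨Polynomial.monomial n (d a), fun k => ?_, ?_⟩
    · rw [Polynomial.coeff_monomial, Polynomial.coeff_monomial]
      split_ifs <;> simp
    · rw [Polynomial.aeval_monomial, Derivation.leibniz, Derivation.leibniz_pow, hD,
        Polynomial.derivative_monomial, Polynomial.aeval_monomial, Polynomial.aeval_monomial]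
      simp only [smul_eq_mul, nsmul_eq_mul, map_mul, map_natCast]
      ring

lemma iter_mul_pow {T : Type*} [CommRing T] [Algebra ℂ T] (D : Derivation ℂ T T) (x g : T)
    (hx : D x = 1) (hg : D g = 0) (n : ℕ) : D^[n] (x ^ n * g) = (n.factorial : T) * g := by
  have hc : ∀ (n c : ℕ) (f : T), D^[n] ((c : T) * f) = (c : T) * D^[n] f := by
    intro n c f
    induction n generalizing f with
    | zero => rfl
    | succ n ih =>
      rw [Function.iterate_succ_apply, Function.iterate_succ_apply, ← ih]
      simp
  induction n with
  | zero => simp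
  | succ n ih =>
    rw [Function.iterate_succ_apply]
    have : D (x ^ (n+1) * g) = ((n+1 : ℕ) : T) * (x ^ n * g) := by
      rw [Derivation.leibniz, Derivation.leibniz_pow, hx, hg]
      simp
      ring
    rw [this, hc, ih, Nat.factorial_succ]
    push_cast
    ring

section
variable {m : ℕ} {T : Type*} [CommRing T] [IsDomain T] [Algebra ℂ T]
  [Algebra (MvPolynomial (Fin m) ℂ) T]
  [IsScalarTower ℂ (MvPolynomial (Fin m) ℂ) T]

lemma const_of_pderiv (r : MvPolynomial (Fin m) ℂ) (h : ∀ i, pderiv i r = 0) : ∃ c, r = C c := by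
  refine ⟨coeff 0 r, ?_⟩
  ext d
  rw [coeff_C]
  split_ifs with h0
  · rw [h0]
  · obtain ⟨i, hi⟩ : ∃ i, d i ≠ 0 := by
      by_contra hh
      push Not at hh
      exact h0 (by ext i; simp [hh i])
    have h1 := congrArg (coeff (d - Finsupp.single i 1)) (h i)
    rw [coeff_pderiv] at h1
    have h2 : d - Finsupp.single i 1 + Finsupp.single i 1 = d := by
      ext j
      by_cases hj : j = i
      · subst hj; simp; omega
      · simp [Finsupp.single_apply, Ne.symm hj]
    rw [h2, coeff_zero] at h1
    rcases mul_eq_zero.1 h1 with h3 | h3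
    · exact h3
    · exfalso
      have : ((((d - Finsupp.single i 1 : Fin m →₀ ℕ) i) + 1 : ℕ) : ℂ) = 0 := by
        push_cast; exact h3
      exact Nat.succ_ne_zero _ (Nat.cast_eq_zero.1 this)

lemma const_mem [FaithfulSMul (MvPolynomial (Fin m) ℂ) T]
    [Algebra.IsIntegral (MvPolynomial (Fin m) ℂ) T]
    (D : Fin m → Derivation ℂ T T)
    (hD : ∀ i r, D i (algebraMap (MvPolynomial (Fin m) ℂ) T r)
      = algebraMap (MvPolynomial (Fin m) ℂ) T (pderiv i r)) (f : T) (hf : ∀ i, D i f = 0) :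
    ∃ c, f = algebraMap (MvPolynomial (Fin m) ℂ) T c := by
  haveI : Module.IsTorsionFree (MvPolynomial (Fin m) ℂ) T := by
    rw [Module.isTorsionFree_iff_algebraMap_injective]
    exact FaithfulSMul.algebraMap_injective _ _
  have hint : IsIntegral (MvPolynomial (Fin m) ℂ) f := Algebra.IsIntegral.isIntegral f
  set P := minpoly (MvPolynomial (Fin m) ℂ) f with hP
  have hPm : P.Monic := minpoly.monic hint
  have hconst : ∀ n, ∃ c : ℂ, P.coeff n = C c := by
    intro n
    refine const_of_pderiv _ fun i => ?_
    obtain ⟨q, hq1, hq2⟩ := D_aeval (pderiv i) (D i) (hD i) f P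
    rw [minpoly.aeval, map_zero, hf i, mul_zero, add_zero] at hq2
    have hdvd := minpoly.isIntegrallyClosed_dvd hint hq2.symm
    have hq0 : q = 0 := by
      by_contra hne
      have h1 := Polynomial.natDegree_le_of_dvd hdvd hne
      have h2 : q.natDegree < P.natDegree := by
        have h3 : q.natDegree ≤ P.natDegree := by
          refine Polynomial.natDegree_le_iff_coeff_eq_zero.2 fun N hN => ?_
          rw [hq1, Polynomial.coeff_eq_zero_of_natDegree_lt hN, map_zero]
        refine lt_of_le_of_ne h3 fun h4 => ?_
        have h5 : q.leadingCoeff = 0 := by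
          rw [Polynomial.leadingCoeff, hq1, h4]
          have : P.coeff P.natDegree = 1 := hPm
          rw [this]; simp
        exact hne (Polynomial.leadingCoeff_eq_zero.1 h5)
      exact absurd h1 (not_le.2 h2)
    rw [← hq1, hq0, Polynomial.coeff_zero]
  have hlift : P ∈ Polynomial.lifts (algebraMap ℂ (MvPolynomial (Fin m) ℂ)) := by
    rw [Polynomial.lifts_iff_coeff_lifts]
    intro n
    obtain ⟨c, hc⟩ := hconst n
    exact ⟨c, hc.symm⟩
  obtain ⟨p, hp, -, hpm⟩ := Polynomial.lifts_and_natDegree_eq_and_monic hlift hPm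
  have hroot : Polynomial.aeval f p = 0 := by
    have := minpoly.aeval (MvPolynomial (Fin m) ℂ) f
    rw [← hP, ← hp, Polynomial.aeval_map_algebraMap] at this
    exact this
  have hsp := IsAlgClosed.splits p
  have hprod := hsp.eq_prod_roots_of_monic hpm
  rw [hprod, map_multiset_prod, Multiset.prod_eq_zero_iff] at hroot
  simp only [Multiset.map_map, Multiset.mem_map, Function.comp] at hroot
  obtain ⟨c, -, hc⟩ := hroot
  refine ⟨C c, ?_⟩
  simp only [map_sub, Polynomial.aeval_X, Polynomial.aeval_C] at hc
  rw [sub_eq_zero] at hc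
  rw [hc, IsScalarTower.algebraMap_apply ℂ (MvPolynomial (Fin m) ℂ) T, algebraMap_eq]

lemma iter_sub {T : Type*} [CommRing T] [Algebra ℂ T] (D : Derivation ℂ T T) (n : ℕ) (f g : T) :
    D^[n] (f - g) = D^[n] f - D^[n] g := by
  induction n generalizing f g with
  | zero => rfl
  | succ n ih => rw [Function.iterate_succ_apply, map_sub, ih]; rfl

theorem all_mem [FaithfulSMul (MvPolynomial (Fin m) ℂ) T]
    [Module.Finite (MvPolynomial (Fin m) ℂ) T]
    (D : Fin m → Derivation ℂ T T)
    (hD : ∀ i r, D i (algebraMap (MvPolynomial (Fin m) ℂ) T r)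
      = algebraMap (MvPolynomial (Fin m) ℂ) T (pderiv i r))
    (hcomm : ∀ i j f, D i (D j f) = D j (D i f)) (f : T) :
    ∃ c, f = algebraMap (MvPolynomial (Fin m) ℂ) T c := by
  have key : ∀ l : ℕ, l ≤ m → ∀ f : T, (∀ i : Fin m, l ≤ i → D i f = 0) →
      ∃ c, f = algebraMap (MvPolynomial (Fin m) ℂ) T c := by
    intro l
    induction l with
    | zero => exact fun _ f hf => const_mem D hD f fun i => hf i (Nat.zero_le _)
    | succ l ih =>
      intro hl
      let i : Fin m := ⟨l, hl⟩
      set x : T := algebraMap (MvPolynomial (Fin m) ℂ) T (X i) with hx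
      have hDx : D i x = 1 := by rw [hx, hD]; simp
      have hstep : ∀ n : ℕ, ∀ f : T, (∀ i : Fin m, l + 1 ≤ i → D i f = 0) →
          (D i)^[n] f = 0 → ∃ c, f = algebraMap (MvPolynomial (Fin m) ℂ) T c := by
        intro n
        induction n with
        | zero => intro f _ hf; exact ⟨0, by simpa using hf⟩
        | succ n ihn =>
          intro f hf hn
          have hg1 : D i ((D i)^[n] f) = 0 := by
            rw [Function.iterate_succ_apply'] at hn; exact hn
          have hg2 : ∀ j : Fin m, l + 1 ≤ j → D j ((D i)^[n] f) = 0 := by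
            intro j hj
            have : ∀ n, D j ((D i)^[n] f) = (D i)^[n] (D j f) := by
              intro n
              induction n with
              | zero => rfl
              | succ n ih2 => rw [Function.iterate_succ_apply', hcomm, ih2,
                  Function.iterate_succ_apply']
            rw [this, hf j hj, iter_zero]
          obtain ⟨c, hc⟩ := ih (by omega) ((D i)^[n] f) (by
            intro j hj
            rcases Nat.lt_or_ge l j with h | h
            · exact hg2 j h
            · have : j = i := Fin.ext (le_antisymm h hj)
              rw [this]; exact hg1)
          set w : T := algebraMap ℂ T ((n.factorial : ℂ)⁻¹) * (D i)^[n] f with hw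
          have hw1 : ∀ j, D j ((D i)^[n] f) = 0 → D j w = 0 := by
            intro j hj
            rw [hw, Derivation.leibniz, hj, Derivation.map_algebraMap]; simp
          obtain ⟨e, he⟩ := ihn (f - x ^ n * w) (by
              intro j hj
              have hjx : D j x = 0 := by
                rw [hx, hD, pderiv_X_of_ne, map_zero]
                intro h
                have := congrArg Fin.val h
                simp [i] at this
                omega
              rw [map_sub, hf j hj, Derivation.leibniz, Derivation.leibniz_pow, hjx,
                hw1 j (hg2 j hj)]
              simp) (by
              rw [iter_sub, iter_mul_pow (D i) x w hDx (hw1 i hg1), hw, ← mul_assoc,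
                ← map_natCast (algebraMap ℂ T), ← map_mul,
                mul_inv_cancel₀ (by exact_mod_cast n.factorial_ne_zero), map_one, one_mul,
                sub_self])
          refine ⟨e + X i ^ n * (C ((n.factorial : ℂ)⁻¹) * c), ?_⟩
          rw [map_add, ← he, map_mul, map_mul, map_pow, ← hx, ← hc, ← algebraMap_eq,
            ← IsScalarTower.algebraMap_apply, ← hw]
          ring
      intro f hf
      obtain ⟨n, hn⟩ := locNil (D i) i (hD i) f
      exact hstep n f hf hn
  exact key m le_rfl f fun i hi => absurd i.2 (by omega)

end
end FGQ


namespace FGQ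
open MvPolynomial

/-- linear automorphisms -/
abbrev GG (k : ℕ) := (Fin k → ℂ) ≃ₗ[ℂ] (Fin k → ℂ)

section
variable {k : ℕ}

/-- substitution action -/
noncomputable def act (g : GG k) : MvPolynomial (Fin k) ℂ →ₐ[ℂ] MvPolynomial (Fin k) ℂ :=
  aeval fun i => ∑ j, C (g (Pi.single j 1) i) * X j

lemma eval_act (g : GG k) (x : Fin k → ℂ) (f : MvPolynomial (Fin k) ℂ) :
    eval x (act g f) = eval (g x) f := by
  have : (aeval x).comp (act g) = (aeval (g x) : MvPolynomial (Fin k) ℂ →ₐ[ℂ] ℂ) := by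
    ext i
    simp only [act, AlgHom.comp_apply, aeval_X, map_sum, map_mul]
    have hx : x = ∑ j, x j • (Pi.single j 1 : Fin k → ℂ) := by
      ext l; simp [Finset.sum_apply, Pi.single_apply]
    conv_rhs => rw [hx, map_sum, Finset.sum_apply]
    refine Finset.sum_congr rfl fun j _ => ?_
    rw [map_smul]
    simp [mul_comm]
  have h2 := DFunLike.congr_fun this f
  simpa [aeval_eq_eval] using h2

lemma act_mul (g h : GG k) (f : MvPolynomial (Fin k) ℂ) : act (g * h) f = act h (act g f) := by
  refine MvPolynomial.funext fun x => ?_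
  rw [eval_act, eval_act, eval_act]; rfl

lemma act_one (f : MvPolynomial (Fin k) ℂ) : act (1 : GG k) f = f := by
  refine MvPolynomial.funext fun x => ?_
  rw [eval_act]; rfl

lemma act_inj (g : GG k) : Function.Injective (act g) := by
  intro a b h
  have := congrArg (act g⁻¹) h
  rwa [← act_mul, ← act_mul, mul_inv_cancel, act_one, act_one] at this

lemma mem_inv {Γ : Subgroup (GG k)} {f : MvPolynomial (Fin k) ℂ} :
    f ∈ invariantSubalgebra k Γ ↔ ∀ g ∈ Γ, act g f = f := by
  constructor
  · intro h g hg
    refine MvPolynomial.funext fun x => ?_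
    rw [eval_act]; exact h g hg x
  · intro h g hg x
    rw [← eval_act, h g hg]

lemma inv_mono {N Γ : Subgroup (GG k)} (h : N ≤ Γ) :
    invariantSubalgebra k Γ ≤ invariantSubalgebra k N :=
  fun _ hf g hg => hf g (h hg)

/-- Lagrange interpolation on a finite set of points. -/
lemma interp (F : Finset (Fin k → ℂ)) (c : (Fin k → ℂ) → ℂ) :
    ∃ v : MvPolynomial (Fin k) ℂ, ∀ p ∈ F, eval p v = c p := by
  classical
  have h1 : ∀ p q : Fin k → ℂ, ∃ l : MvPolynomial (Fin k) ℂ, p ≠ q →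
      eval p l = 1 ∧ eval q l = 0 := by
    intro p q
    by_cases h : p = q
    · exact ⟨0, fun h2 => absurd h h2⟩
    · obtain ⟨i, hi⟩ := Function.ne_iff.1 h
      refine ⟨C ((p i - q i)⁻¹) * (X i - C (q i)), fun _ => ?_⟩
      have := sub_ne_zero.2 hi
      simp [this]
  choose l hl using h1
  refine ⟨∑ p ∈ F, C (c p) * ∏ q ∈ F.erase p, l p q, fun p hp => ?_⟩
  rw [map_sum, Finset.sum_eq_single p]
  · rw [map_mul, map_prod, eval_C, Finset.prod_eq_one, mul_one]
    intro q hq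
    exact (hl p q (Finset.ne_of_mem_erase hq).symm).1
  · intro q hq hqp
    rw [map_mul, map_prod, Finset.prod_eq_zero (i := p), mul_zero]
    · exact Finset.mem_erase.2 ⟨hqp.symm, hp⟩
    · exact (hl q p hqp).2
  · exact fun h => absurd hp h

/-- `u` separates the `N`-orbits in `Γ y`. -/
def Sep (N Γ : Subgroup (GG k)) (y : Fin k → ℂ) (u : MvPolynomial (Fin k) ℂ) : Prop :=
  ∀ g ∈ Γ, ∀ h ∈ Γ, eval (g y) u = eval (h (g y)) u → h ∈ N

lemma exists_sep (N Γ : Subgroup (GG k)) [Finite Γ] (hN : N ≤ Γ)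
    (hnorm : ∀ g ∈ Γ, ∀ n ∈ N, g * n * g⁻¹ ∈ N) (y : Fin k → ℂ)
    (hy : ∀ s ∈ Γ, s y = y → s ∈ N) :
    ∃ u ∈ invariantSubalgebra k N, Sep N Γ y u := by
  classical
  haveI : Finite N := Finite.of_injective _ (Subgroup.inclusion_injective hN)
  haveI := Fintype.ofFinite Γ
  haveI := Fintype.ofFinite N
  let Q := MulAction.orbitRel.Quotient N (Fin k → ℂ)
  let mk : (Fin k → ℂ) → Q := Quotient.mk _
  have hmk : ∀ p q, mk p = mk q ↔ ∃ n ∈ N, n q = p := by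
    intro p q
    change (Quotient.mk _ p = Quotient.mk _ q) ↔ _
    rw [Quotient.eq]
    change p ∈ MulAction.orbit N q ↔ _
    constructor
    · rintro ⟨n, hn⟩; exact ⟨n, n.2, hn⟩
    · rintro ⟨n, hn, h⟩; exact ⟨⟨n, hn⟩, h⟩
  let F : Finset (Fin k → ℂ) := Finset.univ.image fun g : Γ => (g : GG k) y
  have hF : ∀ g ∈ Γ, g y ∈ F := fun g hg => Finset.mem_image.2 ⟨⟨g, hg⟩, Finset.mem_univ _, rfl⟩
  let F' := F.image mk
  let c : (Fin k → ℂ) → ℂ := fun p =>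
    if h : mk p ∈ F' then ((F'.equivFin ⟨mk p, h⟩ : ℕ) : ℂ) else 0
  have hc : ∀ p ∈ F, ∀ q ∈ F, c p = c q → mk p = mk q := by
    intro p hp q hq h
    have hp' : mk p ∈ F' := Finset.mem_image_of_mem _ hp
    have hq' : mk q ∈ F' := Finset.mem_image_of_mem _ hq
    simp only [c, dif_pos hp', dif_pos hq'] at h
    have h2 := F'.equivFin.injective (Fin.ext (Nat.cast_injective h))
    exact congrArg Subtype.val h2
  have hc2 : ∀ p q, mk p = mk q → c p = c q := by
    intro p q h
    simp only [c, h]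
  obtain ⟨v, hv⟩ := interp F c
  have hu : ∀ g ∈ Γ, eval (g y) (∑ n : N, act (n : GG k) v) = Fintype.card N * c (g y) := by
    intro g hg
    rw [map_sum, Finset.sum_congr rfl (g := fun _ => c (g y))]
    · simp
    · intro n _
      rw [eval_act]
      have h1 : (n : GG k) (g y) ∈ F := hF ((n : GG k) * g) (Γ.mul_mem (hN n.2) hg)
      rw [hv _ h1]
      exact hc2 _ _ ((hmk _ _).2 ⟨n, n.2, rfl⟩)
  refine ⟨∑ n : N, act (n : GG k) v, ?_, ?_⟩
  · rw [mem_inv]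
    intro g hg
    rw [map_sum]
    simp only [← act_mul]
    exact Fintype.sum_equiv (Equiv.mulRight (⟨g, hg⟩ : N)) _ _ (fun n => rfl)
  · intro g hg h hh heq
    have h1 := hu g hg
    have h2 := hu (h * g) (Γ.mul_mem hh hg)
    have h3 : (h * g) y = h (g y) := rfl
    rw [h3] at h2
    rw [h1, h2] at heq
    have h4 := mul_left_cancel₀ (by exact_mod_cast Fintype.card_ne_zero) heq
    obtain ⟨n, hn, hng⟩ := (hmk _ _).1 (hc _ (hF g hg) _ (hF _ (Γ.mul_mem hh hg)) h4)
    -- n h g y = g y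
    have h5 : g⁻¹ * (n * h) * g ∈ N := by
      refine hy _ (Γ.mul_mem (Γ.mul_mem (Γ.inv_mem hg) (Γ.mul_mem (hN hn) hh)) hg) ?_
      change g⁻¹ (n (h (g y))) = y
      have : n (h (g y)) = g y := hng
      rw [this]
      exact g.symm_apply_apply y
    have h6 := hnorm g hg _ h5
    have h7 : n * h ∈ N := by
      have : g * (g⁻¹ * (n * h) * g) * g⁻¹ = n * h := by group
      rwa [this] at h6
    have := N.mul_mem (N.inv_mem hn) h7
    rwa [inv_mul_cancel_left] at this

lemma sep_poly (N Γ : Subgroup (GG k)) [Finite Γ] (hN : N ≤ Γ) (y : Fin k → ℂ)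
    (u : MvPolynomial (Fin k) ℂ) (huN : u ∈ invariantSubalgebra k N) (hu : Sep N Γ y u) :
    ∃ (P : Polynomial (invariantSubalgebra k Γ)) (e : MvPolynomial (Fin k) ℂ)
      (d : invariantSubalgebra k Γ),
      Polynomial.aeval u P = 0 ∧ e ∈ invariantSubalgebra k N ∧
      eval y (d : MvPolynomial (Fin k) ℂ) ≠ 0 ∧
      (d : MvPolynomial (Fin k) ℂ) = e * Polynomial.aeval u (Polynomial.derivative P) := by
  classical
  haveI := Fintype.ofFinite Γ
  let W : Finset (MvPolynomial (Fin k) ℂ) := Finset.univ.image fun g : Γ => act (g : GG k) u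
  have hW : ∀ g ∈ Γ, W.image (act g) = W := by
    intro g hg
    refine Finset.eq_of_subset_of_card_le ?_ ?_
    · intro w hw
      obtain ⟨w', hw', rfl⟩ := Finset.mem_image.1 hw
      obtain ⟨h, -, rfl⟩ := Finset.mem_image.1 hw'
      rw [← act_mul]
      exact Finset.mem_image.2 ⟨h * ⟨g, hg⟩, Finset.mem_univ _, by rw [Subgroup.coe_mul]⟩
    · rw [Finset.card_image_of_injective _ (act_inj g)]
  have huW : u ∈ W := Finset.mem_image.2 ⟨1, Finset.mem_univ _, by
    rw [Subgroup.coe_one, act_one]⟩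
  let P0 : Polynomial (MvPolynomial (Fin k) ℂ) := ∏ w ∈ W, (Polynomial.X - Polynomial.C w)
  have hP0 : ∀ g ∈ Γ, P0.map (act g : MvPolynomial (Fin k) ℂ →+* _) = P0 := by
    intro g hg
    simp only [P0, Polynomial.map_prod, Polynomial.map_sub, Polynomial.map_X, Polynomial.map_C]
    conv_rhs => rw [← hW g hg]
    rw [Finset.prod_image (fun a _ b _ h => act_inj g h)]
    rfl
  have hlift : P0 ∈ Polynomial.lifts (algebraMap (invariantSubalgebra k Γ) (MvPolynomial (Fin k) ℂ)) := by
    rw [Polynomial.lifts_iff_coeff_lifts]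
    intro n
    refine ⟨⟨P0.coeff n, mem_inv.2 fun g hg => ?_⟩, rfl⟩
    conv_rhs => rw [← hP0 g hg]
    rw [Polynomial.coeff_map]
    rfl
  obtain ⟨P, hP⟩ := hlift
  replace hP : P.map (algebraMap (invariantSubalgebra k Γ) (MvPolynomial (Fin k) ℂ)) = P0 := hP
  have hae : ∀ p : Polynomial (invariantSubalgebra k Γ), Polynomial.aeval u p
      = Polynomial.eval u (p.map (algebraMap _ (MvPolynomial (Fin k) ℂ))) := by
    intro p
    rw [Polynomial.eval_map_algebraMap]
  have hfac : P0 = (Polynomial.X - Polynomial.C u) *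
      ∏ w ∈ W.erase u, (Polynomial.X - Polynomial.C w) := (Finset.mul_prod_erase _ _ huW).symm
  set v := Polynomial.aeval u (Polynomial.derivative P) with hv
  have hv2 : v = ∏ w ∈ W.erase u, (u - w) := by
    rw [hv, hae, ← Polynomial.derivative_map, hP, hfac, Polynomial.derivative_mul]
    simp [Polynomial.eval_prod]
  have hactv : ∀ g ∈ N, act g v = v := by
    intro g hg
    have h1 : ∀ p : Polynomial (invariantSubalgebra k Γ), act g (Polynomial.aeval u p)
        = Polynomial.aeval u p := by
      intro p
      rw [Polynomial.aeval_eq_sum_range, map_sum]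
      refine Finset.sum_congr rfl fun i _ => ?_
      rw [Algebra.smul_def, map_mul, map_pow, mem_inv.1 huN g hg]
      congr 1
      exact mem_inv.1 (p.coeff i).2 g (hN hg)
    exact h1 _
  have hdA : ∏ g : Γ, act (g : GG k) v ∈ invariantSubalgebra k Γ := by
    rw [mem_inv]
    intro g hg
    rw [map_prod]
    simp only [← act_mul]
    exact Fintype.prod_equiv (Equiv.mulRight (⟨g, hg⟩ : Γ)) _ _ (fun n => rfl)
  have hdy : eval y (∏ g : Γ, act (g : GG k) v) ≠ 0 := by
    rw [map_prod, Finset.prod_ne_zero_iff]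
    intro g _
    rw [eval_act, hv2, map_prod, Finset.prod_ne_zero_iff]
    intro w hw h0
    obtain ⟨hwu, hw2⟩ := Finset.mem_erase.1 hw
    obtain ⟨h, -, rfl⟩ := Finset.mem_image.1 hw2
    rw [map_sub, sub_eq_zero, eval_act] at h0
    exact hwu (mem_inv.1 huN _ (hu g g.2 h h.2 h0))
  have hde : ∏ g : Γ, act (g : GG k) v = (∏ g ∈ Finset.univ.erase (1 : Γ), act (g : GG k) v) * v := by
    rw [← Finset.mul_prod_erase _ _ (Finset.mem_univ (1 : Γ)), mul_comm]
    rw [Subgroup.coe_one, act_one]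
  refine ⟨P, ∏ g ∈ Finset.univ.erase (1 : Γ), act (g : GG k) v, ⟨_, hdA⟩, ?_, ?_, hdy, hde⟩
  · rw [hae, hP, hfac]; simp
  · rw [mem_inv]
    intro g hg
    have hv0 : v ≠ 0 := by
      intro h
      rw [hde, h, mul_zero, map_zero] at hdy
      exact hdy rfl
    refine mul_right_cancel₀ hv0 ?_
    have h1 := mem_inv.1 hdA g (hN hg)
    rwa [hde, map_mul, hactv g hg] at h1

lemma sep_decomp (N Γ : Subgroup (GG k)) [Finite Γ] (hN : N ≤ Γ)
    (hnorm : ∀ g ∈ Γ, ∀ n ∈ N, g * n * g⁻¹ ∈ N) (y : Fin k → ℂ)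
    (hy : ∀ s ∈ Γ, s y = y → s ∈ N) (b : MvPolynomial (Fin k) ℂ)
    (hb : b ∈ invariantSubalgebra k N) :
    ∃ u₁ ∈ invariantSubalgebra k N, ∃ u₂ ∈ invariantSubalgebra k N, ∃ c : ℂ,
      Sep N Γ y u₁ ∧ Sep N Γ y u₂ ∧ b = u₁ - C c * u₂ := by
  classical
  obtain ⟨u, huN, hu⟩ := exists_sep N Γ hN hnorm y hy
  haveI := Fintype.ofFinite Γ
  let bad : Finset ℂ := Finset.univ.image fun p : Γ × Γ =>
    -(eval ((p.1 : GG k) y) b - eval ((p.2 : GG k) ((p.1 : GG k) y)) b) /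
      (eval ((p.1 : GG k) y) u - eval ((p.2 : GG k) ((p.1 : GG k) y)) u)
  obtain ⟨c, hc⟩ := Infinite.exists_notMem_finset bad
  refine ⟨b + C c * u, ?_, u, huN, c, ?_, hu, by ring⟩
  · exact add_mem hb (mul_mem (Subalgebra.algebraMap_mem _ c) huN)
  · intro g hg h hh heq
    by_contra hhN
    have hne : eval (g y) u - eval (h (g y)) u ≠ 0 :=
      fun h0 => hhN (hu g hg h hh (sub_eq_zero.1 h0))
    apply hc
    refine Finset.mem_image.2 ⟨(⟨g, hg⟩, ⟨h, hh⟩), Finset.mem_univ _, ?_⟩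
    simp only [map_add, map_mul, eval_C] at heq
    rw [div_eq_iff hne]
    linear_combination (-1 : ℂ) * heq

end
end FGQ


namespace FGQ
open MvPolynomial TensorProduct

lemma ext_deriv {R T : Type*} [CommRing R] [CommRing T] [Algebra ℂ R] [Algebra ℂ T] [Algebra R T]
    [IsScalarTower ℂ R T] [Algebra.FormallyEtale R T] (d : Derivation ℂ R R) :
    ∃ D : Derivation ℂ T T, ∀ r, D (algebraMap R T r) = algebraMap R T (d r) := by
  let e := KaehlerDifferential.tensorKaehlerEquivOfFormallyEtale ℂ R T
  let l : Ω[R⁄ℂ] →ₗ[R] T := (Algebra.linearMap R T).comp d.liftKaehlerDifferential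
  let l2 : T ⊗[R] Ω[R⁄ℂ] →ₗ[T] T := AlgebraTensorModule.lift
    ((LinearMap.toSpanSingleton T (Ω[R⁄ℂ] →ₗ[R] T) l))
  refine ⟨(l2.comp e.symm.toLinearMap).compDer (KaehlerDifferential.D ℂ T), fun r => ?_⟩
  change l2 (e.symm (KaehlerDifferential.D ℂ T (algebraMap R T r))) = _
  rw [KaehlerDifferential.tensorKaehlerEquivOfFormallyEtale_symm_D_algebraMap]
  simp [l2, l]

lemma deriv_unique {R T : Type*} [CommRing R] [CommRing T] [Algebra ℂ R] [Algebra ℂ T] [Algebra R T]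
    [IsScalarTower ℂ R T] [Algebra.FormallyUnramified R T] (D : Derivation ℂ T T)
    (h : ∀ r, D (algebraMap R T r) = 0) (x : T) : D x = 0 := by
  let E : Derivation R T T := Derivation.mk'
    { toFun := D
      map_add' := map_add D
      map_smul' := fun r x => by
        rw [Algebra.smul_def, Derivation.leibniz, h]
        simp [Algebra.smul_def] } (fun a b => D.leibniz a b)
  change E x = 0
  rw [← E.liftKaehlerDifferential_comp_D, Subsingleton.elim (KaehlerDifferential.D R T x) 0,
    map_zero]

lemma pderiv_comm' {m : ℕ} (i j : Fin m) (f : MvPolynomial (Fin m) ℂ) :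
    pderiv i (pderiv j f) = pderiv j (pderiv i f) := by
  have : ⁅(pderiv i : Derivation ℂ (MvPolynomial (Fin m) ℂ) (MvPolynomial (Fin m) ℂ)),
      (pderiv j : Derivation ℂ (MvPolynomial (Fin m) ℂ) (MvPolynomial (Fin m) ℂ))⁆ = 0 := by
    refine MvPolynomial.derivation_ext fun l => ?_
    rw [Derivation.commutator_apply, pderiv_X, pderiv_X]
    simp [Pi.single_apply, apply_ite]
  have h := DFunLike.congr_fun this f
  rw [Derivation.commutator_apply] at h
  simpa [sub_eq_zero] using h

lemma exists_derivs {m : ℕ} {T : Type*} [CommRing T] [Algebra ℂ T]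
    [Algebra (MvPolynomial (Fin m) ℂ) T] [IsScalarTower ℂ (MvPolynomial (Fin m) ℂ) T]
    [Algebra.FormallyEtale (MvPolynomial (Fin m) ℂ) T] :
    ∃ D : Fin m → Derivation ℂ T T, (∀ i r, D i (algebraMap (MvPolynomial (Fin m) ℂ) T r)
      = algebraMap (MvPolynomial (Fin m) ℂ) T (pderiv i r)) ∧
      ∀ i j f, D i (D j f) = D j (D i f) := by
  choose D hD using fun i : Fin m => ext_deriv (R := MvPolynomial (Fin m) ℂ) (T := T) (pderiv i)
  refine ⟨D, hD, fun i j f => ?_⟩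
  have := deriv_unique (R := MvPolynomial (Fin m) ℂ) (T := T) ⁅D i, D j⁆ (fun r => by
    rw [Derivation.commutator_apply, hD, hD, hD, hD, pderiv_comm', sub_self]) f
  rw [Derivation.commutator_apply] at this
  exact sub_eq_zero.1 this

lemma ufd_mem {R K : Type*} [CommRing R] [IsDomain R] [UniqueFactorizationMonoid R] [Field K]
    [Algebra R K] [IsFractionRing R K] (c : K)
    (h : ∀ p : R, Prime p → ∃ d r : R, ¬ p ∣ d ∧ algebraMap R K d * c = algebraMap R K r) :
    ∃ r, c = algebraMap R K r := by
  obtain ⟨a, b, hcop, hab⟩ := IsFractionRing.exists_reduced_fraction R c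
  have hb0 : (b : R) ≠ 0 := nonZeroDivisors.coe_ne_zero b
  by_cases hu : IsUnit (b : R)
  · obtain ⟨u, hu⟩ := hu
    refine ⟨a * (u⁻¹ : Rˣ), ?_⟩
    rw [← hab, IsLocalization.mk'_eq_iff_eq_mul, ← map_mul, ← hu, mul_assoc, Units.inv_mul, mul_one]
  · exfalso
    obtain ⟨p, hp, hpb⟩ := WfDvdMonoid.exists_irreducible_factor hu hb0
    obtain ⟨d, r, hd, hdr⟩ := h p hp.prime
    have h1 : d * a = r * b := by
      apply IsFractionRing.injective R K
      rw [map_mul, map_mul, ← hdr, ← hab, mul_assoc, IsLocalization.mk'_spec]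
    have h2 : (b : R) ∣ d * a := ⟨r, by rw [h1, mul_comm]⟩
    exact hd (hpb.trans (hcop.symm.dvd_of_dvd_mul_right h2))

lemma integral_of_local {R K L : Type*} [CommRing R] [IsDomain R] [UniqueFactorizationMonoid R]
    [Field K] [Field L] [Algebra R K] [IsFractionRing R K] [Algebra R L] [Algebra K L]
    [IsScalarTower R K L] [FiniteDimensional K L] (h : L)
    (H : ∀ p : R, Prime p → ∃ d : R, ¬ p ∣ d ∧ IsIntegral R (algebraMap R L d * h)) :
    IsIntegral R h := by
  have hKint : ∀ x : L, IsIntegral K x := fun x => Algebra.IsIntegral.isIntegral x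
  set Q := minpoly K h with hQ
  have hQm : Q.Monic := minpoly.monic (hKint h)
  have hscale : ∀ (x : L) (d : K), d ≠ 0 →
      (minpoly K (algebraMap K L d * x)).natDegree ≤ (minpoly K x).natDegree := by
    intro x d hd
    have h1 := Polynomial.scaleRoots_aeval_eq_zero (r := d) (minpoly.aeval K x)
    have h2 := minpoly.dvd K _ h1
    have h3 : (Polynomial.scaleRoots (minpoly K x) d).Monic :=
      (Polynomial.monic_scaleRoots_iff d).2 (minpoly.monic (hKint x))
    have := Polynomial.natDegree_le_of_dvd h2 h3.ne_zero
    rwa [Polynomial.natDegree_scaleRoots] at this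
  have hcoef : ∀ n, ∃ r, Q.coeff n = algebraMap R K r := by
    intro n
    refine ufd_mem (R := R) _ fun p hp => ?_
    obtain ⟨d, hd, hint⟩ := H p hp
    have hd0 : d ≠ 0 := by rintro rfl; exact hd (dvd_zero _)
    have hdK : algebraMap R K d ≠ 0 := by
      rw [Ne, IsFractionRing.to_map_eq_zero_iff]; exact hd0
    rw [IsScalarTower.algebraMap_apply R K L] at hint
    have h1 := Polynomial.scaleRoots_aeval_eq_zero (r := algebraMap R K d) (minpoly.aeval K h)
    have h2 := minpoly.dvd K _ h1
    have h3 : (Polynomial.scaleRoots Q (algebraMap R K d)).Monic :=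
      (Polynomial.monic_scaleRoots_iff _).2 hQm
    have h4 : (Polynomial.scaleRoots Q (algebraMap R K d)).natDegree ≤
        (minpoly K (algebraMap K L (algebraMap R K d) * h)).natDegree := by
      rw [Polynomial.natDegree_scaleRoots]
      have := hscale (algebraMap K L (algebraMap R K d) * h) (algebraMap R K d)⁻¹ (inv_ne_zero hdK)
      rwa [← mul_assoc, ← map_mul, inv_mul_cancel₀ hdK, map_one, one_mul] at this
    have h5 := Polynomial.eq_of_monic_of_dvd_of_natDegree_le (minpoly.monic (hKint _)) h3 h2 h4
    have h6 := minpoly.isIntegrallyClosed_eq_field_fractions K L hint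
    have h7 := congrArg (fun q => Polynomial.coeff q n) (h5.trans h6)
    simp only [Polynomial.coeff_scaleRoots, Polynomial.coeff_map] at h7
    refine ⟨d ^ (Q.natDegree - n), (minpoly R (algebraMap K L (algebraMap R K d) * h)).coeff n, fun hdv => hd (hp.dvd_of_dvd_pow hdv), ?_⟩
    · rw [map_pow, mul_comm]
      exact h7
  have hlift : Q ∈ Polynomial.lifts (algebraMap R K) := by
    rw [Polynomial.lifts_iff_coeff_lifts]
    intro n
    obtain ⟨c, hc⟩ := hcoef n
    exact ⟨c, hc.symm⟩
  obtain ⟨p, hp, -, hpm⟩ := Polynomial.lifts_and_natDegree_eq_and_monic hlift hQm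
  refine ⟨p, hpm, ?_⟩
  have := minpoly.aeval K h
  rw [← hQ, ← hp, Polynomial.aeval_map_algebraMap] at this
  exact this

section
variable {m : ℕ} {L : Type*} [Field L] [Algebra ℂ L] [Algebra (MvPolynomial (Fin m) ℂ) L]
  [IsScalarTower ℂ (MvPolynomial (Fin m) ℂ) L]
  [Algebra (FractionRing (MvPolynomial (Fin m) ℂ)) L]
  [IsScalarTower (MvPolynomial (Fin m) ℂ) (FractionRing (MvPolynomial (Fin m) ℂ)) L]
  [FiniteDimensional (FractionRing (MvPolynomial (Fin m) ℂ)) L]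

local notation "RR" => MvPolynomial (Fin m) ℂ

theorem descent (D : Fin m → Derivation ℂ L L)
    (hD : ∀ i r, D i (algebraMap RR L r) = algebraMap RR L (pderiv i r))
    (hcomm : ∀ i j f, D i (D j f) = D j (D i f))
    (U : Set L) (hint : ∀ u ∈ U, IsIntegral RR u)
    (H : ∀ p : RR, Prime p → ∀ u ∈ U, ∃ d : RR, ¬ p ∣ d ∧
      ∀ i, algebraMap RR L d * D i u ∈ Algebra.adjoin RR U) :
    ∀ u ∈ U, ∃ r, u = algebraMap RR L r := by
  set B := Algebra.adjoin RR U with hB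
  have hRB : ∀ r : RR, algebraMap RR L r ∈ B := fun r => B.algebraMap_mem r
  have hBint : ∀ b ∈ B, IsIntegral RR b := by
    intro b hb
    have : B ≤ integralClosure RR L := Algebra.adjoin_le hint
    exact this hb
  have step1 : ∀ p : RR, Prime p → ∀ b ∈ B, ∃ d : RR, ¬ p ∣ d ∧
      ∀ i, algebraMap RR L d * D i b ∈ B := by
    intro p hp b hb
    induction hb using Algebra.adjoin_induction with
    | mem x hx => exact H p hp x hx
    | algebraMap r =>
      refine ⟨1, fun h => hp.not_unit (isUnit_of_dvd_one h), fun i => ?_⟩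
      rw [hD, map_one, one_mul]; exact hRB _
    | add x y hx hy ihx ihy =>
      obtain ⟨d, hd, h1⟩ := ihx
      obtain ⟨e, he, h2⟩ := ihy
      refine ⟨d * e, fun h => (hp.dvd_or_dvd h).elim hd he, fun i => ?_⟩
      have : algebraMap RR L (d * e) * D i (x + y) = algebraMap RR L e * (algebraMap RR L d * D i x)
          + algebraMap RR L d * (algebraMap RR L e * D i y) := by
        rw [map_mul, map_add]; ring
      rw [this]
      exact B.add_mem (B.mul_mem (hRB _) (h1 i)) (B.mul_mem (hRB _) (h2 i))
    | mul x y hx hy ihx ihy =>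
      obtain ⟨d, hd, h1⟩ := ihx
      obtain ⟨e, he, h2⟩ := ihy
      refine ⟨d * e, fun h => (hp.dvd_or_dvd h).elim hd he, fun i => ?_⟩
      have : algebraMap RR L (d * e) * D i (x * y)
          = y * algebraMap RR L e * (algebraMap RR L d * D i x)
          + x * algebraMap RR L d * (algebraMap RR L e * D i y) := by
        rw [map_mul, Derivation.leibniz]; simp only [smul_eq_mul]; ring
      rw [this]
      exact B.add_mem (B.mul_mem (B.mul_mem hy (hRB _)) (h1 i))
        (B.mul_mem (B.mul_mem hx (hRB _)) (h2 i))
  let T : Subalgebra RR L :=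
    { carrier := {h | ∀ p : RR, Prime p → ∃ d : RR, ¬ p ∣ d ∧ algebraMap RR L d * h ∈ B}
      mul_mem' := by
        intro x y hx hy p hp
        obtain ⟨d, hd, h1⟩ := hx p hp
        obtain ⟨e, he, h2⟩ := hy p hp
        refine ⟨d * e, fun h => (hp.dvd_or_dvd h).elim hd he, ?_⟩
        have : algebraMap RR L (d * e) * (x * y)
          = (algebraMap RR L d * x) * (algebraMap RR L e * y) := by rw [map_mul]; ring
        rw [this]
        exact B.mul_mem h1 h2
      add_mem' := by
        intro x y hx hy p hp
        obtain ⟨d, hd, h1⟩ := hx p hp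
        obtain ⟨e, he, h2⟩ := hy p hp
        refine ⟨d * e, fun h => (hp.dvd_or_dvd h).elim hd he, ?_⟩
        have : algebraMap RR L (d * e) * (x + y) = algebraMap RR L e * (algebraMap RR L d * x)
          + algebraMap RR L d * (algebraMap RR L e * y) := by rw [map_mul]; ring
        rw [this]
        exact B.add_mem (B.mul_mem (hRB _) h1) (B.mul_mem (hRB _) h2)
      algebraMap_mem' := by
        intro r p hp
        refine ⟨1, fun h => hp.not_unit (isUnit_of_dvd_one h), ?_⟩
        rw [map_one, one_mul]; exact hRB _ }
  have hBT : ∀ b ∈ B, b ∈ T := by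
    intro b hb p hp
    refine ⟨1, fun h => hp.not_unit (isUnit_of_dvd_one h), ?_⟩
    rw [map_one, one_mul]; exact hb
  have hDT : ∀ i, ∀ h ∈ T, D i h ∈ T := by
    intro i h hh p hp
    obtain ⟨d, hd, h1⟩ := hh p hp
    obtain ⟨e, he, h2⟩ := step1 p hp _ h1
    refine ⟨e * d * d, fun h => (hp.dvd_or_dvd h).elim
      (fun h => (hp.dvd_or_dvd h).elim he hd) hd, ?_⟩
    have h3 : D i (algebraMap RR L d * h) = algebraMap RR L d * D i h
        + h * algebraMap RR L (pderiv i d) := by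
      rw [Derivation.leibniz, hD]; rfl
    have : algebraMap RR L (e * d * d) * D i h = algebraMap RR L d *
        (algebraMap RR L e * D i (algebraMap RR L d * h)) - algebraMap RR L e *
        algebraMap RR L (pderiv i d) * (algebraMap RR L d * h) := by
      rw [h3, map_mul, map_mul]; ring
    rw [this]
    exact B.sub_mem (B.mul_mem (hRB _) (h2 i)) (B.mul_mem (B.mul_mem (hRB _) (hRB _)) h1)
  have hTint : T ≤ integralClosure RR L := by
    intro h hh
    refine integral_of_local (K := FractionRing RR) h fun p hp => ?_
    obtain ⟨d, hd, h1⟩ := hh p hp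
    exact ⟨d, hd, hBint _ h1⟩
  haveI : IsNoetherian RR (integralClosure RR L) :=
    IsIntegralClosure.isNoetherian RR (FractionRing RR) L (integralClosure RR L)
  haveI : IsNoetherian RR T := isNoetherian_of_injective
    (Subalgebra.inclusion hTint).toLinearMap (Subalgebra.inclusion_injective hTint)
  haveI : Module.Finite RR T := inferInstance
  have hinj : Function.Injective (algebraMap RR L) := by
    rw [IsScalarTower.algebraMap_eq RR (FractionRing RR) L]
    exact (algebraMap (FractionRing RR) L).injective.comp (IsFractionRing.injective RR _)
  haveI : FaithfulSMul RR T := by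
    rw [faithfulSMul_iff_algebraMap_injective]
    intro a b h
    exact hinj (congrArg Subtype.val h)
  haveI : IsScalarTower ℂ RR T := IsScalarTower.of_algebraMap_eq fun c => Subtype.ext
    (IsScalarTower.algebraMap_apply ℂ RR L c)
  let D' : Fin m → Derivation ℂ T T := fun i => Derivation.mk'
    { toFun := fun x => ⟨D i x, hDT i x x.2⟩
      map_add' := fun x y => Subtype.ext (map_add (D i) _ _)
      map_smul' := fun c x => Subtype.ext ((D i).map_smul c (x : L)) }
    (fun a b => Subtype.ext ((D i).leibniz a b))
  intro u hu
  obtain ⟨c, hc⟩ := all_mem D' (fun i r => Subtype.ext (hD i r))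
    (fun i j f => Subtype.ext (hcomm i j f)) ⟨u, hBT u (Algebra.subset_adjoin hu)⟩
  exact ⟨c, congrArg Subtype.val hc⟩

end
end FGQ


namespace FGQ
open MvPolynomial

section
variable {k m : ℕ}

lemma inv_integral (Γ : Subgroup (GG k)) [Finite Γ] :
    Algebra.IsIntegral (invariantSubalgebra k Γ) (MvPolynomial (Fin k) ℂ) := by
  classical
  refine ⟨fun u => ?_⟩
  haveI := Fintype.ofFinite Γ
  let P0 : Polynomial (MvPolynomial (Fin k) ℂ) :=
    ∏ g : Γ, (Polynomial.X - Polynomial.C (act (g : GG k) u))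
  have hP0 : ∀ g ∈ Γ, P0.map (act g : MvPolynomial (Fin k) ℂ →+* _) = P0 := by
    intro g hg
    simp only [P0, Polynomial.map_prod, Polynomial.map_sub, Polynomial.map_X, Polynomial.map_C]
    refine Fintype.prod_equiv (Equiv.mulRight (⟨g, hg⟩ : Γ)) _ _ (fun h => ?_)
    rw [Equiv.coe_mulRight, Subgroup.coe_mul, act_mul]
    rfl
  have hlift : P0 ∈ Polynomial.lifts (algebraMap (invariantSubalgebra k Γ) (MvPolynomial (Fin k) ℂ)) := by
    rw [Polynomial.lifts_iff_coeff_lifts]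
    intro n
    refine ⟨⟨P0.coeff n, mem_inv.2 fun g hg => ?_⟩, rfl⟩
    conv_rhs => rw [← hP0 g hg]
    rw [Polynomial.coeff_map]
    rfl
  have hmon : P0.Monic := Polynomial.monic_prod_of_monic _ _ fun g _ => Polynomial.monic_X_sub_C _
  obtain ⟨P, hP, -, hPm⟩ := Polynomial.lifts_and_natDegree_eq_and_monic hlift hmon
  refine ⟨P, hPm, ?_⟩
  rw [Polynomial.eval₂_eq_eval_map, hP, Polynomial.eval_prod]
  refine Finset.prod_eq_zero (Finset.mem_univ (1 : Γ)) ?_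
  rw [Subgroup.coe_one, act_one]; simp

lemma exists_lift (Γ : Subgroup (GG k)) [Finite Γ]
    (φ : invariantSubalgebra k Γ →ₐ[ℂ] MvPolynomial (Fin m) ℂ) (hdom : Function.Injective φ)
    {Ω : Type*} [Field Ω] [IsAlgClosed Ω] (j : MvPolynomial (Fin m) ℂ →+* Ω)
    (hj : Function.Injective j) :
    ∃ ι : MvPolynomial (Fin k) ℂ →+* Ω, ∀ a : invariantSubalgebra k Γ, ι a = j (φ a) := by
  letI : Algebra (invariantSubalgebra k Γ) Ω := (j.comp (φ : _ →+* _)).toAlgebra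
  haveI := inv_integral Γ
  have h1 : Function.Injective (algebraMap (invariantSubalgebra k Γ) Ω) := hj.comp hdom
  have h2 : Function.Injective (algebraMap (invariantSubalgebra k Γ) (MvPolynomial (Fin k) ℂ)) :=
    Subtype.val_injective
  haveI := (Module.isTorsionFree_iff_algebraMap_injective (R := invariantSubalgebra k Γ) (A := Ω)).2 h1
  haveI := (Module.isTorsionFree_iff_algebraMap_injective (R := invariantSubalgebra k Γ)
    (A := MvPolynomial (Fin k) ℂ)).2 h2
  let ι : MvPolynomial (Fin k) ℂ →ₐ[invariantSubalgebra k Γ] Ω := IsAlgClosed.lift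
  exact ⟨ι, fun a => ι.commutes a⟩

set_option maxHeartbeats 2000000 in
theorem invN_le (N Γ : Subgroup (GG k)) [Finite Γ] (hN : N ≤ Γ)
    (hnorm : ∀ g ∈ Γ, ∀ n ∈ N, g * n * g⁻¹ ∈ N)
    (φ : invariantSubalgebra k Γ →ₐ[ℂ] MvPolynomial (Fin m) ℂ) (hdom : Function.Injective φ)
    (hintcl : ∀ p : MvPolynomial (Fin m) ℂ,
      IsIntegral (φ.range : Subalgebra ℂ (MvPolynomial (Fin m) ℂ)) p → p ∈ φ.range)
    (Hy : ∀ p : MvPolynomial (Fin m) ℂ, Prime p → ∃ y : Fin k → ℂ,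
      (∀ s ∈ Γ, s y = y → s ∈ N) ∧ ∀ a : invariantSubalgebra k Γ, p ∣ φ a →
        eval y (a : MvPolynomial (Fin k) ℂ) = 0) :
    invariantSubalgebra k N ≤ invariantSubalgebra k Γ := by
  let R := MvPolynomial (Fin m) ℂ
  let S := MvPolynomial (Fin k) ℂ
  let K := FractionRing R
  let Ω := AlgebraicClosure K
  have hRΩ : Function.Injective (algebraMap R Ω) := by
    rw [IsScalarTower.algebraMap_eq R K Ω]
    exact (algebraMap K Ω).injective.comp (IsFractionRing.injective R K)
  obtain ⟨ι₀, hι₀⟩ := exists_lift Γ φ hdom (algebraMap R Ω) hRΩ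
  let L := IntermediateField.adjoin K (Set.range fun i => ι₀ (X i))
  haveI : FiniteDimensional K L := IntermediateField.finiteDimensional_adjoin
    fun x _ => Algebra.IsIntegral.isIntegral x
  have hιL : ∀ s, ι₀ s ∈ L := by
    intro s
    induction s using MvPolynomial.induction_on with
    | C c =>
      have : ι₀ (C c) = algebraMap R Ω (φ (algebraMap ℂ _ c)) := hι₀ (algebraMap ℂ _ c)
      rw [this, IsScalarTower.algebraMap_apply R K Ω]
      exact L.algebraMap_mem _
    | add p q hp hq => rw [map_add]; exact L.add_mem hp hq
    | mul_X p i hp =>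
      rw [map_mul]
      exact L.mul_mem hp (IntermediateField.subset_adjoin _ _ ⟨i, rfl⟩)
  let ι : S →+* L := ι₀.codRestrict L hιL
  have hι : ∀ a : invariantSubalgebra k Γ, ι a = algebraMap R L (φ a) := fun a =>
    Subtype.ext (hι₀ a)
  haveI : Algebra.FormallyEtale R K := Algebra.FormallyEtale.of_isLocalization (nonZeroDivisors R)
  haveI : Algebra.FormallyEtale K L := Algebra.FormallyEtale.of_isSeparable K L
  haveI : Algebra.FormallyEtale R L := Algebra.FormallyEtale.comp R K L
  haveI : IsScalarTower ℂ R L := IsScalarTower.of_algebraMap_eq fun c => Subtype.ext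
    (IsScalarTower.algebraMap_apply ℂ R Ω c)
  obtain ⟨D, hD, hcomm⟩ := exists_derivs (m := m) (T := L)
  have hinj : Function.Injective (algebraMap R L) := fun a b h => hRΩ (congrArg Subtype.val h)
  -- polynomial identities
  have haev : ∀ (u : S) (P : Polynomial (invariantSubalgebra k Γ)),
      ι (Polynomial.aeval u P) = Polynomial.aeval (ι u) (P.map (φ : _ →+* R)) := by
    intro u P
    have hc : (ι : S →+* L).comp (algebraMap (invariantSubalgebra k Γ) S)
        = (algebraMap R L).comp (φ : _ →+* R) := RingHom.ext hι
    rw [Polynomial.aeval_def, Polynomial.hom_eval₂, hc, Polynomial.aeval_def, Polynomial.eval₂_map]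
  have hmain := descent D hD hcomm (ι '' (invariantSubalgebra k N)) ?_ ?_
  · intro u hu
    obtain ⟨r, hr⟩ := hmain (ι u) ⟨u, hu, rfl⟩
    obtain ⟨P, hPm, hP⟩ := (inv_integral Γ).isIntegral u
    have h1 : Polynomial.aeval r (P.map (φ : _ →+* R)) = 0 := by
      apply hinj
      rw [← Polynomial.aeval_algebraMap_apply, ← hr, ← haev, map_zero]
      have : Polynomial.aeval u P = 0 := hP
      rw [this, map_zero]
    have h2 : IsIntegral (φ.range : Subalgebra ℂ R) r := by
      refine ⟨P.map (φ.rangeRestrict : _ →+* φ.range), hPm.map _, ?_⟩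
      rw [Polynomial.eval₂_map]
      rw [Polynomial.aeval_def, Polynomial.eval₂_map] at h1
      exact h1
    obtain ⟨a, ha⟩ := hintcl r h2
    have h3 : ι u = ι a := by rw [hι, hr]; exact congrArg _ ha.symm
    -- `ι` is injective since it is so on the integral subring
    haveI := inv_integral Γ
    have hker : RingHom.ker ι = ⊥ := by
      refine Ideal.eq_bot_of_comap_eq_bot (R := invariantSubalgebra k Γ) ?_
      rw [eq_bot_iff]
      intro b hb
      have hb' : ι (b : S) = 0 := hb
      rw [hι, ← map_zero (algebraMap R L)] at hb'
      have := hinj hb'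
      rw [← map_zero φ] at this
      exact hdom this
    have h4 := (RingHom.injective_iff_ker_eq_bot ι).2 hker h3
    rw [h4]
    exact a.2
  · rintro _ ⟨u, hu, rfl⟩
    obtain ⟨P, hPm, hP⟩ := (inv_integral Γ).isIntegral u
    refine ⟨P.map (φ : _ →+* R), hPm.map _, ?_⟩
    have h1 : Polynomial.aeval u P = 0 := hP
    have h2 := haev u P
    rw [h1, map_zero] at h2
    exact h2.symm
  · rintro p hp _ ⟨b, hb, rfl⟩
    obtain ⟨y, hy1, hy2⟩ := Hy p hp
    obtain ⟨u₁, hu₁, u₂, hu₂, c, hs₁, hs₂, hbu⟩ := sep_decomp N Γ hN hnorm y hy1 b hb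
    set B := Algebra.adjoin R (ι '' (invariantSubalgebra k N : Set S)) with hB
    have hιB : ∀ u ∈ invariantSubalgebra k N, ι u ∈ B := fun u hu =>
      Algebra.subset_adjoin ⟨u, hu, rfl⟩
    have hone : ∀ u ∈ invariantSubalgebra k N, Sep N Γ y u → ∃ d : invariantSubalgebra k Γ,
        eval y (d : S) ≠ 0 ∧ ∀ i, algebraMap R L (φ d) * D i (ι u) ∈ B := by
      intro u hu hs
      obtain ⟨P, e, d, hP, he, hd, hde⟩ := sep_poly N Γ hN y u hu hs
      refine ⟨d, hd, fun i => ?_⟩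
      obtain ⟨q, -, hq⟩ := D_aeval (pderiv i) (D i) (hD i) (ι u) (P.map (φ : _ →+* R))
      rw [← haev, hP, map_zero, map_zero, Polynomial.derivative_map, ← haev] at hq
      have : algebraMap R L (φ d) * D i (ι u) = ι e * (- Polynomial.aeval (ι u) q) := by
        rw [← hι, hde, map_mul, mul_assoc]
        congr 1
        linear_combination -hq
      rw [this]
      refine B.mul_mem (hιB e he) (B.neg_mem ?_)
      refine Algebra.adjoin_mono ?_ (Polynomial.aeval_mem_adjoin_singleton R (ι u))
      rintro _ rfl
      exact ⟨u, hu, rfl⟩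
    obtain ⟨d₁, hd₁, h₁⟩ := hone u₁ hu₁ hs₁
    obtain ⟨d₂, hd₂, h₂⟩ := hone u₂ hu₂ hs₂
    refine ⟨φ (d₁ * d₂), fun hdv => ?_, fun i => ?_⟩
    · have := hy2 _ hdv
      rw [MulMemClass.coe_mul, map_mul] at this
      exact (mul_ne_zero hd₁ hd₂) this
    · have hcc : ι (C c) = algebraMap R L (C c) := by
        have := hι (algebraMap ℂ _ c)
        rw [AlgHom.commutes] at this
        exact this
      have hDc : D i (algebraMap R L (C c)) = 0 := by rw [hD, pderiv_C, map_zero]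
      have : algebraMap R L (φ (d₁ * d₂)) * D i (ι b) =
          algebraMap R L (φ d₂) * (algebraMap R L (φ d₁) * D i (ι u₁)) -
          algebraMap R L (φ d₁) * algebraMap R L (C c) *
            (algebraMap R L (φ d₂) * D i (ι u₂)) := by
        rw [hbu, map_sub, map_mul, map_sub, map_mul, map_mul, Derivation.leibniz, hcc, hDc]
        simp only [smul_eq_mul, mul_zero, add_zero]
        ring
      rw [this]
      exact B.sub_mem (B.mul_mem (B.algebraMap_mem _) (h₁ i))
        (B.mul_mem (B.mul_mem (B.algebraMap_mem _) (B.algebraMap_mem _)) (h₂ i))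

end
end FGQ

open MvPolynomial
namespace FGQ

lemma zar_open {m : ℕ} (U : Set (Fin m → ℂ)) (hU : @IsOpen _ (zariskiTop (Fin m)) U) :
    ∀ x ∈ U, ∃ f : MvPolynomial (Fin m) ℂ, eval x f ≠ 0 ∧ ∀ z, eval z f ≠ 0 → z ∈ U := by
  unfold zariskiTop at hU
  have hU' : TopologicalSpace.GenerateOpen
    {U | ∃ f : MvPolynomial (Fin m) ℂ, U = {p | MvPolynomial.eval p f ≠ 0}} U := hU
  induction hU' with
  | basic s hs =>
    obtain ⟨f, rfl⟩ := hs
    intro x hx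
    exact ⟨f, hx, fun z hz => hz⟩
  | univ => intro x _; exact ⟨1, by simp, fun z _ => trivial⟩
  | inter s t hs ht ih1 ih2 =>
    rintro x ⟨hx1, hx2⟩
    obtain ⟨f, hf, hf'⟩ := ih1 hs x hx1
    obtain ⟨g, hg, hg'⟩ := ih2 ht x hx2
    refine ⟨f * g, by simp [hf, hg], fun z hz => ?_⟩
    rw [map_mul] at hz
    exact ⟨hf' z (left_ne_zero_of_mul hz), hg' z (right_ne_zero_of_mul hz)⟩
  | sUnion S hS ih =>
    rintro x ⟨s, hs, hx⟩
    obtain ⟨f, hf, hf'⟩ := ih s hs (hS s hs) x hx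
    exact ⟨f, hf, fun z hz => ⟨s, hs, hf' z hz⟩⟩

lemma zar_basic {m : ℕ} (f : MvPolynomial (Fin m) ℂ) :
    @IsOpen _ (zariskiTop (Fin m)) {p | eval p f ≠ 0} :=
  TopologicalSpace.GenerateOpen.basic _ ⟨f, rfl⟩

lemma exists_pt {m : ℕ} (P : Ideal (MvPolynomial (Fin m) ℂ)) (hP : P.IsPrime)
    (g) (hg : g ∉ P) : ∃ x : Fin m → ℂ, (∀ f ∈ P, eval x f = 0) ∧ eval x g ≠ 0 := by
  obtain ⟨ev, h1, h2⟩ := exists_point P hP g hg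
  have : ∀ f, ev f = eval (fun i => ev (X i)) f := by
    intro f
    rw [← MvPolynomial.coe_aeval_eq_eval]
    have : ev = aeval (fun i => ev (X i)) := by ext i; simp
    conv_lhs => rw [this]
    rfl
  exact ⟨fun i => ev (X i), fun f hf => by rw [← this]; exact h1 f hf, by rw [← this]; exact h2⟩

lemma dim_le_top {m : ℕ} (I : Ideal (MvPolynomial (Fin m) ℂ)) (F : Set (Fin m → ℂ))
    (hF : ∀ x, x ∈ F ↔ ∀ f ∈ I, eval x f = 0) :
    ringKrullDim (MvPolynomial (Fin m) ℂ ⧸ I) ≤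
      @topologicalKrullDim F
        (TopologicalSpace.induced (fun x => (x : Fin m → ℂ)) (zariskiTop (Fin m))) := by
  letI : TopologicalSpace (Fin m → ℂ) := zariskiTop (Fin m)
  letI : TopologicalSpace F :=
    TopologicalSpace.induced (fun x => (x : Fin m → ℂ)) (zariskiTop (Fin m))
  let mk := Ideal.Quotient.mk I
  let Z : PrimeSpectrum (MvPolynomial (Fin m) ℂ ⧸ I) → Set F := fun Q =>
    {x | ∀ f, mk f ∈ Q.asIdeal → eval (x : Fin m → ℂ) f = 0}
  have pt : ∀ (Q : PrimeSpectrum (MvPolynomial (Fin m) ℂ ⧸ I)) g, mk g ∉ Q.asIdeal →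
      ∃ x ∈ Z Q, eval (x : Fin m → ℂ) g ≠ 0 := by
    intro Q g hg
    obtain ⟨x, h1, h2⟩ := exists_pt (Q.asIdeal.comap mk) (Ideal.IsPrime.comap mk) g hg
    refine ⟨⟨x, (hF x).2 fun f hf => h1 f ?_⟩, fun f hf => h1 f hf, h2⟩
    rw [Ideal.mem_comap, Ideal.Quotient.eq_zero_iff_mem.2 hf]
    exact zero_mem _
  have hop : ∀ (U : Set F), IsOpen U → ∀ x ∈ U, ∃ f : MvPolynomial (Fin m) ℂ,
      eval (x : Fin m → ℂ) f ≠ 0 ∧ ∀ z : F, eval (z : Fin m → ℂ) f ≠ 0 → z ∈ U := by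
    intro U hU x hx
    obtain ⟨V, hV, rfl⟩ := hU
    obtain ⟨f, hf, hf'⟩ := zar_open V hV x hx
    exact ⟨f, hf, fun z hz => hf' z hz⟩
  have hcl : ∀ Q, IsClosed (Z Q) := by
    intro Q
    have : Z Q = ⋂ f : {f // mk f ∈ Q.asIdeal}, {x : F | eval (x : Fin m → ℂ) f.1 = 0} := by
      ext x; simp [Z]
    rw [this]
    refine isClosed_iInter fun f => ?_
    rw [← isOpen_compl_iff]
    exact ⟨{p | eval p f.1 ≠ 0}, zar_basic f.1, rfl⟩
  have hirr : ∀ Q, IsIrreducible (Z Q) := by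
    intro Q
    constructor
    · obtain ⟨x, hx, _⟩ := pt Q 1 (by rw [map_one]; exact Q.isPrime.one_notMem)
      exact ⟨x, hx⟩
    · rintro U V hU hV ⟨x, hx, hxU⟩ ⟨x', hx', hxV⟩
      obtain ⟨f, hf, hf'⟩ := hop U hU x hxU
      obtain ⟨g, hg, hg'⟩ := hop V hV x' hxV
      obtain ⟨z, hz, hz'⟩ := pt Q (f * g) (by
        rw [map_mul]
        intro h
        rcases Q.isPrime.mem_or_mem h with h | h
        · exact hf (hx f h)
        · exact hg (hx' g h))
      rw [map_mul] at hz'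
      exact ⟨z, hz, hf' z (left_ne_zero_of_mul hz'), hg' z (right_ne_zero_of_mul hz')⟩
  let G : PrimeSpectrum (MvPolynomial (Fin m) ℂ ⧸ I) →
    (TopologicalSpace.IrreducibleCloseds F)ᵒᵈ := fun Q =>
      OrderDual.toDual ⟨Z Q, hirr Q, hcl Q⟩
  have hG : StrictMono G := by
    intro Q Q' h
    obtain ⟨h1, h2⟩ := h
    refine OrderDual.toDual_lt_toDual.2 ⟨?_, ?_⟩
    · intro x hx f hf
      exact hx f (h1 hf)
    · intro h3
      apply h2
      intro a ha
      obtain ⟨f, rfl⟩ := Ideal.Quotient.mk_surjective a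
      by_contra hn
      obtain ⟨x, hx, hx'⟩ := pt Q f hn
      exact hx' (h3 hx f ha)
  have := Order.krullDim_le_of_strictMono G hG
  rw [Order.krullDim_orderDual] at this
  exact this

end FGQ

open MvPolynomial
namespace FGQ

lemma dim_le_int {A S : Type*} [CommRing A] [CommRing S] [Algebra A S] [Algebra.IsIntegral A S]
    (hinj : Function.Injective (algebraMap A S)) : ringKrullDim A ≤ ringKrullDim S := by
  refine iSup_le fun l => ?_
  obtain ⟨Q, -, hQ, hQ'⟩ := Ideal.exists_ideal_over_prime_of_isIntegral
    (S := S) l.head.asIdeal ⊥ (by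
      rw [← RingHom.ker_eq_comap_bot, (RingHom.injective_iff_ker_eq_bot _).1 hinj]; exact bot_le)
  haveI : Q.LiesOver l.head.asIdeal := ⟨hQ'.symm⟩
  obtain ⟨L, h, -⟩ := Ideal.exists_ltSeries_of_hasGoingUp l Q
  rw [← h]
  exact le_iSup (fun l : LTSeries (PrimeSpectrum S) => ((l.length : ℕ∞) : WithBot ℕ∞)) L

lemma dim_ge_int {A S : Type*} [CommRing A] [CommRing S] [Algebra A S] [Algebra.IsIntegral A S] :
    ringKrullDim S ≤ ringKrullDim A := by
  refine Order.krullDim_le_of_strictMono (PrimeSpectrum.comap (algebraMap A S)) ?_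
  intro P Q h
  exact Ideal.IsIntegral.comap_lt_comap (I := P.asIdeal) (J := Q.asIdeal) h

lemma dim_mv (m : ℕ) : ringKrullDim (MvPolynomial (Fin m) ℂ) = m := by
  rw [MvPolynomial.ringKrullDim_of_isNoetherianRing]
  simp

noncomputable def ptI {m : ℕ} (x : Fin m → ℂ) : Ideal (MvPolynomial (Fin m) ℂ) := RingHom.ker (eval x)

instance {m : ℕ} (x : Fin m → ℂ) : (ptI x).IsPrime := RingHom.ker_isPrime _

noncomputable def transl {m : ℕ} (v : Fin m → ℂ) :
    MvPolynomial (Fin m) ℂ →ₐ[ℂ] MvPolynomial (Fin m) ℂ := aeval fun i => X i + C (v i)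

lemma transl_transl {m : ℕ} (v w : Fin m → ℂ) (h : v + w = 0) :
    (transl v).comp (transl w) = AlgHom.id ℂ _ := by
  ext1 i
  have h := congrFun h i
  simp only [Pi.add_apply, Pi.zero_apply] at h
  rw [AlgHom.comp_apply, AlgHom.id_apply]
  unfold transl
  rw [aeval_X, map_add, aeval_X, aeval_C, add_assoc, MvPolynomial.algebraMap_eq, ← C_add, h, C_0, add_zero]
  
noncomputable def translE {m : ℕ} (v : Fin m → ℂ) :
    MvPolynomial (Fin m) ℂ ≃ₐ[ℂ] MvPolynomial (Fin m) ℂ :=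
  AlgEquiv.ofAlgHom (transl v) (transl (-v)) (transl_transl _ _ (by simp))
    (transl_transl _ _ (by simp))

lemma eval_transl {m : ℕ} (v x : Fin m → ℂ) (f) : eval x (transl v f) = eval (x + v) f := by
  induction f using MvPolynomial.induction_on with
  | C a => simp [transl]
  | add p q hp hq => rw [map_add, map_add, hp, hq, map_add]
  | mul_X p i hp => rw [map_mul, map_mul, hp, map_mul]; simp [transl]

lemma height_ptI {m : ℕ} (x : Fin m → ℂ) : (ptI x).height = m := by
  haveI : FiniteRingKrullDim (MvPolynomial (Fin m) ℂ) := by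
    rw [finiteRingKrullDim_iff_ne_bot_and_top, dim_mv]
    exact ⟨WithBot.coe_ne_bot, fun h => by
      have := WithBot.coe_eq_top.1 h
      exact ENat.coe_ne_top m this⟩
  obtain ⟨M, hM, hM'⟩ := Ideal.exists_isMaximal_height (R := MvPolynomial (Fin m) ℂ)
  rw [dim_mv] at hM'
  obtain ⟨z, hz, -⟩ := exists_pt M hM.isPrime 1 (hM.isPrime.one_notMem)
  have h1 : M = ptI z := hM.eq_of_le (Ideal.IsPrime.ne_top inferInstance) hz
  have h2 : (ptI z).comap (translE (x - z)).toRingEquiv = ptI x := by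
    ext f
    rw [Ideal.mem_comap]
    change eval z (transl (x - z) f) = 0 ↔ eval x f = 0
    rw [eval_transl]
    simp
  rw [← h2, RingEquiv.height_comap, ← h1]
  exact_mod_cast hM'

lemma dim_bound {m : ℕ} {A : Type*} [CommRing A] [IsNoetherianRing A]
    (φ : A →+* MvPolynomial (Fin m) ℂ) (π : MvPolynomial (Fin m) ℂ) (x0 : Fin m → ℂ)
    (hx : eval x0 π = 0) (d D : ℕ)
    (hd : ringKrullDim (A ⧸ (Ideal.span {π}).comap φ) ≤ d)
    (hD : ringKrullDim (MvPolynomial (Fin m) ℂ ⧸ ((ptI x0).comap φ).map φ) ≤ D) :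
    m ≤ d + D + 1 := by
  set q : Ideal A := (Ideal.span {π}).comap φ with hq
  let f : (A ⧸ q) →+* (MvPolynomial (Fin m) ℂ ⧸ Ideal.span {π}) :=
    Ideal.quotientMap (Ideal.span {π}) φ le_rfl
  letI : Algebra (A ⧸ q) (MvPolynomial (Fin m) ℂ ⧸ Ideal.span {π}) := f.toAlgebra
  have hπ : π ∈ ptI x0 := hx
  have h1 := Ideal.height_le_height_add_one_of_mem hπ
  rw [height_ptI] at h1
  set mk := Ideal.Quotient.mk (Ideal.span {π}) with hmk
  have hsp : Ideal.span {π} ≤ ptI x0 := by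
    rw [Ideal.span_le]; simpa using hπ
  haveI hP : ((ptI x0).map mk).IsPrime :=
    Ideal.map_isPrime_of_surjective Ideal.Quotient.mk_surjective (by rwa [Ideal.mk_ker])
  set P := (ptI x0).map mk with hPd
  set p : Ideal (A ⧸ q) := P.comap f with hp
  haveI : P.LiesOver p := ⟨rfl⟩
  have h2 := Ideal.height_le_height_add_of_liesOver p P
  have hle : p.map (algebraMap (A ⧸ q) (MvPolynomial (Fin m) ℂ ⧸ Ideal.span {π})) ≤ P :=
    Ideal.map_comap_le
  set J := p.map (algebraMap (A ⧸ q) (MvPolynomial (Fin m) ℂ ⧸ Ideal.span {π})) with hJ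
  haveI hP2 : (P.map (Ideal.Quotient.mk J)).IsPrime :=
    Ideal.map_isPrime_of_surjective Ideal.Quotient.mk_surjective (by rwa [Ideal.mk_ker])
  have h3 : (p.height : WithBot ℕ∞) ≤ d := Ideal.height_le_ringKrullDim_of_isPrime.trans hd
  have h4 : ((P.map (Ideal.Quotient.mk J)).height : WithBot ℕ∞) ≤ D := by
    refine Ideal.height_le_ringKrullDim_of_isPrime.trans (le_trans ?_ hD)
    refine ringKrullDim_le_of_surjective
      (Ideal.Quotient.lift _ ((Ideal.Quotient.mk J).comp mk) ?_) ?_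
    · intro a ha
      have : ((ptI x0).comap φ).map φ ≤ RingHom.ker ((Ideal.Quotient.mk J).comp mk) := by
        rw [Ideal.map_le_iff_le_comap]
        intro b hb
        change (Ideal.Quotient.mk J) (mk (φ b)) = 0
        rw [Ideal.Quotient.eq_zero_iff_mem]
        have : mk (φ b) = algebraMap _ _ (Ideal.Quotient.mk q b) := rfl
        rw [this]
        apply Ideal.mem_map_of_mem
        exact Ideal.mem_map_of_mem mk hb
      exact this ha
    · refine Ideal.Quotient.lift_surjective_of_surjective _ _ ?_
      exact Ideal.Quotient.mk_surjective.comp Ideal.Quotient.mk_surjective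
  have h3' : p.height ≤ (d : ℕ∞) := by exact_mod_cast h3
  have h4' : (P.map (Ideal.Quotient.mk J)).height ≤ (D : ℕ∞) := by exact_mod_cast h4
  have : (m : ℕ∞) ≤ ((d + D + 1 : ℕ) : ℕ∞) := by
    push_cast
    refine h1.trans ?_
    gcongr
    refine h2.trans ?_
    gcongr
  exact_mod_cast this

end FGQ

open MvPolynomial
namespace FGQ

lemma pt_of_prime {k : ℕ} (N Γ : Subgroup (GG k)) [Finite Γ]
    (q : Ideal (MvPolynomial (Fin k) ℂ)) (hq : q.IsPrime)
    (h : ∀ s ∈ Γ, s ∉ N → ∃ i, act s (X i) - X i ∉ q) :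
    ∃ y : Fin k → ℂ, (∀ s ∈ Γ, s y = y → s ∈ N) ∧ ∀ f ∈ q, eval y f = 0 := by
  classical
  haveI := Fintype.ofFinite Γ
  have h' : ∀ s : Γ, ∃ f : MvPolynomial (Fin k) ℂ, f ∉ q ∧
      ∀ y : Fin k → ℂ, eval y f ≠ 0 → (s : GG k) y = y → (s : GG k) ∈ N := by
    intro s
    by_cases hs : (s : GG k) ∈ N
    · exact ⟨1, hq.one_notMem, fun _ _ _ => hs⟩
    · obtain ⟨i, hi⟩ := h s s.2 hs
      refine ⟨_, hi, fun y hy hsy => ?_⟩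
      rw [map_sub, eval_act, hsy, sub_self] at hy
      exact absurd rfl hy
  choose f hf hf' using h'
  obtain ⟨y, hy1, hy2⟩ := exists_pt q hq (∏ s, f s) (by
    intro hmem
    obtain ⟨s, _, hs⟩ := (hq.prod_mem_iff).1 hmem
    exact hf s hs)
  refine ⟨y, fun s hs hsy => ?_, hy1⟩
  rw [map_prod] at hy2
  exact hf' ⟨s, hs⟩ y (Finset.prod_ne_zero_iff.1 hy2 _ (Finset.mem_univ _)) hsy

lemma act_sub_X {k : ℕ} (s : GG k) (i : Fin k) :
    act s (X i) - X i = ∑ j, (LinearMap.toMatrix'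
      ((s : (Fin k → ℂ) →ₗ[ℂ] (Fin k → ℂ)) - LinearMap.id) i j) • (X j : MvPolynomial (Fin k) ℂ) := by
  classical
  rw [act, aeval_X]
  have : (X i : MvPolynomial (Fin k) ℂ) = ∑ j, C ((Pi.single j 1 : Fin k → ℂ) i) * X j := by
    simp [Pi.single_apply]
  conv_lhs => rw [this]
  rw [← Finset.sum_sub_distrib]
  refine Finset.sum_congr rfl fun j _ => ?_
  rw [LinearMap.toMatrix'_apply, smul_eq_C_mul, LinearMap.sub_apply, LinearMap.id_apply,
    Pi.sub_apply, C_sub, sub_mul]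
  have h : (fun j' => if j' = j then (1 : ℂ) else 0) = Pi.single j 1 := by
    ext l; simp [Pi.single_apply]
  simp [h]

lemma small_dim {k : ℕ} (q : Ideal (MvPolynomial (Fin k) ℂ)) (s : GG k)
    (h : ∀ i, act s (X i) - X i ∈ q)
    (hr : Module.finrank ℂ (LinearMap.ker
      ((s : (Fin k → ℂ) →ₗ[ℂ] (Fin k → ℂ)) - LinearMap.id)) + 2 ≤ k) :
    ringKrullDim (MvPolynomial (Fin k) ℂ ⧸ q) ≤ ((k - 2 : ℕ) : WithBot ℕ∞) := by
  classical
  set u := (s : (Fin k → ℂ) →ₗ[ℂ] (Fin k → ℂ)) - LinearMap.id with hu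
  set M := LinearMap.toMatrix' u with hM
  let mk : MvPolynomial (Fin k) ℂ →ₐ[ℂ] (MvPolynomial (Fin k) ℂ ⧸ q) := Ideal.Quotient.mkₐ ℂ q
  let Lm : (Fin k → ℂ) →ₗ[ℂ] (MvPolynomial (Fin k) ℂ ⧸ q) :=
    Fintype.linearCombination ℂ (fun i => mk (X i))
  have hker : LinearMap.range (Matrix.mulVecLin M.transpose) ≤ LinearMap.ker Lm := by
    rintro _ ⟨c, rfl⟩
    rw [LinearMap.mem_ker, Matrix.mulVecLin_apply]
    have h1 : Lm (M.transpose.mulVec c) = mk (∑ i, c i • (act s (X i) - X i)) := by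
      rw [Fintype.linearCombination_apply, map_sum]
      simp only [act_sub_X, map_smul, map_sum, Finset.smul_sum, Matrix.mulVec, dotProduct,
        Finset.sum_smul, Matrix.transpose_apply, ← hu, ← hM]
      rw [Finset.sum_comm]
      refine Finset.sum_congr rfl fun i _ => Finset.sum_congr rfl fun j _ => ?_
      rw [smul_smul, mul_comm]
    rw [h1]
    change Ideal.Quotient.mk q _ = 0
    rw [Ideal.Quotient.eq_zero_iff_mem]
    refine Ideal.sum_mem _ fun i _ => ?_
    rw [smul_eq_C_mul]
    exact Ideal.mul_mem_left _ _ (h i)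
  have hrank : Module.finrank ℂ (LinearMap.range (Matrix.mulVecLin M.transpose)) =
      Module.finrank ℂ (LinearMap.range u) := by
    have h1 : M.transpose.rank = M.rank := Matrix.rank_transpose M
    have h2 : Matrix.mulVecLin M = u := by
      rw [← Matrix.toLin'_apply', hM, Matrix.toLin'_toMatrix']
    rw [Matrix.rank, Matrix.rank, h2] at h1
    exact h1
  have h3 := LinearMap.finrank_range_add_finrank_ker u
  have h4 := LinearMap.finrank_range_add_finrank_ker Lm
  have h5 := Submodule.finrank_mono hker
  rw [hrank] at h5
  simp only [Module.finrank_fintype_fun_eq_card, Fintype.card_fin] at h3 h4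
  have h6 : Module.finrank ℂ (LinearMap.range Lm) ≤ k - 2 := by omega
  let b := Module.finBasis ℂ (LinearMap.range Lm)
  let G : MvPolynomial (Fin (Module.finrank ℂ (LinearMap.range Lm))) ℂ →ₐ[ℂ]
    (MvPolynomial (Fin k) ℂ ⧸ q) := aeval fun i => (b i : MvPolynomial (Fin k) ℂ ⧸ q)
  have hG : Function.Surjective G := by
    have hX : ∀ i, mk (X i) ∈ G.range := by
      intro i
      have hi : mk (X i) ∈ LinearMap.range Lm := ⟨Pi.single i 1, by
        rw [Fintype.linearCombination_apply_single, one_smul]⟩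
      have := b.sum_repr ⟨_, hi⟩
      have := congrArg Subtype.val this
      simp only at this
      rw [← this, Submodule.coe_sum]
      refine Subalgebra.sum_mem _ fun j _ => ?_
      rw [Submodule.coe_smul]
      refine Subalgebra.smul_mem _ ?_ _
      exact ⟨X j, by simp [G]⟩
    intro z
    obtain ⟨f, rfl⟩ := Ideal.Quotient.mk_surjective z
    change mk f ∈ G.range
    induction f using MvPolynomial.induction_on with
    | C a =>
      have : mk (C a) = algebraMap ℂ _ a := mk.commutes a
      rw [this]; exact Subalgebra.algebraMap_mem _ _
    | add p q hp hq => rw [map_add]; exact add_mem hp hq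
    | mul_X p i hp => rw [map_mul]; exact mul_mem hp (hX i)
  have h7 := ringKrullDim_le_of_surjective G.toRingHom hG
  rw [dim_mv] at h7
  exact h7.trans (by exact_mod_cast h6)

end FGQ

open MvPolynomial
namespace FGQ

/-- the reflections in `Γ` -/
def RS {k : ℕ} (Γ : Subgroup (GG k)) : Set (GG k) :=
  {g : (Fin k → ℂ) ≃ₗ[ℂ] (Fin k → ℂ) | g ∈ Γ ∧ g ≠ 1 ∧
          Module.finrank ℂ
            (LinearMap.ker ((g : (Fin k → ℂ) →ₗ[ℂ] (Fin k → ℂ)) - LinearMap.id)) = k - 1}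

lemma closure_le {k : ℕ} (Γ : Subgroup (GG k)) : Subgroup.closure (RS Γ) ≤ Γ :=
  (Subgroup.closure_le _).2 fun _ hg => hg.1

lemma RS_conj {k : ℕ} (Γ : Subgroup (GG k)) (g : GG k) (hg : g ∈ Γ) (n : GG k) (hn : n ∈ RS Γ) :
    g * n * g⁻¹ ∈ RS Γ := by
  obtain ⟨h1, h2, h3⟩ := hn
  refine ⟨Γ.mul_mem (Γ.mul_mem hg h1) (Γ.inv_mem hg), ?_, ?_⟩
  · intro h
    apply h2
    exact conj_eq_one_iff.1 h
  · rw [← h3]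
    have : LinearMap.ker (((g * n * g⁻¹ : GG k) : (Fin k → ℂ) →ₗ[ℂ] (Fin k → ℂ)) - LinearMap.id)
      = (LinearMap.ker ((n : (Fin k → ℂ) →ₗ[ℂ] (Fin k → ℂ)) - LinearMap.id)).map
        (g : (Fin k → ℂ) →ₗ[ℂ] (Fin k → ℂ)) := by
      ext x
      rw [Submodule.mem_map]
      simp only [LinearMap.mem_ker, LinearMap.sub_apply, LinearMap.id_apply, sub_eq_zero,
        LinearEquiv.coe_coe]
      constructor
      · intro hx
        have hx : g (n (g⁻¹ x)) = x := hx
        refine ⟨g⁻¹ x, ?_, ?_⟩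
        · apply g.injective
          rw [hx]; exact (g.apply_symm_apply x).symm
        · exact g.apply_symm_apply x
      · rintro ⟨y, hy, rfl⟩
        change g (n (g.symm (g y))) = g y
        rw [g.symm_apply_apply, hy]
    rw [this]
    exact LinearEquiv.finrank_map_eq g _

lemma closure_norm {k : ℕ} (Γ : Subgroup (GG k)) :
    ∀ g ∈ Γ, ∀ n ∈ Subgroup.closure (RS Γ), g * n * g⁻¹ ∈ Subgroup.closure (RS Γ) := by
  intro g hg n hn
  induction hn using Subgroup.closure_induction with
  | mem x hx => exact Subgroup.subset_closure (RS_conj Γ g hg x hx)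
  | one => rw [mul_one, mul_inv_cancel]; exact Subgroup.one_mem _
  | mul x y _ _ hx hy =>
    have : g * (x * y) * g⁻¹ = (g * x * g⁻¹) * (g * y * g⁻¹) := by group
    rw [this]; exact Subgroup.mul_mem _ hx hy
  | inv x _ hx =>
    have : g * x⁻¹ * g⁻¹ = (g * x * g⁻¹)⁻¹ := by group
    rw [this]; exact Subgroup.inv_mem _ hx

lemma rank_small {k : ℕ} (Γ : Subgroup (GG k)) (s : GG k) (hs : s ∈ Γ)
    (hs' : s ∉ Subgroup.closure (RS Γ)) :
    Module.finrank ℂ (LinearMap.ker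
      ((s : (Fin k → ℂ) →ₗ[ℂ] (Fin k → ℂ)) - LinearMap.id)) + 2 ≤ k := by
  have h1 : s ≠ 1 := by rintro rfl; exact hs' (Subgroup.one_mem _)
  have h2 : Module.finrank ℂ (LinearMap.ker
      ((s : (Fin k → ℂ) →ₗ[ℂ] (Fin k → ℂ)) - LinearMap.id)) ≠ k - 1 :=
    fun h => hs' (Subgroup.subset_closure ⟨hs, h1, h⟩)
  have h3 := Submodule.finrank_le (LinearMap.ker
      ((s : (Fin k → ℂ) →ₗ[ℂ] (Fin k → ℂ)) - LinearMap.id))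
  rw [Module.finrank_fintype_fun_eq_card, Fintype.card_fin] at h3
  have h4 : Module.finrank ℂ (LinearMap.ker
      ((s : (Fin k → ℂ) →ₗ[ℂ] (Fin k → ℂ)) - LinearMap.id)) ≠ k := by
    intro h
    apply h1
    have := Submodule.eq_top_of_finrank_eq (K := ℂ) (V := Fin k → ℂ)
      (S := LinearMap.ker ((s : (Fin k → ℂ) →ₗ[ℂ] (Fin k → ℂ)) - LinearMap.id)) (by simp [h])
    rw [LinearMap.ker_eq_top, sub_eq_zero] at this
    ext1 x
    have := LinearMap.congr_fun this x
    exact this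
  omega

lemma inv_noeth {k : ℕ} (Γ : Subgroup (GG k)) [Finite Γ] :
    IsNoetherianRing (invariantSubalgebra k Γ) := by
  haveI := inv_integral Γ
  haveI : Module.Finite (invariantSubalgebra k Γ) (MvPolynomial (Fin k) ℂ) := by
    haveI : Algebra.FiniteType (invariantSubalgebra k Γ) (MvPolynomial (Fin k) ℂ) :=
      Algebra.FiniteType.of_restrictScalars_finiteType ℂ _ _
    exact Algebra.IsIntegral.finite
  haveI : Algebra.FiniteType ℂ (invariantSubalgebra k Γ) :=
    ⟨fg_of_fg_of_fg ℂ (invariantSubalgebra k Γ) (MvPolynomial (Fin k) ℂ)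
      Algebra.FiniteType.out Module.Finite.fg_top Subtype.val_injective⟩
  exact Algebra.FiniteType.isNoetherianRing ℂ _

theorem Hy_main {k m : ℕ} (hkm : k ≤ m) (Γ : Subgroup (GG k)) [Finite Γ]
    (φ : invariantSubalgebra k Γ →ₐ[ℂ] MvPolynomial (Fin m) ℂ)
    (hequi : ∀ y : Fin k → ℂ,
      {x : Fin m → ℂ | ∀ f : invariantSubalgebra k Γ,
        eval x (φ f) = eval y (f : MvPolynomial (Fin k) ℂ)}.Nonempty →
      @topologicalKrullDim
        {x : Fin m → ℂ | ∀ f : invariantSubalgebra k Γ,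
          eval x (φ f) = eval y (f : MvPolynomial (Fin k) ℂ)}
        (TopologicalSpace.induced (fun x => (x : Fin m → ℂ)) (zariskiTop (Fin m)))
        = ((m - k : ℕ) : ℕ∞))
    (π : MvPolynomial (Fin m) ℂ) (hπ : Prime π) :
    ∃ y : Fin k → ℂ, (∀ s ∈ Γ, s y = y → s ∈ Subgroup.closure (RS Γ)) ∧
      ∀ a : invariantSubalgebra k Γ, π ∣ φ a → eval y (a : MvPolynomial (Fin k) ℂ) = 0 := by
  haveI hspan : (Ideal.span {π}).IsPrime := (Ideal.span_singleton_prime hπ.ne_zero).2 hπ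
  haveI := inv_integral Γ
  haveI := inv_noeth Γ
  let φr : invariantSubalgebra k Γ →+* MvPolynomial (Fin m) ℂ := φ
  set q : Ideal (invariantSubalgebra k Γ) := (Ideal.span {π}).comap φr with hq
  haveI : q.IsPrime := Ideal.IsPrime.comap φr
  have hinjA : Function.Injective (algebraMap (invariantSubalgebra k Γ)
    (MvPolynomial (Fin k) ℂ)) := Subtype.val_injective
  have hbot : ∀ P : Ideal (invariantSubalgebra k Γ),
      (⊥ : Ideal (MvPolynomial (Fin k) ℂ)).comap (algebraMap (invariantSubalgebra k Γ) _) ≤ P := by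
    intro P
    rw [← RingHom.ker_eq_comap_bot, (RingHom.injective_iff_ker_eq_bot _).1 hinjA]; exact bot_le
  obtain ⟨q', -, hq', hqq'⟩ := Ideal.exists_ideal_over_prime_of_isIntegral
    (S := MvPolynomial (Fin k) ℂ) q ⊥ (hbot q)
  by_cases hc : ∀ s ∈ Γ, s ∉ Subgroup.closure (RS Γ) → ∃ i, act s (X i) - X i ∉ q'
  · obtain ⟨y, hy1, hy2⟩ := pt_of_prime _ Γ q' hq' hc
    refine ⟨y, hy1, fun a ha => hy2 _ ?_⟩
    have : a ∈ q'.comap (algebraMap (invariantSubalgebra k Γ) (MvPolynomial (Fin k) ℂ)) := by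
      rw [hqq', hq, Ideal.mem_comap, Ideal.mem_span_singleton]
      exact ha
    exact this
  · exfalso
    push Not at hc
    obtain ⟨s, hs, hsN, hsq⟩ := hc
    have hrk := rank_small Γ s hs hsN
    have hd1 := small_dim q' s hsq hrk
    haveI : q'.LiesOver q := ⟨hqq'.symm⟩
    have hd2 : ringKrullDim (invariantSubalgebra k Γ ⧸ q) ≤
        ringKrullDim (MvPolynomial (Fin k) ℂ ⧸ q') := by
      refine dim_le_int (A := invariantSubalgebra k Γ ⧸ q) (S := MvPolynomial (Fin k) ℂ ⧸ q') ?_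
      exact FaithfulSMul.algebraMap_injective _ _
    obtain ⟨x0, hx0, -⟩ := exists_pt (Ideal.span {π}) hspan 1 hspan.one_notMem
    have hx0π : eval x0 π = 0 := hx0 π (Ideal.mem_span_singleton_self π)
    obtain ⟨y0, hy0⟩ : ∃ y0 : Fin k → ℂ, ∀ a : invariantSubalgebra k Γ,
        eval y0 (a : MvPolynomial (Fin k) ℂ) = eval x0 (φ a) := by
      haveI : ((ptI x0).comap φr).IsPrime := Ideal.IsPrime.comap φr
      obtain ⟨P, -, hP, hP'⟩ := Ideal.exists_ideal_over_prime_of_isIntegral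
        (S := MvPolynomial (Fin k) ℂ) ((ptI x0).comap φr) ⊥ (hbot _)
      obtain ⟨y0, hy0, -⟩ := exists_pt P hP 1 hP.one_notMem
      refine ⟨y0, fun a => ?_⟩
      have h1 : a - algebraMap ℂ _ (eval x0 (φ a)) ∈ (ptI x0).comap φr := by
        change eval x0 (φ (a - algebraMap ℂ _ (eval x0 (φ a)))) = 0
        rw [map_sub, AlgHom.commutes, map_sub, MvPolynomial.algebraMap_eq, eval_C, sub_self]
      rw [← hP'] at h1
      have h2 := hy0 _ h1
      have h3 : algebraMap (invariantSubalgebra k Γ) (MvPolynomial (Fin k) ℂ)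
        (a - algebraMap ℂ _ (eval x0 (φ a))) = (a : MvPolynomial (Fin k) ℂ) - C (eval x0 (φ a)) := by
        rw [map_sub]; rfl
      rw [h3, map_sub, eval_C, sub_eq_zero] at h2
      exact h2
    have hfib := hequi y0 ⟨x0, fun f => (hy0 f).symm⟩
    have hD := dim_le_top (((ptI x0).comap φr).map φr) {x : Fin m → ℂ |
        ∀ f : invariantSubalgebra k Γ, eval x (φ f) = eval y0 (f : MvPolynomial (Fin k) ℂ)} (by
      intro x
      constructor
      · intro hx f hf
        have : ((ptI x0).comap φr).map φr ≤ ptI x := by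
          rw [Ideal.map_le_iff_le_comap]
          intro a ha
          change eval x (φ a) = 0
          rw [hx a, hy0 a]; exact ha
        exact this hf
      · intro hx a
        have h1 : a - algebraMap ℂ _ (eval x0 (φ a)) ∈ (ptI x0).comap φr := by
          change eval x0 (φ (a - algebraMap ℂ _ (eval x0 (φ a)))) = 0
          rw [map_sub, AlgHom.commutes, map_sub, MvPolynomial.algebraMap_eq, eval_C, sub_self]
        have h2 := hx _ (Ideal.mem_map_of_mem φr h1)
        change eval x (φ (a - algebraMap ℂ _ (eval x0 (φ a)))) = 0 at h2
        rw [map_sub, AlgHom.commutes, map_sub, MvPolynomial.algebraMap_eq, eval_C,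
          sub_eq_zero] at h2
        rw [h2, hy0])
    rw [hfib] at hD
    have := dim_bound φr π x0 hx0π (k - 2) (m - k) (hd2.trans hd1) hD
    omega

theorem gen_refl {k m : ℕ} (hkm : k ≤ m) (Γ : Subgroup (GG k)) [Finite Γ]
    (φ : invariantSubalgebra k Γ →ₐ[ℂ] MvPolynomial (Fin m) ℂ) (hdom : Function.Injective φ)
    (hequi : ∀ y : Fin k → ℂ,
      {x : Fin m → ℂ | ∀ f : invariantSubalgebra k Γ,
        eval x (φ f) = eval y (f : MvPolynomial (Fin k) ℂ)}.Nonempty →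
      @topologicalKrullDim
        {x : Fin m → ℂ | ∀ f : invariantSubalgebra k Γ,
          eval x (φ f) = eval y (f : MvPolynomial (Fin k) ℂ)}
        (TopologicalSpace.induced (fun x => (x : Fin m → ℂ)) (zariskiTop (Fin m)))
        = ((m - k : ℕ) : ℕ∞))
    (hintcl : ∀ p : MvPolynomial (Fin m) ℂ,
      IsIntegral (φ.range : Subalgebra ℂ (MvPolynomial (Fin m) ℂ)) p → p ∈ φ.range) :
    Γ = Subgroup.closure (RS Γ) := by
  have hle := invN_le (Subgroup.closure (RS Γ)) Γ (closure_le Γ) (closure_norm Γ) φ hdom hintcl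
    (Hy_main hkm Γ φ hequi)
  refine le_antisymm ?_ (closure_le Γ)
  obtain ⟨y, hy, -⟩ := pt_of_prime (Subgroup.closure (RS Γ)) Γ ⊥ Ideal.isPrime_bot (by
    intro s hs hsN
    by_contra hcon
    push Not at hcon
    apply hsN
    have : s = 1 := by
      ext1 x
      ext i
      have h1 := hcon i
      rw [Ideal.mem_bot, sub_eq_zero] at h1
      have h2 := eval_act s x (X i)
      rw [h1, eval_X, eval_X] at h2
      exact h2.symm
    rw [this]; exact Subgroup.one_mem _)
  obtain ⟨u, hu, hsep⟩ := exists_sep (Subgroup.closure (RS Γ)) Γ (closure_le Γ) (closure_norm Γ) y hy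
  intro h hh
  refine hsep 1 (Subgroup.one_mem _) h hh ?_
  exact (hle hu h hh y).symm

end FGQ

open MvPolynomial
namespace FGQ

section
variable {k : ℕ}

lemma act_hom (g : GG k) {f : MvPolynomial (Fin k) ℂ} {n : ℕ} (hf : f.IsHomogeneous n) :
    (act g f).IsHomogeneous n := by
  have := hf.aeval (fun i => ∑ j, C (g (Pi.single j 1) i) * X j) (n := 1) (by
    intro i
    refine IsHomogeneous.sum _ _ _ fun j _ => ?_
    have := (isHomogeneous_C (Fin k) (g (Pi.single j 1) i)).mul (isHomogeneous_X ℂ j)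
    simpa using this)
  rw [one_mul] at this
  exact this

lemma comp_act (g : GG k) (f : MvPolynomial (Fin k) ℂ) (n : ℕ) :
    homogeneousComponent n (act g f) = act g (homogeneousComponent n f) := by
  conv_lhs => rw [← sum_homogeneousComponent f]
  rw [map_sum, map_sum]
  by_cases h : n < f.totalDegree + 1
  · rw [Finset.sum_eq_single n]
    · exact homogeneousComponent_eq_self (act_hom g (homogeneousComponent_isHomogeneous n f))
    · intro b _ hb
      rw [homogeneousComponent_of_mem (act_hom g (homogeneousComponent_isHomogeneous b f)),
        if_neg hb.symm]
    · intro hn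
      exact absurd (Finset.mem_range.2 h) hn
  · rw [homogeneousComponent_eq_zero n f (by omega), map_zero]
    refine Finset.sum_eq_zero fun b hb => ?_
    have := Finset.mem_range.1 hb
    rw [homogeneousComponent_of_mem (act_hom g (homogeneousComponent_isHomogeneous b f)),
        if_neg (by omega)]

lemma comp_inv {Γ : Subgroup (GG k)} {f : MvPolynomial (Fin k) ℂ}
    (hf : f ∈ invariantSubalgebra k Γ) (n : ℕ) :
    homogeneousComponent n f ∈ invariantSubalgebra k Γ := by
  rw [mem_inv] at hf ⊢
  intro g hg
  rw [← comp_act, hf g hg]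

/-- Reynolds operator -/
noncomputable def rey (Γ : Subgroup (GG k)) [Fintype Γ] :
    MvPolynomial (Fin k) ℂ →ₗ[ℂ] MvPolynomial (Fin k) ℂ :=
  ((Fintype.card Γ : ℂ)⁻¹) • ∑ g : Γ, (act (g : GG k)).toLinearMap

lemma rey_apply (Γ : Subgroup (GG k)) [Fintype Γ] (f) :
    rey Γ f = ((Fintype.card Γ : ℂ)⁻¹) • ∑ g : Γ, act (g : GG k) f := by
  simp [rey]

lemma act_sum_mul (Γ : Subgroup (GG k)) [Fintype Γ] (f) (h : Γ) :
    ∑ g : Γ, act (h : GG k) (act (g : GG k) f) = ∑ g : Γ, act (g : GG k) f := by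
  have h1 : ∀ g : Γ, act (h : GG k) (act (g : GG k) f) = act ((g * h : Γ) : GG k) f := by
    intro g
    rw [Subgroup.coe_mul, act_mul]
  rw [Finset.sum_congr rfl fun g _ => h1 g]
  exact Fintype.sum_bijective (fun g : Γ => g * h) (Group.mulRight_bijective h) _ _ fun g => rfl

lemma rey_mem (Γ : Subgroup (GG k)) [Fintype Γ] (f) : rey Γ f ∈ invariantSubalgebra k Γ := by
  rw [mem_inv]
  intro h hh
  rw [rey_apply, map_smul, map_sum, act_sum_mul Γ f ⟨h, hh⟩]

lemma card_ne (Γ : Subgroup (GG k)) [Fintype Γ] : (Fintype.card Γ : ℂ) ≠ 0 := by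
  exact_mod_cast Fintype.card_ne_zero

lemma rey_mul (Γ : Subgroup (GG k)) [Fintype Γ] (a f) (ha : a ∈ invariantSubalgebra k Γ) :
    rey Γ (a * f) = a * rey Γ f := by
  rw [rey_apply, rey_apply, mul_smul_comm, Finset.mul_sum]
  congr 1
  refine Finset.sum_congr rfl fun g _ => ?_
  rw [map_mul, mem_inv.1 ha g g.2]

lemma rey_self (Γ : Subgroup (GG k)) [Fintype Γ] (a) (ha : a ∈ invariantSubalgebra k Γ) :
    rey Γ a = a := by
  rw [rey_apply, Finset.sum_congr rfl (fun g _ => mem_inv.1 ha (g : Γ) g.2), Finset.sum_const,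
    Finset.card_univ, ← Nat.cast_smul_eq_nsmul ℂ, smul_smul, inv_mul_cancel₀ (card_ne Γ), one_smul]

lemma rey_hom (Γ : Subgroup (GG k)) [Fintype Γ] {f : MvPolynomial (Fin k) ℂ} {n : ℕ}
    (hf : f.IsHomogeneous n) : (rey Γ f).IsHomogeneous n := by
  rw [rey_apply, smul_eq_C_mul]
  have h1 : (∑ g : Γ, act (g : GG k) f).IsHomogeneous n :=
    IsHomogeneous.sum _ _ _ fun g _ => act_hom _ hf
  simpa using (isHomogeneous_C (Fin k) ((Fintype.card Γ : ℂ)⁻¹)).mul h1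

/-- positive degree homogeneous invariants -/
def HI (Γ : Subgroup (GG k)) : Set (MvPolynomial (Fin k) ℂ) :=
  {a | a ∈ invariantSubalgebra k Γ ∧ ∃ d, 0 < d ∧ a.IsHomogeneous d}

/-- Hilbert ideal -/
noncomputable def II (Γ : Subgroup (GG k)) : Ideal (MvPolynomial (Fin k) ℂ) := Ideal.span (HI Γ)

lemma mem_II {Γ : Subgroup (GG k)} {a : MvPolynomial (Fin k) ℂ}
    (ha : a ∈ invariantSubalgebra k Γ) (h0 : eval (0 : Fin k → ℂ) a = 0) : a ∈ II Γ := by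
  rw [← sum_homogeneousComponent a]
  refine Ideal.sum_mem _ fun n _ => ?_
  rcases Nat.eq_zero_or_pos n with rfl | hn
  · rw [homogeneousComponent_zero]
    have : coeff 0 a = 0 := by
      rw [← constantCoeff_eq, ← h0, eval_zero]
    rw [this, C_0]; exact zero_mem _
  · exact Ideal.subset_span ⟨comp_inv ha n, n, hn, homogeneousComponent_isHomogeneous n a⟩

lemma act_II {Γ : Subgroup (GG k)} (g : GG k) (hg : g ∈ Γ) {f : MvPolynomial (Fin k) ℂ}
    (hf : f ∈ II Γ) : act g f ∈ II Γ := by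
  have : II Γ ≤ (II Γ).comap (act g) := by
    refine Ideal.span_le.2 fun a ha => ?_
    change act g a ∈ II Γ
    rw [mem_inv.1 ha.1 g hg]
    exact Ideal.subset_span ha
  exact this hf

lemma refl_div {Γ : Subgroup (GG k)} (s : GG k) (hs : s ∈ RS Γ) :
    ∃ l : MvPolynomial (Fin k) ℂ, l ≠ 0 ∧ ∀ h : MvPolynomial (Fin k) ℂ, ∃ h',
      act s h - h = l * h' ∧ (h' = 0 ∨ h'.totalDegree < h.totalDegree) := by
  classical
  obtain ⟨-, hs1, hs2⟩ := hs
  set u := (s : (Fin k → ℂ) →ₗ[ℂ] (Fin k → ℂ)) - LinearMap.id with hu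
  have h3 := LinearMap.finrank_range_add_finrank_ker u
  rw [Module.finrank_fintype_fun_eq_card, Fintype.card_fin] at h3
  have hu0 : u ≠ 0 := by
    intro h
    apply hs1
    ext1 x
    rw [hu, sub_eq_zero] at h
    exact LinearMap.congr_fun h x
  have h1 : Module.finrank ℂ (LinearMap.range u) ≠ 0 := by
    intro h
    rw [Submodule.finrank_eq_zero, LinearMap.range_eq_bot] at h
    exact hu0 h
  have h2 : Module.finrank ℂ (LinearMap.range u) = 1 := by omega
  obtain ⟨v, -, hv⟩ := finrank_eq_one_iff'.1 h2
  have hlam : ∀ j, ∃ c : ℂ, u (Pi.single j 1) = c • (v : Fin k → ℂ) := by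
    intro j
    obtain ⟨c, hc⟩ := hv ⟨u (Pi.single j 1), _, rfl⟩
    exact ⟨c, (congrArg Subtype.val hc).symm⟩
  choose lam hlam using hlam
  let l : MvPolynomial (Fin k) ℂ := ∑ j, C (lam j) * X j
  have hX : ∀ i, act s (X i) - X i = l * C ((v : Fin k → ℂ) i) := by
    intro i
    rw [act_sub_X, Finset.sum_mul]
    refine Finset.sum_congr rfl fun j _ => ?_
    rw [LinearMap.toMatrix'_apply, ← hu, smul_eq_C_mul]
    have h : (fun j' => if j' = j then (1 : ℂ) else 0) = Pi.single j 1 := by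
      ext l; simp [Pi.single_apply]
    simp only [h, hlam, Pi.smul_apply, smul_eq_mul, C_mul]
    ring
  have hl0 : l ≠ 0 := by
    intro h0
    apply hs1
    ext1 x
    ext i
    have h1 := hX i
    rw [h0, zero_mul, sub_eq_zero] at h1
    have h2 := eval_act s x (X i)
    rw [h1, eval_X, eval_X] at h2
    exact h2.symm
  have hl1 : l.IsHomogeneous 1 := by
    refine IsHomogeneous.sum _ _ _ fun j _ => ?_
    have := (isHomogeneous_C (Fin k) (lam j)).mul (isHomogeneous_X ℂ j)
    simpa using this
  refine ⟨l, hl0, fun h => ?_⟩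
  have hdvd : l ∣ act s h - h := by
    induction h using MvPolynomial.induction_on with
    | C a => simp [act]
    | add p q hp hq =>
      have : act s (p + q) - (p + q) = (act s p - p) + (act s q - q) := by rw [map_add]; ring
      rw [this]; exact dvd_add hp hq
    | mul_X p i hp =>
      have : act s (p * X i) - p * X i = (act s p - p) * act s (X i) + p * (act s (X i) - X i) := by
        rw [map_mul]; ring
      rw [this, hX i]
      exact dvd_add (hp.mul_right _) ((dvd_mul_right l _).mul_left _)
  obtain ⟨h', hh'⟩ := hdvd
  refine ⟨h', hh', ?_⟩
  by_cases h0 : h' = 0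
  · exact Or.inl h0
  · right
    have h4 : (l * h').totalDegree = 1 + h'.totalDegree := by
      rw [totalDegree_mul_of_isDomain hl0 h0, hl1.totalDegree hl0]
    have h5 : (act s h - h).totalDegree ≤ h.totalDegree := by
      refine (totalDegree_sub _ _).trans (max_le ?_ le_rfl)
      conv_lhs => rw [← sum_homogeneousComponent h, map_sum]
      refine totalDegree_finsetSum_le fun n hn => ?_
      have := (act_hom s (homogeneousComponent_isHomogeneous n h)).totalDegree_le
      have h6 := Finset.mem_range.1 hn
      omega
    rw [hh', h4] at h5
    omega

lemma local_lemma (Γ : Subgroup (GG k)) [Finite Γ] (hΓ : Γ = Subgroup.closure (RS Γ))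
    {ι : Type*} [Fintype ι] [DecidableEq ι] (g : ι → MvPolynomial (Fin k) ℂ)
    (hg : ∀ i, g i ∈ invariantSubalgebra k Γ) (i0 : ι)
    (hmin : ∀ c : ι → MvPolynomial (Fin k) ℂ, (∀ i, c i ∈ invariantSubalgebra k Γ) →
      ∑ i, g i * c i = 0 → eval (0 : Fin k → ℂ) (c i0) = 0)
    (h : ι → MvPolynomial (Fin k) ℂ) (hh : ∑ i, g i * h i = 0) : h i0 ∈ II Γ := by
  haveI := Fintype.ofFinite Γ
  induction hn : (h i0).totalDegree using Nat.strong_induction_on generalizing h with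
  | _ n ih =>
  have key : ∀ s ∈ RS Γ, act s (h i0) - h i0 ∈ II Γ := by
    intro s hs
    obtain ⟨l, hl0, hl⟩ := refl_div s hs
    choose h' h1 h2 using fun i => hl (h i)
    rw [h1]
    refine Ideal.mul_mem_left _ _ ?_
    rcases h2 i0 with h0 | hlt
    · rw [h0]; exact zero_mem _
    · refine ih _ (hn ▸ hlt) h' ?_ rfl
      have : l * ∑ i, g i * h' i = 0 := by
        rw [Finset.mul_sum]
        calc ∑ i, l * (g i * h' i) = ∑ i, (act s (g i * h i) - g i * h i) := by
              refine Finset.sum_congr rfl fun i _ => ?_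
              rw [map_mul, mem_inv.1 (hg i) s hs.1]
              linear_combination (-1 : MvPolynomial (Fin k) ℂ) * g i * h1 i
          _ = 0 := by rw [Finset.sum_sub_distrib, ← map_sum, hh, map_zero, sub_zero]
      exact (mul_eq_zero.1 this).resolve_left hl0
  have key2 : ∀ s ∈ Subgroup.closure (RS Γ), act s (h i0) - h i0 ∈ II Γ := by
    intro s hs
    induction hs using Subgroup.closure_induction with
    | mem x hx => exact key x hx
    | one => rw [act_one, sub_self]; exact zero_mem _
    | mul x y hx hy h1 h2 =>
      rw [act_mul]
      have := add_mem (act_II y (hΓ ▸ hy) h1) h2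
      rw [map_sub] at this
      convert this using 1; ring
    | inv x hx h1 =>
      have := neg_mem (act_II x⁻¹ (Γ.inv_mem (hΓ ▸ hx)) h1)
      rw [map_sub, ← act_mul, mul_inv_cancel, act_one] at this
      convert this using 1; ring
  have key3 : rey Γ (h i0) - h i0 ∈ II Γ := by
    have : rey Γ (h i0) - h i0 =
        C ((Fintype.card Γ : ℂ)⁻¹) * ∑ s : Γ, (act (s : GG k) (h i0) - h i0) := by
      rw [Finset.sum_sub_distrib, mul_sub, rey_apply, smul_eq_C_mul, Finset.sum_const,
        Finset.card_univ, ← smul_eq_C_mul (Fintype.card Γ • h i0),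
        ← Nat.cast_smul_eq_nsmul ℂ, smul_smul, inv_mul_cancel₀ (card_ne Γ), one_smul]
    rw [this]
    exact Ideal.mul_mem_left _ _ (Ideal.sum_mem _ fun s _ => key2 s (hΓ ▸ s.2))
  have key4 : rey Γ (h i0) ∈ II Γ := by
    refine mem_II (rey_mem Γ _) (hmin (fun i => rey Γ (h i)) (fun i => rey_mem Γ _) ?_)
    have := congrArg (rey Γ) hh
    rw [map_sum, map_zero] at this
    rw [← this]
    exact Finset.sum_congr rfl fun i _ => (rey_mul Γ _ _ (hg i)).symm
  have := sub_mem key4 key3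
  rwa [sub_sub_cancel] at this

end
end FGQ

open MvPolynomial
namespace FGQ

section
variable {k : ℕ}

lemma pderiv_all_zero {ι : Type*} [DecidableEq ι] (p : MvPolynomial ι ℂ) (h : ∀ i, pderiv i p = 0) :
    p = C (coeff 0 p) := by
  ext m
  rw [coeff_C]
  split_ifs with hm
  · rw [hm]
  · obtain ⟨i, hi⟩ : ∃ i, m i ≠ 0 := by
      by_contra hcon
      push Not at hcon
      exact hm (Finsupp.ext fun i => (hcon i).symm)
    have h1 := coeff_pderiv (i := i) p (m - Finsupp.single i 1)
    have h2 : m - Finsupp.single i 1 + Finsupp.single i 1 = m := by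
      ext j
      by_cases hj : j = i
      · subst hj; simp; omega
      · simp [Finsupp.single_apply, Ne.symm hj]
    rw [h, h2, coeff_zero] at h1
    rcases mul_eq_zero.1 h1.symm with h3 | h3
    · exact h3
    · exfalso
      exact Nat.cast_add_one_ne_zero (R := ℂ) _ h3

lemma totalDegree_pderiv_lt' {ι : Type*} [DecidableEq ι] (p : MvPolynomial ι ℂ) (i : ι)
    (h : p.totalDegree ≠ 0) : (pderiv i p).totalDegree < p.totalDegree := by
  rw [totalDegree, Finset.sup_lt_iff (Nat.pos_of_ne_zero h)]
  intro m hm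
  rw [mem_support_iff, coeff_pderiv] at hm
  have h1 := le_totalDegree (mem_support_iff.2 (left_ne_zero_of_mul hm))
  rw [Finsupp.sum_add_index' (fun _ => rfl) (fun _ _ _ => rfl), Finsupp.sum_single_index rfl] at h1
  omega

lemma pderiv_chain {ι : Type*} [Fintype ι] [DecidableEq ι] (x : ι → MvPolynomial (Fin k) ℂ)
    (p : MvPolynomial ι ℂ) (l : Fin k) :
    pderiv l (aeval x p) = ∑ i, aeval x (pderiv i p) * pderiv l (x i) := by
  induction p using MvPolynomial.induction_on with
  | C a => simp
  | add p q hp hq => simp only [map_add, hp, hq, add_mul, Finset.sum_add_distrib]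
  | mul_X p j hp =>
    rw [map_mul, aeval_X, Derivation.leibniz, hp]
    simp only [Derivation.leibniz, map_add, smul_eq_mul, map_mul, aeval_X, add_mul,
      Finset.sum_add_distrib, pderiv_X]
    congr 1
    · rw [Finset.sum_eq_single j]
      · simp
      · intro b _ hb; simp [Pi.single_apply, hb]
      · simp
    · rw [Finset.mul_sum]
      exact Finset.sum_congr rfl fun i _ => by ring

theorem algindep (Γ : Subgroup (GG k)) [Finite Γ] (hΓ : Γ = Subgroup.closure (RS Γ))
    {ι : Type*} [Fintype ι] (x : ι → MvPolynomial (Fin k) ℂ) (hx : ∀ i, x i ∈ HI Γ)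
    (hind : ∀ c : ι → ℂ, ∑ i, C (c i) * x i ∈ ptI (0 : Fin k → ℂ) * II Γ → ∀ i, c i = 0) :
    AlgebraicIndependent ℂ x := by
  classical
  rw [algebraicIndependent_iff]
  intro p
  induction hn : p.totalDegree using Nat.strong_induction_on generalizing p with
  | _ n ih =>
  intro hp
  by_contra hp0
  let g : ι → MvPolynomial (Fin k) ℂ := fun i => aeval x (pderiv i p)
  have hgA : ∀ i, g i ∈ invariantSubalgebra k Γ := by
    intro i
    have : (aeval x : MvPolynomial ι ℂ →ₐ[ℂ] _).range ≤ invariantSubalgebra k Γ := by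
      rw [← Algebra.adjoin_range_eq_range_aeval]
      refine Algebra.adjoin_le ?_
      rintro _ ⟨j, rfl⟩
      exact (hx j).1
    exact this ⟨_, rfl⟩
  have hg0 : ∃ i, g i ≠ 0 := by
    by_contra hcon
    push Not at hcon
    have hall : ∀ i, pderiv i p = 0 := by
      intro i
      by_cases hd : p.totalDegree = 0
      · rw [totalDegree_eq_zero_iff_eq_C.1 hd]; simp
      · exact ih _ (hn ▸ totalDegree_pderiv_lt' p i hd) _ rfl (hcon i)
    have h1 := pderiv_all_zero p hall
    rw [h1, aeval_C, MvPolynomial.algebraMap_eq] at hp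
    rw [C_eq_zero.1 hp, C_0] at h1
    exact hp0 h1
  let P : Finset ι → Prop := fun T => ∃ t ∈ invariantSubalgebra k Γ, eval (0 : Fin k → ℂ) t ≠ 0 ∧
    ∀ j, ∃ c : ι → MvPolynomial (Fin k) ℂ, (∀ i, c i ∈ invariantSubalgebra k Γ) ∧
      (∀ i, i ∉ T → c i = 0) ∧ t * g j = ∑ i, g i * c i
  obtain ⟨T, hT, hTmin⟩ := WellFounded.has_min (wellFounded_lt (α := Finset ι)) {T | P T}
    ⟨Finset.univ, 1, one_mem _, by simp, fun j => ⟨Pi.single j 1, by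
      intro i
      by_cases h : i = j
      · subst h; simp [one_mem]
      · simp [Pi.single_apply, h, zero_mem], by simp, by simp [Pi.single_apply]⟩⟩
  obtain ⟨t, htA, ht0, ht⟩ := hT
  choose c hcA hcT hc using ht
  have hTne : T.Nonempty := by
    rw [Finset.nonempty_iff_ne_empty]
    rintro rfl
    obtain ⟨i, hi⟩ := hg0
    have h1 := hc i
    rw [Finset.sum_eq_zero (fun j _ => by rw [hcT i j (Finset.notMem_empty j), mul_zero])] at h1
    rcases mul_eq_zero.1 h1 with h2 | h2
    · exact ht0 (by rw [h2, map_zero])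
    · exact hi h2
  obtain ⟨i0, hi0⟩ := hTne
  let g' : ι → MvPolynomial (Fin k) ℂ := fun i => if i ∈ T then g i else 0
  have hg'A : ∀ i, g' i ∈ invariantSubalgebra k Γ := by
    intro i
    by_cases h : i ∈ T
    · simp only [g', if_pos h]; exact hgA i
    · simp only [g', if_neg h]; exact zero_mem _
  have hmin : ∀ e : ι → MvPolynomial (Fin k) ℂ, (∀ i, e i ∈ invariantSubalgebra k Γ) →
      ∑ i, g' i * e i = 0 → eval (0 : Fin k → ℂ) (e i0) = 0 := by
    intro e heA he
    by_contra he0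
    refine hTmin (T.erase i0) ?_ (Finset.erase_ssubset hi0)
    refine ⟨t * e i0, mul_mem htA (heA i0), by rw [map_mul]; exact mul_ne_zero ht0 he0, fun j => ?_⟩
    refine ⟨fun i => if i ∈ T.erase i0 then c j i * e i0 - c j i0 * e i else 0, ?_, ?_, ?_⟩
    · intro i
      simp only
      split_ifs
      · exact sub_mem (mul_mem (hcA j i) (heA i0)) (mul_mem (hcA j i0) (heA i))
      · exact zero_mem _
    · intro i hi
      simp only [if_neg hi]
    · have h1 : ∀ i, g i * (if i ∈ T.erase i0 then c j i * e i0 - c j i0 * e i else 0) =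
          g i * c j i * e i0 - c j i0 * (g' i * e i) := by
        intro i
        by_cases hi : i ∈ T
        · by_cases hii : i = i0
          · subst hii
            simp only [Finset.mem_erase, ne_eq, not_true_eq_false, false_and, if_false, g', if_pos hi]
            ring
          · rw [if_pos (Finset.mem_erase.2 ⟨hii, hi⟩)]
            simp only [g', if_pos hi]
            ring
        · rw [if_neg (fun h => hi (Finset.mem_of_mem_erase h)), hcT j i hi]
          simp only [g', if_neg hi]
          ring
      rw [Finset.sum_congr rfl fun i _ => h1 i, Finset.sum_sub_distrib, ← Finset.sum_mul,
        ← Finset.mul_sum, he, ← hc j]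
      ring
  have hgc : ∀ j i, g i * c j i = g' i * c j i := by
    intro j i
    by_cases hi : i ∈ T
    · simp only [g', if_pos hi]
    · rw [hcT j i hi, mul_zero, mul_zero]
  have hH : ∀ l : Fin k, ∑ j, c j i0 * pderiv l (x j) ∈ II Γ := by
    intro l
    refine local_lemma Γ hΓ g' hg'A i0 hmin (fun i => ∑ j, c j i * pderiv l (x j)) ?_
    have h1 := pderiv_chain x p l
    rw [hp, map_zero] at h1
    simp only [Finset.mul_sum]
    rw [Finset.sum_comm]
    calc ∑ j, ∑ i, g' i * (c j i * pderiv l (x j)) = ∑ j, t * (g j * pderiv l (x j)) := by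
          refine Finset.sum_congr rfl fun j _ => ?_
          rw [← mul_assoc, hc j, Finset.sum_mul]
          refine Finset.sum_congr rfl fun i _ => ?_
          rw [hgc]; ring
      _ = 0 := by rw [← Finset.mul_sum, ← h1, mul_zero]
  choose hxA d hdpos hd using hx
  have hmem : ∑ j, c j i0 * (C (d j : ℂ) * x j) ∈ ptI (0 : Fin k → ℂ) * II Γ := by
    have h1 : ∑ l, X l * ∑ j, c j i0 * pderiv l (x j) ∈ ptI (0 : Fin k → ℂ) * II Γ := by
      refine Ideal.sum_mem _ fun l _ => Ideal.mul_mem_mul ?_ (hH l)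
      change eval 0 (X l) = 0
      simp
    convert h1 using 1
    simp only [Finset.mul_sum]
    rw [Finset.sum_comm]
    refine Finset.sum_congr rfl fun j _ => ?_
    have h2 := (hd j).sum_X_mul_pderiv
    have h3 : C (d j : ℂ) * x j = ∑ l, X l * pderiv l (x j) := by
      rw [h2, nsmul_eq_mul]; simp
    rw [h3, Finset.mul_sum]
    exact Finset.sum_congr rfl fun l _ => by ring
  have hmem2 : ∑ j, C (eval 0 (c j i0) * (d j : ℂ)) * x j ∈ ptI (0 : Fin k → ℂ) * II Γ := by
    have h1 : ∑ j, (c j i0 - C (eval 0 (c j i0))) * (C (d j : ℂ) * x j) ∈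
        ptI (0 : Fin k → ℂ) * II Γ := by
      refine Ideal.sum_mem _ fun j _ => Ideal.mul_mem_mul ?_ (Ideal.mul_mem_left _ _
        (Ideal.subset_span ⟨hxA j, d j, hdpos j, hd j⟩))
      change eval 0 _ = 0
      simp
    have h2 := sub_mem hmem h1
    rw [← Finset.sum_sub_distrib] at h2
    convert h2 using 1
    refine Finset.sum_congr rfl fun j _ => ?_
    rw [C_mul]; ring
  have h3 := hind _ hmem2 i0
  have h4 : eval 0 (c i0 i0) = 0 := by
    rcases mul_eq_zero.1 h3 with h | h
    · exact h
    · exact absurd h (by exact_mod_cast (hdpos i0).ne')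
  have h5 := hmin (fun i => c i0 i - Pi.single (M := fun _ => MvPolynomial (Fin k) ℂ) i0 t i) (by
    intro i
    refine sub_mem (hcA i0 i) ?_
    by_cases h : i = i0
    · subst h; simpa using htA
    · simp [Pi.single_apply, h, zero_mem]) (by
    simp only [mul_sub, Finset.sum_sub_distrib, ← hgc]
    rw [← hc i0]
    simp [Pi.single_apply, g', hi0, mul_comm])
  simp only [Pi.single_eq_same, map_sub, h4, zero_sub, neg_eq_zero] at h5
  exact ht0 h5

end
end FGQ

open MvPolynomial
namespace FGQ

section
variable {k : ℕ}

lemma exists_J (Γ : Subgroup (GG k)) :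
    ∃ J : Finset (MvPolynomial (Fin k) ℂ), (∀ f ∈ J, f ∈ HI Γ) ∧
      (∀ a ∈ II Γ, ∃ c : MvPolynomial (Fin k) ℂ → ℂ,
        a - ∑ f ∈ J, C (c f) * f ∈ ptI (0 : Fin k → ℂ) * II Γ) ∧
      (∀ c : {f // f ∈ J} → ℂ, ∑ f, C (c f) * f.1 ∈ ptI (0 : Fin k → ℂ) * II Γ → ∀ f, c f = 0) := by
  classical
  set mI := ptI (0 : Fin k → ℂ) * II Γ with hmI
  obtain ⟨B, hB, hBspan⟩ := (Submodule.fg_span_iff_fg_span_finset_subset (HI Γ)).1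
    (IsNoetherian.noetherian (Submodule.span (MvPolynomial (Fin k) ℂ) (HI Γ)))
  let v : MvPolynomial (Fin k) ℂ →ₗ[ℂ] (MvPolynomial (Fin k) ℂ ⧸ mI) :=
    (Ideal.Quotient.mkₐ ℂ mI).toLinearMap
  have hv : ∀ f, v f = 0 ↔ f ∈ mI := fun f => Ideal.Quotient.eq_zero_iff_mem
  obtain ⟨b, hbB, -, hspan, hind⟩ := exists_linearIndepOn_extension
    (K := ℂ) (v := v) (linearIndepOn_empty ℂ v) (Set.empty_subset (B : Set _))
  have hfin : b.Finite := B.finite_toSet.subset hbB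
  obtain ⟨J, rfl⟩ : ∃ J : Finset (MvPolynomial (Fin k) ℂ), b = ↑J :=
    ⟨hfin.toFinset, by simp⟩
  refine ⟨J, fun f hf => hB (hbB hf), ?_, ?_⟩
  · intro a ha
    have h1 : v a ∈ Submodule.span ℂ (v '' (B : Set _)) := by
      have ha' : a ∈ Submodule.span (MvPolynomial (Fin k) ℂ) (B : Set (MvPolynomial (Fin k) ℂ)) := by
        rw [← hBspan]; exact ha
      induction ha' using Submodule.span_induction with
      | mem x hx => exact Submodule.subset_span ⟨x, hx, rfl⟩
      | zero => rw [map_zero]; exact zero_mem _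
      | add x y hx hy h1 h2 =>
        rw [map_add]
        exact add_mem (h1 (by rw [← hBspan] at hx; exact hx)) (h2 (by rw [← hBspan] at hy; exact hy))
      | smul r x hx h1 =>
        have hxI : x ∈ II Γ := by rw [← hBspan] at hx; exact hx
        have h2 : v (r • x) = eval 0 r • v x := by
          rw [← map_smul, ← sub_eq_zero, ← map_sub, hv, smul_eq_mul, smul_eq_C_mul, ← sub_mul]
          refine Ideal.mul_mem_mul ?_ hxI
          change eval 0 _ = 0
          simp
        rw [h2]
        exact Submodule.smul_mem _ _ (h1 hxI)
    have h2 : v a ∈ Submodule.span ℂ (v '' (J : Set _)) := (Submodule.span_le.2 hspan) h1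
    obtain ⟨c, hc⟩ := (Submodule.mem_span_image_finset_iff_exists_fun' ℂ).1 h2
    refine ⟨c, ?_⟩
    rw [← hv, map_sub, ← hc, map_sum, sub_eq_zero]
    refine Finset.sum_congr rfl fun f _ => ?_
    rw [← smul_eq_C_mul, map_smul]
  · intro c hc
    have h1 : LinearIndependent ℂ (fun f : {f // f ∈ J} => v f.1) := hind
    rw [Fintype.linearIndependent_iff] at h1
    refine h1 c ?_
    rw [← hv, map_sum] at hc
    rw [← hc]
    refine Finset.sum_congr rfl fun f _ => ?_
    rw [← smul_eq_C_mul, map_smul]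

lemma gen_hom (Γ : Subgroup (GG k)) [Finite Γ] (J : Finset (MvPolynomial (Fin k) ℂ))
    (hJ : ∀ f ∈ J, f ∈ HI Γ)
    (hspan : ∀ a ∈ II Γ, ∃ c : MvPolynomial (Fin k) ℂ → ℂ,
        a - ∑ f ∈ J, C (c f) * f ∈ ptI (0 : Fin k → ℂ) * II Γ) (n : ℕ) :
    ∀ a ∈ invariantSubalgebra k Γ, a.IsHomogeneous n →
      a ∈ Algebra.adjoin ℂ (J : Set (MvPolynomial (Fin k) ℂ)) := by
  haveI := Fintype.ofFinite Γ
  induction n using Nat.strong_induction_on with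
  | _ n ih =>
  intro a ha han
  set W := Algebra.adjoin ℂ (J : Set (MvPolynomial (Fin k) ℂ)) with hW
  rcases Nat.eq_zero_or_pos n with rfl | hn
  · have h1 := homogeneousComponent_eq_self han
    rw [homogeneousComponent_zero] at h1
    rw [← h1, ← MvPolynomial.algebraMap_eq]
    exact Subalgebra.algebraMap_mem _ _
  have haI : a ∈ II Γ := Ideal.subset_span ⟨ha, n, hn, han⟩
  obtain ⟨c, hc⟩ := hspan a haI
  have key0 : ∀ i ∈ II Γ, ∀ z ∈ ptI (0 : Fin k → ℂ),
      homogeneousComponent n (rey Γ (z * i)) ∈ W := by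
    intro i hi
    change i ∈ Submodule.span _ _ at hi
    induction hi using Submodule.span_induction with
    | mem b hb =>
      intro z hz
      obtain ⟨hbA, d, hd, hbd⟩ := hb
      rw [mul_comm, rey_mul Γ b z hbA, ← sum_homogeneousComponent (rey Γ z), Finset.mul_sum, map_sum]
      refine Subalgebra.sum_mem _ fun j _ => ?_
      rw [homogeneousComponent_of_mem (hbd.mul (homogeneousComponent_isHomogeneous j (rey Γ z)))]
      split_ifs with hnd
      · rcases Nat.eq_zero_or_pos j with rfl | hj
        · have : coeff 0 (rey Γ z) = 0 := by
            rw [← constantCoeff_eq, ← eval_zero, rey_apply, smul_eval, map_sum]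
            rw [Finset.sum_eq_zero, mul_zero]
            intro g _
            rw [eval_act, map_zero]
            exact hz
          rw [homogeneousComponent_zero, this, C_0, mul_zero]
          exact zero_mem _
        · exact mul_mem (ih d (by omega) b hbA hbd)
            (ih j (by omega) _ (comp_inv (rey_mem Γ z) j) (homogeneousComponent_isHomogeneous _ _))
      · exact zero_mem _
    | zero => intro z _; rw [mul_zero, map_zero, map_zero]; exact zero_mem _
    | add x y _ _ h1 h2 =>
      intro z hz
      rw [mul_add, map_add, map_add]; exact add_mem (h1 z hz) (h2 z hz)
    | smul r x _ h1 =>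
      intro z hz
      rw [smul_eq_mul, ← mul_assoc]
      exact h1 _ (Ideal.mul_mem_right _ _ hz)
  have key : ∀ z ∈ ptI (0 : Fin k → ℂ) * II Γ, homogeneousComponent n (rey Γ z) ∈ W := by
    intro z hz
    refine Submodule.mul_induction_on hz (fun m hm i hi => key0 i hi m hm) ?_
    intro x y h1 h2
    rw [map_add, map_add]; exact add_mem h1 h2
  have h1 := key _ hc
  rw [map_sub, map_sub, rey_self Γ a ha, homogeneousComponent_eq_self han] at h1
  have hsA : ∑ f ∈ J, C (c f) * f ∈ invariantSubalgebra k Γ :=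
    Subalgebra.sum_mem _ fun f hf => by
      rw [← smul_eq_C_mul]; exact Subalgebra.smul_mem _ (hJ f hf).1 _
  rw [rey_self Γ _ hsA] at h1
  have h2 : homogeneousComponent n (∑ f ∈ J, C (c f) * f) ∈ W := by
    rw [map_sum]
    refine Subalgebra.sum_mem _ fun f hf => ?_
    obtain ⟨-, d, -, hd⟩ := hJ f hf
    rw [homogeneousComponent_C_mul, homogeneousComponent_of_mem hd, ← smul_eq_C_mul]
    refine Subalgebra.smul_mem _ ?_ _
    split_ifs
    · exact Algebra.subset_adjoin hf
    · exact zero_mem _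
  have := add_mem h1 h2
  rwa [sub_add_cancel] at this

theorem chevalley (Γ : Subgroup (GG k)) [Finite Γ] (hΓ : Γ = Subgroup.closure (RS Γ)) :
    Nonempty (invariantSubalgebra k Γ ≃ₐ[ℂ] MvPolynomial (Fin k) ℂ) := by
  obtain ⟨J, hJ, hspan, hind⟩ := exists_J Γ
  have halg := algindep Γ hΓ (fun f : {f // f ∈ J} => f.1) (fun f => hJ f.1 f.2) hind
  have hadj : Algebra.adjoin ℂ (Set.range fun f : {f // f ∈ J} => f.1) =
      invariantSubalgebra k Γ := by
    have hr : (Set.range fun f : {f // f ∈ J} => f.1) = (J : Set (MvPolynomial (Fin k) ℂ)) := by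
      ext f; simp
    rw [hr]
    refine le_antisymm (Algebra.adjoin_le fun f hf => (hJ f hf).1) ?_
    intro a ha
    rw [← sum_homogeneousComponent a]
    exact Subalgebra.sum_mem _ fun n _ => gen_hom Γ J hJ hspan n _ (comp_inv ha n)
      (homogeneousComponent_isHomogeneous n a)
  let e1 : MvPolynomial {f // f ∈ J} ℂ ≃ₐ[ℂ] invariantSubalgebra k Γ :=
    halg.aevalEquiv.trans (Subalgebra.equivOfEq _ _ hadj)
  have hcard : Fintype.card {f // f ∈ J} = k := by
    haveI := inv_integral Γ
    have h1 := ringKrullDim_eq_of_ringEquiv e1.toRingEquiv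
    have h2 : ringKrullDim (invariantSubalgebra k Γ) =
        ringKrullDim (MvPolynomial (Fin k) ℂ) :=
      le_antisymm (dim_le_int Subtype.val_injective)
        (dim_ge_int (A := invariantSubalgebra k Γ) (S := MvPolynomial (Fin k) ℂ))
    rw [h2, dim_mv, MvPolynomial.ringKrullDim_of_isNoetherianRing,
      ringKrullDim_eq_zero_of_field, zero_add, Nat.card_eq_fintype_card] at h1
    exact_mod_cast h1
  exact ⟨e1.symm.trans (renameEquiv ℂ (Fintype.equivFinOfCardEq hcard))⟩

end
end FGQ

/-- Panyushev-type lemma: if `ψ : X → Y/Γ` is a dominant, equidimensional morphism from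
an affine space `X = ℂᵐ` to the quotient of `Y = ℂᵏ` by a finite linear group `Γ`, and
`ℂ[Y]^Γ` is integrally closed in `ℂ[X]`, then `Γ` is generated by pseudo-reflections
and `Y/Γ` is smooth, i.e. `ℂ[Y]^Γ` is a polynomial ring. -/
theorem finite_group_quotient_reflection_group
    (k m : ℕ) (hkm : k ≤ m)
    (Γ : Subgroup ((Fin k → ℂ) ≃ₗ[ℂ] (Fin k → ℂ))) [Finite Γ]
    -- the comorphism of ψ : X → Y/Γ
    (φ : invariantSubalgebra k Γ →ₐ[ℂ] MvPolynomial (Fin m) ℂ)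
    -- ψ is dominant
    (hdom : Function.Injective φ)
    -- ψ is equidimensional: each nonempty fiber has dimension m − k
    (hequi : ∀ y : Fin k → ℂ,
      {x : Fin m → ℂ | ∀ f : invariantSubalgebra k Γ,
        eval x (φ f) = eval y (f : MvPolynomial (Fin k) ℂ)}.Nonempty →
      @topologicalKrullDim
        {x : Fin m → ℂ | ∀ f : invariantSubalgebra k Γ,
          eval x (φ f) = eval y (f : MvPolynomial (Fin k) ℂ)}
        (TopologicalSpace.induced (fun x => (x : Fin m → ℂ)) (zariskiTop (Fin m)))
        = ((m - k : ℕ) : ℕ∞))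
    -- ℂ[Y]^Γ is integrally closed in ℂ[X]
    (hintcl : ∀ p : MvPolynomial (Fin m) ℂ,
      IsIntegral (φ.range : Subalgebra ℂ (MvPolynomial (Fin m) ℂ)) p → p ∈ φ.range) :
    -- Γ is generated by pseudo-reflections …
    Γ = Subgroup.closure
        {g : (Fin k → ℂ) ≃ₗ[ℂ] (Fin k → ℂ) | g ∈ Γ ∧ g ≠ 1 ∧
          Module.finrank ℂ
            (LinearMap.ker ((g : (Fin k → ℂ) →ₗ[ℂ] (Fin k → ℂ)) - LinearMap.id)) = k - 1} ∧
    -- … and ℂ[Y]^Γ is a polynomial ring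
    Nonempty (invariantSubalgebra k Γ ≃ₐ[ℂ] MvPolynomial (Fin k) ℂ) := by
  have h := FGQ.gen_refl hkm Γ φ hdom hequi hintcl
  exact ⟨h, FGQ.chevalley Γ h⟩
end

section
/- Let V be a finite-dimensional representation of a reductive group G such that V is self-dual as a G-module. Then for every G-stable divisor D ⊂ V there is a nonzero G-invariant polynomial f ∈ ℂ[V]^G vanishing on D. -/
open MvPolynomial

/-- Substitution of a linear map into polynomials: `(polySub A f)(x) = f(Ax)`. -/
noncomputable def polySub (d : ℕ) (A : (Fin d → ℂ) →ₗ[ℂ] (Fin d → ℂ)) :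
    MvPolynomial (Fin d) ℂ →ₐ[ℂ] MvPolynomial (Fin d) ℂ :=
  MvPolynomial.aeval (fun i => ∑ j, MvPolynomial.C (A (Pi.single j 1) i) * MvPolynomial.X j)

namespace SDInv

lemma open_basic {σ : Type*} (U : Set (σ → ℂ)) (hU : @IsOpen _ (zariskiTop σ) U) (y : σ → ℂ)
    (hy : y ∈ U) : ∃ f : MvPolynomial σ ℂ, eval y f ≠ 0 ∧ ∀ x, eval x f ≠ 0 → x ∈ U := by
  induction hU with
  | basic s hs =>
    obtain ⟨f, rfl⟩ := hs
    exact ⟨f, hy, fun x hx => hx⟩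
  | univ => exact ⟨1, by simp, fun _ _ => trivial⟩
  | inter s t _ _ ihs iht =>
    obtain ⟨f, hf, hf'⟩ := ihs hy.1
    obtain ⟨g, hg, hg'⟩ := iht hy.2
    refine ⟨f * g, by simp [hf, hg], fun x hx => ?_⟩
    rw [map_mul] at hx
    exact ⟨hf' x (left_ne_zero_of_mul hx), hg' x (right_ne_zero_of_mul hx)⟩
  | sUnion S _ ih =>
    obtain ⟨s, hs, hys⟩ := hy
    obtain ⟨f, hf, hf'⟩ := ih s hs hys
    exact ⟨f, hf, fun x hx => ⟨s, hs, hf' x hx⟩⟩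

lemma isOpen_ne {σ : Type*} (f : MvPolynomial σ ℂ) :
    @IsOpen _ (zariskiTop σ) {p | eval p f ≠ 0} :=
  TopologicalSpace.GenerateOpen.basic _ ⟨f, rfl⟩

/-- vanishing ideal -/
def vI {σ : Type*} (C : Set (σ → ℂ)) : Ideal (MvPolynomial σ ℂ) where
  carrier := {p | ∀ x ∈ C, eval x p = 0}
  zero_mem' _ _ := map_zero _
  add_mem' {p q} hp hq x hx := by simp [hq x hx, hp x hx]
  smul_mem' p q hq x hx := by simp [hq x hx]

lemma mem_vI {σ : Type*} {C : Set (σ → ℂ)} {p : MvPolynomial σ ℂ} :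
    p ∈ vI C ↔ ∀ x ∈ C, eval x p = 0 := Iff.rfl

lemma vI_prime {σ : Type*} {C : Set (σ → ℂ)} (hC : @IsIrreducible _ (zariskiTop σ) C) :
    (vI C).IsPrime := by
  refine ⟨?_, ?_⟩
  · intro h
    obtain ⟨x, hx⟩ := hC.1
    have h1 : (1 : MvPolynomial σ ℂ) ∈ vI C := by rw [h]; trivial
    simpa using h1 x hx
  · intro f g hfg
    by_contra hcon
    push Not at hcon
    obtain ⟨hf, hg⟩ := hcon
    simp only [mem_vI, not_forall] at hf hg
    obtain ⟨x, hx, hfx⟩ := hf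
    obtain ⟨y, hy, hgy⟩ := hg
    obtain ⟨z, hz, hz1, hz2⟩ := hC.2 _ _ (isOpen_ne f) (isOpen_ne g) ⟨x, hx, hfx⟩ ⟨y, hy, hgy⟩
    have := hfg z hz
    rw [map_mul] at this
    exact (mul_ne_zero hz1 hz2) this

lemma exists_max {X : Type*} [TopologicalSpace X] (D : Set X) (x : X) (hx : x ∈ D) :
    ∃ C, x ∈ C ∧ C ⊆ D ∧ IsIrreducible C ∧
      ∀ C', C ⊆ C' → C' ⊆ D → IsIrreducible C' → C' = C := by
  obtain ⟨m, hsm, hm⟩ := zorn_subset_nonempty { t : Set X | t ⊆ D ∧ IsPreirreducible t }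
      (fun c hc hcc _ => by
        refine ⟨⋃₀ c, ⟨Set.sUnion_subset fun t ht => (hc ht).1, ?_⟩,
          fun _ hxc => Set.subset_sUnion_of_mem hxc⟩
        rintro u v hu hv ⟨y, ⟨p, hpc, hyp⟩, hyu⟩ ⟨x, ⟨q, hqc, hxq⟩, hxv⟩
        rcases hcc.total hpc hqc with hpq | hqp
        · obtain ⟨x, hxp, hxuv⟩ := (hc hqc).2 u v hu hv ⟨y, hpq hyp, hyu⟩ ⟨x, hxq, hxv⟩
          exact ⟨x, ⟨q, hqc, hxp⟩, hxuv⟩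
        · obtain ⟨x, hxp, hxuv⟩ := (hc hpc).2 u v hu hv ⟨y, hyp, hyu⟩ ⟨x, hqp hxq, hxv⟩
          exact ⟨x, ⟨p, hpc, hxp⟩, hxuv⟩)
      {x} ⟨by simpa using hx, isPreirreducible_singleton⟩
  have hxm : x ∈ m := hsm rfl
  exact ⟨m, hxm, hm.prop.1, ⟨⟨x, hxm⟩, hm.prop.2⟩,
    fun C' h1 h2 h3 => (hm.eq_of_subset ⟨h2, h3.2⟩ h1).symm⟩

lemma krull_le {σ : Type*} (C : Set (σ → ℂ)) (hC : @IsIrreducible _ (zariskiTop σ) C) :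
    @topologicalKrullDim C
        (TopologicalSpace.induced (fun x => (x : σ → ℂ)) (zariskiTop σ))
      ≤ (Order.coheight (⟨vI C, vI_prime hC⟩ : PrimeSpectrum (MvPolynomial σ ℂ)) : ℕ∞) := by
  let _ := zariskiTop σ
  rw [Order.coheight_eq_krullDim_Ici, ← Order.krullDim_orderDual]
  change Order.krullDim (TopologicalSpace.IrreducibleCloseds C) ≤ _
  have hirr : ∀ Z : TopologicalSpace.IrreducibleCloseds C,
      IsIrreducible (Subtype.val '' (Z : Set C)) := fun Z =>
    Z.isIrreducible'.image _ continuous_subtype_val.continuousOn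
  refine Order.krullDim_le_of_strictMono
    (fun Z => OrderDual.toDual ⟨⟨vI (Subtype.val '' (Z : Set C)), vI_prime (hirr Z)⟩, ?_⟩) ?_
  · change vI C ≤ vI _
    rintro f hf _ ⟨x, _, rfl⟩
    exact hf x x.2
  · intro Z Z' h
    change vI (Subtype.val '' (Z' : Set C)) < vI (Subtype.val '' (Z : Set C))
    refine lt_of_le_not_ge ?_ ?_
    · rintro f hf _ ⟨x, hx, rfl⟩
      exact hf x ⟨x, h.le hx, rfl⟩
    · intro hle
      obtain ⟨x, hx', hx⟩ := Set.not_subset.mp (not_le_of_gt h)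
      obtain ⟨U, hU, hUZ⟩ := isOpen_induced_iff.mp Z.isClosed'.isOpen_compl
      have hxU : (x : σ → ℂ) ∈ U := by
        have : x ∈ (Subtype.val ⁻¹' U : Set C) := by rw [hUZ]; exact hx
        exact this
      obtain ⟨f, hf, hf'⟩ := open_basic U hU x hxU
      have hfZ : f ∈ vI (Subtype.val '' (Z : Set C)) := by
        rintro _ ⟨y, hy, rfl⟩
        by_contra hne
        have : y ∈ (Subtype.val ⁻¹' U : Set C) := hf' _ hne
        rw [hUZ] at this
        exact this hy
      exact hf (hle hfZ x ⟨x, hx', rfl⟩)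

lemma principal {d : ℕ} (P : PrimeSpectrum (MvPolynomial (Fin d) ℂ))
    (hP : P.asIdeal ≠ ⊥) (h : ((d - 1 : ℕ) : ℕ∞) ≤ Order.coheight P) :
    ∃ q : MvPolynomial (Fin d) ℂ, P.asIdeal = Ideal.span {q} := by
  obtain ⟨q, hq, hqp⟩ := P.2.exists_mem_prime_of_ne_bot hP
  refine ⟨q, ?_⟩
  by_contra hne
  let Q : PrimeSpectrum (MvPolynomial (Fin d) ℂ) :=
    ⟨Ideal.span {q}, (Ideal.span_singleton_prime hqp.ne_zero).mpr hqp⟩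
  have hQP : Q < P := by
    refine lt_of_le_of_ne ?_ ?_
    · change Ideal.span {q} ≤ P.asIdeal
      rwa [Ideal.span_singleton_le_iff_mem]
    · rintro rfl
      exact hne rfl
  have hbQ : (⊥ : PrimeSpectrum (MvPolynomial (Fin d) ℂ)) < Q := by
    refine bot_lt_iff_ne_bot.mpr fun h => ?_
    have : Ideal.span {q} = ⊥ := congrArg PrimeSpectrum.asIdeal h
    exact hqp.ne_zero (Ideal.span_singleton_eq_bot.mp this)
  have hht : (2 : ℕ) ≤ Order.height P := by
    have := Order.length_le_height_last
      (p := ((RelSeries.singleton _ (⊥ : PrimeSpectrum (MvPolynomial (Fin d) ℂ))).snoc Q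
        (by simpa using hbQ)).snoc P (by simpa using hQP))
    simpa using this
  have hdim : ringKrullDim (MvPolynomial (Fin d) ℂ) = d := by
    rw [MvPolynomial.ringKrullDim_of_isNoetherianRing]; simp
  have hsum : Order.height P + Order.coheight P ≤ (d : ℕ∞) := by
    have h1 := Order.krullDim_eq_iSup_height_add_coheight_of_nonempty
      (α := PrimeSpectrum (MvPolynomial (Fin d) ℂ))
    change ringKrullDim _ = _ at h1
    rw [hdim] at h1
    have h2 : (d : ℕ∞) = _ := WithBot.coe_injective h1
    rw [h2]
    exact le_iSup (fun a : PrimeSpectrum (MvPolynomial (Fin d) ℂ) =>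
      Order.height a + Order.coheight a) P
  have h3 := (add_le_add hht h).trans hsum
  have h4 : 2 + (d - 1) ≤ d := by exact_mod_cast h3
  omega

lemma eval_polySub (d : ℕ) (A : (Fin d → ℂ) →ₗ[ℂ] (Fin d → ℂ)) (p : MvPolynomial (Fin d) ℂ)
    (x : Fin d → ℂ) : eval x (polySub d A p) = eval (A x) p := by
  have hA : ∀ i, A x i = ∑ j, A (Pi.single j 1) i * x j := by
    intro i
    conv_lhs => rw [pi_eq_sum_univ' x]
    simp [map_sum, Finset.sum_apply, mul_comm]
  unfold polySub
  induction p using MvPolynomial.induction_on with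
  | C a => simp
  | add p q hp hq => rw [map_add, map_add, hp, hq, map_add]
  | mul_X p i hp => rw [map_mul, map_mul, hp, map_mul]; simp [hA]

/-- semi-invariant generator -/
lemma semiinv {d : ℕ} {G : Type*} [Group G]
    (ρ : G →* ((Fin d → ℂ) ≃ₗ[ℂ] (Fin d → ℂ)))
    (D : Set (Fin d → ℂ)) (f₀ : MvPolynomial (Fin d) ℂ) (hf₀ : f₀ ≠ 0) (hf₀D : f₀ ∈ vI D)
    (hloc : ∀ x ∈ D, ∃ q : MvPolynomial (Fin d) ℂ, eval x q = 0 ∧ ∀ h ∈ vI D, q ∣ h)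
    (hst : ∀ (g : G), ∀ x ∈ D, ρ g x ∈ D) :
    ∃ f : MvPolynomial (Fin d) ℂ, f ≠ 0 ∧ f ∈ vI D ∧
      ∃ χ : G → ℂ, ∀ g, polySub d (ρ g).toLinearMap f = C (χ g) * f := by
  obtain ⟨f, ⟨hf0, hfD⟩, hmin⟩ := (wellFounded_dvdNotUnit
    (α := MvPolynomial (Fin d) ℂ)).has_min {f | f ≠ 0 ∧ f ∈ vI D} ⟨f₀, hf₀, hf₀D⟩
  have hdvd : ∀ h ∈ vI D, f ∣ h := by
    intro h hh
    letI := Classical.choice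
      (inferInstance : Nonempty (NormalizedGCDMonoid (MvPolynomial (Fin d) ℂ)))
    have he0 : gcd f h ≠ 0 := fun h0 => hf0 ((gcd_eq_zero_iff _ _).mp h0).1
    have heD : gcd f h ∈ vI D := by
      intro x hx
      obtain ⟨q, hqx, hq⟩ := hloc x hx
      obtain ⟨r, hr⟩ := dvd_gcd (hq f hfD) (hq h hh)
      rw [hr, map_mul, hqx, zero_mul]
    obtain ⟨a, ha⟩ := gcd_dvd_left f h
    have hau : IsUnit a := by
      by_contra hau
      exact hmin _ ⟨he0, heD⟩ ⟨he0, a, hau, ha⟩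
    have : f ∣ gcd f h := by
      obtain ⟨u, rfl⟩ := hau
      exact ⟨↑u⁻¹, by conv_rhs => rw [ha]
                      simp [mul_assoc]⟩
    exact this.trans (gcd_dvd_right f h)
  refine ⟨f, hf0, hfD, ?_⟩
  have hgD : ∀ g, polySub d (ρ g).toLinearMap f ∈ vI D := by
    intro g x hx
    rw [eval_polySub]
    exact hfD _ (hst g x hx)
  have key : ∀ g, ∃ c : ℂ, polySub d (ρ g).toLinearMap f = C c * f := by
    intro g
    obtain ⟨c, hc⟩ := hdvd _ (hgD g)
    obtain ⟨c', hc'⟩ := hdvd _ (hgD g⁻¹)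
    have h1 : polySub d (ρ g).toLinearMap (polySub d (ρ g⁻¹).toLinearMap f) = f := by
      apply MvPolynomial.funext
      intro x
      rw [eval_polySub, eval_polySub]
      congr 2
      change (ρ g⁻¹ * ρ g) x = x
      rw [← map_mul]; simp
    rw [hc', map_mul, hc, mul_assoc] at h1
    have h2 : c * polySub d (ρ g).toLinearMap c' = 1 := mul_left_cancel₀ hf0 (by rw [h1, mul_one])
    have hcu : IsUnit c := IsUnit.of_mul_eq_one _ h2
    obtain ⟨r, _, hr⟩ := MvPolynomial.isUnit_iff_eq_C_of_isReduced.mp hcu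
    exact ⟨r, by rw [hc, hr, mul_comm]⟩
  choose χ hχ using key
  exact ⟨χ, hχ⟩


lemma dual_poly {d : ℕ} (N : ℕ) (l : MvPolynomial (Fin d) ℂ →ₗ[ℂ] ℂ) :
    ∃ F : MvPolynomial (Fin d) ℂ,
      (∀ b : Fin d → ℂ, eval b F = l (∑ k ∈ Finset.range (N + 1), (∑ j, C (b j) * X j) ^ k)) ∧
      (F = 0 → ∀ p ∈ restrictTotalDegree (Fin d) ℂ N, l p = 0) := by
  refine ⟨∑ k ∈ Finset.range (N + 1), ∑ a ∈ Finset.piAntidiag Finset.univ k,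
    monomial (Finsupp.equivFunOnFinite.symm a) ((Nat.multinomial Finset.univ a : ℂ) *
      l (monomial (Finsupp.equivFunOnFinite.symm a) 1)), ?_, ?_⟩
  · intro b
    simp only [map_sum, Finset.sum_pow_eq_sum_piAntidiag]
    refine Finset.sum_congr rfl fun k _ => Finset.sum_congr rfl fun a _ => ?_
    have h1 : ((Nat.multinomial Finset.univ a : ℕ) : MvPolynomial (Fin d) ℂ) *
        ∏ i, (C (b i) * X i) ^ a i = ((Nat.multinomial Finset.univ a : ℂ) * ∏ i, b i ^ a i) •
          monomial (Finsupp.equivFunOnFinite.symm a) (1 : ℂ) := by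
      rw [MvPolynomial.monomial_eq, smul_eq_C_mul]
      simp only [mul_pow, Finset.prod_mul_distrib, map_mul, map_prod, map_pow, map_natCast, C_1,
        one_mul, mul_assoc]
      rw [Finsupp.prod_fintype _ _ (by simp)]
      simp
    rw [h1, map_smul, eval_monomial, Finsupp.prod_fintype _ _ (by simp)]
    simp only [Finsupp.coe_equivFunOnFinite_symm, smul_eq_mul]
    ring
  · intro hF p hp
    have hmon : ∀ s : Fin d →₀ ℕ, s.degree ≤ N → l (monomial s 1) = 0 := by
      intro s hs
      have h0 := congrArg (coeff s) hF
      simp only [coeff_sum, coeff_monomial, coeff_zero] at h0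
      have hdeg : ∑ i, s i = s.degree := (Finsupp.degree_eq_sum s).symm
      rw [Finset.sum_eq_single s.degree, Finset.sum_eq_single (s : Fin d → ℕ)] at h0
      · rw [if_pos (by ext; simp)] at h0
        have hm : ((Nat.multinomial Finset.univ s : ℕ) : ℂ) ≠ 0 :=
          Nat.cast_ne_zero.mpr (Nat.multinomial_pos _ _).ne'
        have := (mul_eq_zero.mp h0).resolve_left hm
        convert this
        ext; simp
      · intro a _ hne
        rw [if_neg]
        rintro rfl
        exact hne (by ext; simp)
      · intro h
        exact absurd (by simp [hdeg]) h
      · intro k _ hk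
        refine Finset.sum_eq_zero fun a ha => if_neg ?_
        rintro rfl
        rw [Finset.mem_piAntidiag] at ha
        exact hk (by rw [← ha.1, ← hdeg]; simp)
      · intro h
        exact absurd (by simpa [Nat.lt_succ_iff] using hs) h
    rw [mem_restrictTotalDegree] at hp
    rw [p.as_sum, map_sum]
    refine Finset.sum_eq_zero fun s hs => ?_
    have : monomial s (coeff s p) = coeff s p • monomial s (1 : ℂ) := by
      rw [smul_monomial, smul_eq_mul, mul_one]
    rw [this, map_smul, hmon s, smul_zero]
    refine le_trans ?_ hp
    have := le_totalDegree hs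
    simpa [Finsupp.degree_eq_sum, Finsupp.sum_fintype] using this

lemma linform_deg {d : ℕ} (b : Fin d → ℂ) (N : ℕ) :
    (∑ k ∈ Finset.range (N + 1), (∑ j, C (b j) * X j) ^ k : MvPolynomial (Fin d) ℂ) ∈
      restrictTotalDegree (Fin d) ℂ N := by
  refine Submodule.sum_mem _ fun k hk => ?_
  rw [mem_restrictTotalDegree]
  refine (totalDegree_pow _ _).trans ?_
  have h1 : (∑ j, C (b j) * X j : MvPolynomial (Fin d) ℂ).totalDegree ≤ 1 := by
    refine totalDegree_finsetSum_le fun j _ => ?_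
    refine (totalDegree_mul _ _).trans ?_
    simp
  have := Finset.mem_range.mp hk
  calc k * _ ≤ k * 1 := Nat.mul_le_mul_left _ h1
    _ ≤ N := by omega

end SDInv

/-- For a self-dual representation `V` of a (linearly) reductive group `G`, every
`G`-stable divisor `D ⊂ V` (a Zariski-closed proper subset all of whose irreducible
components have dimension `d − 1`) is contained in the zero set of a nonzero
`G`-invariant polynomial. -/
theorem selfdual_invariant_vanishing_on_stable_divisor
    (d : ℕ) (G : Type*) [Group G]
    (ρ : G →* ((Fin d → ℂ) ≃ₗ[ℂ] (Fin d → ℂ)))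
    -- self-duality: an invariant nondegenerate bilinear form
    (B : (Fin d → ℂ) →ₗ[ℂ] (Fin d → ℂ) →ₗ[ℂ] ℂ)
    (hBnd : ∀ v, (∀ w, B v w = 0) → v = 0)
    (hBnd' : ∀ w, (∀ v, B v w = 0) → w = 0)
    (hBinv : ∀ (g : G) (u w : Fin d → ℂ), B (ρ g u) (ρ g w) = B u w)
    -- linear reductivity
    (hred : ∀ (N : ℕ) (W : Submodule ℂ (MvPolynomial (Fin d) ℂ)),
      W ≤ MvPolynomial.restrictTotalDegree (Fin d) ℂ N →
      (∀ (g : G), ∀ f ∈ W, polySub d (ρ g).toLinearMap f ∈ W) →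
      ∃ W' : Submodule ℂ (MvPolynomial (Fin d) ℂ),
        (∀ (g : G), ∀ f ∈ W', polySub d (ρ g).toLinearMap f ∈ W') ∧
        W ⊓ W' = ⊥ ∧ W ⊔ W' = MvPolynomial.restrictTotalDegree (Fin d) ℂ N)
    -- D is a G-stable divisor
    (D : Set (Fin d → ℂ))
    (hDclosed : @IsClosed _ (zariskiTop (Fin d)) D)
    (hDne : D.Nonempty)
    (hDproper : D ≠ Set.univ)
    (hDpure : ∀ C : Set (Fin d → ℂ), C ⊆ D →
      @IsIrreducible _ (zariskiTop (Fin d)) C →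
      (∀ C', C ⊆ C' → C' ⊆ D → @IsIrreducible _ (zariskiTop (Fin d)) C' → C' = C) →
      @topologicalKrullDim C
        (TopologicalSpace.induced (fun x => (x : Fin d → ℂ)) (zariskiTop (Fin d)))
        = ((d - 1 : ℕ) : ℕ∞))
    (hDstable : ∀ g : G, (fun x => ρ g x) '' D = D) :
    ∃ f : MvPolynomial (Fin d) ℂ, f ≠ 0 ∧
      (∀ (g : G) (x : Fin d → ℂ), eval (ρ g x) f = eval x f) ∧
      ∀ x ∈ D, eval x f = 0 := by
  classical
  -- a nonzero polynomial vanishing on D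
  obtain ⟨y, hy⟩ := (Set.ne_univ_iff_exists_notMem D).mp hDproper
  obtain ⟨f₀, hf₀y, hf₀⟩ := SDInv.open_basic Dᶜ
    (@IsClosed.isOpen_compl _ (zariskiTop (Fin d)) D hDclosed) y hy
  have hf₀0 : f₀ ≠ 0 := by
    rintro rfl
    simp at hf₀y
  have hf₀D : f₀ ∈ SDInv.vI D := fun x hx => by
    by_contra hne
    exact hf₀ x hne hx
  have hloc : ∀ x ∈ D, ∃ q : MvPolynomial (Fin d) ℂ, eval x q = 0 ∧
      ∀ h ∈ SDInv.vI D, q ∣ h := by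
    intro x hx
    obtain ⟨Z, hxZ, hZD, hZ, hmax⟩ := @SDInv.exists_max _ (zariskiTop (Fin d)) D x hx
    have hdim := hDpure Z hZD hZ hmax
    have hle := SDInv.krull_le Z hZ
    rw [hdim] at hle
    have hsub : SDInv.vI D ≤ SDInv.vI Z := fun h hh z hz => hh z (hZD hz)
    obtain ⟨q, hq⟩ := SDInv.principal ⟨SDInv.vI Z, SDInv.vI_prime hZ⟩
      (fun hbot => hf₀0 (by
        have : f₀ ∈ SDInv.vI Z := hsub hf₀D
        rw [show SDInv.vI Z = ⊥ from hbot] at this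
        exact this)) (WithBot.coe_le_coe.mp hle)
    change SDInv.vI Z = _ at hq
    refine ⟨q, ?_, fun h hh => ?_⟩
    · have : q ∈ SDInv.vI Z := by rw [hq]; exact Ideal.mem_span_singleton_self q
      exact this x hxZ
    · have := hsub hh
      rwa [hq, Ideal.mem_span_singleton] at this
  obtain ⟨f, hf0, hfD, χ, hχ⟩ := SDInv.semiinv ρ D f₀ hf₀0 hf₀D hloc
    (fun g x hx => by rw [← hDstable g]; exact ⟨x, hx, rfl⟩)
  have hfN : f ∈ restrictTotalDegree (Fin d) ℂ f.totalDegree := by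
    rw [mem_restrictTotalDegree]
  obtain ⟨W', hW'st, hinf, hsup⟩ := hred f.totalDegree (Submodule.span ℂ {f})
    (by rwa [Submodule.span_singleton_le_iff_mem])
    (by
      intro g p hp
      obtain ⟨c, rfl⟩ := Submodule.mem_span_singleton.mp hp
      rw [map_smul, hχ, ← smul_eq_C_mul]
      exact Submodule.smul_mem _ _ (Submodule.smul_mem _ _ (Submodule.mem_span_singleton_self f)))
  have hfW' : f ∉ W' := by
    intro h
    have : f ∈ Submodule.span ℂ {f} ⊓ W' := ⟨Submodule.mem_span_singleton_self f, h⟩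
    rw [hinf] at this
    exact hf0 this
  obtain ⟨l, hlf, hlW⟩ := Submodule.exists_le_ker_of_notMem hfW'
  have hl : ∀ g, ∀ p ∈ restrictTotalDegree (Fin d) ℂ f.totalDegree,
      l (polySub d (ρ g).toLinearMap p) = χ g * l p := by
    intro g p hp
    rw [← hsup] at hp
    obtain ⟨u, hu, w, hw, rfl⟩ := Submodule.mem_sup.mp hp
    obtain ⟨c, rfl⟩ := Submodule.mem_span_singleton.mp hu
    have h1 : l w = 0 := hlW hw
    have h2 : l (polySub d (ρ g).toLinearMap w) = 0 := hlW (hW'st g w hw)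
    rw [map_add, map_add, map_add, h1, h2, map_smul, map_smul, map_smul, hχ, ← smul_eq_C_mul,
      map_smul]
    simp only [smul_eq_mul]
    ring
  obtain ⟨F, hFe, hF0⟩ := SDInv.dual_poly f.totalDegree l
  have hFne : F ≠ 0 := fun h => hlf (hF0 h f hfN)
  let A : (Fin d → ℂ) →ₗ[ℂ] (Fin d → ℂ) :=
    LinearMap.pi fun j => B.flip (Pi.single j 1)
  have hA : ∀ v j, A v j = B v (Pi.single j 1) := fun v j => rfl
  have hB : ∀ v x, B v x = ∑ j, A v j * x j := by
    intro v x
    conv_lhs => rw [pi_eq_sum_univ' x]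
    simp [hA, map_sum, mul_comm]
  have hAinj : Function.Injective A := by
    rw [injective_iff_map_eq_zero]
    intro v hv
    apply hBnd
    intro w
    rw [hB, hv]; simp
  have hAsurj : Function.Surjective A := LinearMap.surjective_of_injective hAinj
  have hfs0 : polySub d A F ≠ 0 := by
    intro h
    apply hFne
    apply MvPolynomial.funext
    intro x
    obtain ⟨v, rfl⟩ := hAsurj x
    rw [← SDInv.eval_polySub, h]; simp
  have hfs : ∀ g v, eval v (polySub d A F) = χ g * eval (ρ g v) (polySub d A F) := by
    intro g v
    rw [SDInv.eval_polySub, SDInv.eval_polySub, hFe, hFe, ← hl g _ (SDInv.linform_deg _ _)]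
    congr 1
    simp only [map_sum, map_pow]
    refine Finset.sum_congr rfl fun k _ => ?_
    congr 1
    rw [← map_sum]
    apply MvPolynomial.funext
    intro x
    rw [SDInv.eval_polySub]
    have h1 := hBinv g v x
    rw [hB, hB] at h1
    simpa using h1.symm
  refine ⟨f * polySub d A F, mul_ne_zero hf0 hfs0, ?_, ?_⟩
  · intro g x
    have h1 : eval (ρ g x) f = χ g * eval x f := by
      have := congrArg (eval x) (hχ g)
      rw [SDInv.eval_polySub] at this
      simpa using this
    rw [map_mul, map_mul, h1, hfs g x]
    ring
  · intro x hx
    rw [map_mul, hfD x hx, zero_mul]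
end
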